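/- Let R be a finite chain ring of length m with maximal ideal N and residue field F_q, let t, k, n be integers with 1 ≤ t < k ≤ n/2, and let 𝓕 be a family of free rank-k submodules of R^n such that any two members of 𝓕 contain a common free submodule of rank t. If |𝓕| = q^{(m−1)(k−t)(n−k)} · [n−t choose k−t]_q, then 𝓕 is one of the following: (a) the set of all free rank-k submodules of R^n containing a fixed free submodule of rank t; or (b) n = 2k and 𝓕 is the set of all free rank-k submodules contained in a fixed free submodule of R^n of rank 2k−t. -/

import Mathlib

/-- Powers of a (left) ideal of a possibly noncommutative ring:
`idealPow N 0 = ⊤` and `idealPow N (i+1) = (idealPow N i) * N`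
(the left ideal generated by the products `a * b` with `a ∈ N^i`, `b ∈ N`). -/
def idealPow {R : Type*} [Ring R] (N : Ideal R) : ℕ → Ideal R
  | 0 => ⊤
  | i + 1 => Submodule.span R {x | ∃ a ∈ idealPow N i, ∃ b ∈ N, x = a * b}

/-- The Gaussian binomial coefficient
`[n choose k]_q = ∏_{i=0}^{k-1} (q^{n-i} - 1) / (q^{k-i} - 1)`
(the quotient of the two integer products; it is an exact division). -/
def gaussBinom (q n k : ℕ) : ℕ :=
  (∏ i ∈ Finset.range k, (q ^ (n - i) - 1)) / ∏ i ∈ Finset.range k, (q ^ (k - i) - 1)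

section EKRA1
set_option linter.unusedSectionVars false
set_option linter.deprecated false
open Finset Module
open scoped Classical

namespace EKR

/-- q-number -/
def br (q r : ℕ) : ℕ := ∑ i ∈ Finset.range r, q ^ i

@[simp] lemma br_zero (q : ℕ) : br q 0 = 0 := by simp [br]
@[simp] lemma br_one (q : ℕ) : br q 1 = 1 := by simp [br]
lemma br_succ (q r : ℕ) : br q (r+1) = br q r + q ^ r := by simp [br, Finset.sum_range_succ]
lemma br_add (q a b : ℕ) : br q (a+b) = br q a + q ^ a * br q b := by
  simp [br, Finset.sum_range_add, Finset.mul_sum, pow_add]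
lemma br_succ' (q r : ℕ) : br q (r+1) = 1 + q * br q r := by
  rw [add_comm, br_add]; simp
lemma br_pos {q r : ℕ} (hr : 0 < r) : 0 < br q r := by
  obtain ⟨s, rfl⟩ : ∃ s, r = s+1 := ⟨r-1, by omega⟩
  rw [br_succ']; omega
lemma br_mul (q r : ℕ) : (q:ℤ) ^ r - 1 = (q - 1) * br q r := by
  induction r with
  | zero => simp
  | succ r ih => rw [br_succ]; push_cast; rw [mul_add, ← ih]; ring
lemma br_mono {q a b : ℕ} (h : a ≤ b) : br q a ≤ br q b := by
  obtain ⟨c, rfl⟩ := Nat.exists_eq_add_of_le h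
  rw [br_add]; omega

variable {K V : Type*} [Field K] [Finite K] [AddCommGroup V] [Module K V] [Finite V]

noncomputable instance instFS : Fintype (Submodule K V) := Fintype.ofFinite _

lemma q_pos : 2 ≤ Nat.card K := by
  have : 1 < Nat.card K := Finite.one_lt_card
  omega

lemma card_vec (A : Submodule K V) : (Set.ncard (A : Set V)) = Nat.card K ^ finrank K A := by
  rw [← Module.natCard_eq_pow_finrank (K := K) (V := A)]
  rfl

lemma card_diff {A B : Submodule K V} (h : A ≤ B) :
    Set.ncard ((B : Set V) \ A) + Nat.card K ^ finrank K A = Nat.card K ^ finrank K B := by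
  rw [← card_vec, ← card_vec]
  exact Set.ncard_sdiff_add_ncard_of_subset h (Set.toFinite _)

lemma sup_span_dim (A : Submodule K V) {v : V} (hv : v ∉ A) :
    finrank K ↥(A ⊔ Submodule.span K {v}) = finrank K A + 1 := by
  have h1 := Submodule.finrank_sup_add_finrank_inf_eq A (Submodule.span K {v})
  have hv0 : v ≠ 0 := by rintro rfl; exact hv A.zero_mem
  rw [finrank_span_singleton hv0] at h1
  have : A ⊓ Submodule.span K {v} = ⊥ := by
    rw [eq_bot_iff]
    rintro x ⟨hx, hx'⟩
    obtain ⟨c, rfl⟩ := Submodule.mem_span_singleton.1 hx'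
    by_cases hc : c = 0
    · simp [hc]
    · exact (hv ((Submodule.smul_mem_iff A hc).1 hx)).elim
  rw [this, finrank_bot] at h1
  omega

lemma eq_sup_span {A x : Submodule K V} (hA : A ≤ x) (hd : finrank K x = finrank K A + 1) {v : V} (hv : v ∈ x)
    (hv' : v ∉ A) : A ⊔ Submodule.span K {v} = x := by
  apply Submodule.eq_of_le_of_finrank_eq
  · exact sup_le hA (by simpa using hv)
  · rw [sup_span_dim A hv', hd]

/-- atoms -/
noncomputable def atoms (A B : Submodule K V) : Finset (Submodule K V) :=
  univ.filter fun x => A ≤ x ∧ x ≤ B ∧ finrank K x = finrank K A + 1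
noncomputable def coatoms (A B : Submodule K V) : Finset (Submodule K V) :=
  univ.filter fun x => A ≤ x ∧ x ≤ B ∧ finrank K x + 1 = finrank K B

lemma mem_atoms {A B x : Submodule K V} : x ∈ atoms A B ↔ A ≤ x ∧ x ≤ B ∧ finrank K x = finrank K A + 1 := by
  simp [atoms]
lemma mem_coatoms {A B x : Submodule K V} : x ∈ coatoms A B ↔ A ≤ x ∧ x ≤ B ∧ finrank K x + 1 = finrank K B := by
  simp [coatoms]

lemma card_atoms {A B : Submodule K V} (h : A ≤ B) :
    (atoms A B).card = br (Nat.card K) (finrank K B - finrank K A) := by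
  set q := Nat.card K with hq
  have hq2 : 2 ≤ q := q_pos
  set s : Finset V := ((B : Set V) \ A).toFinite.toFinset with hs
  have hsc : s.card + q ^ finrank K A = q ^ finrank K B := by
    rw [← card_diff h, Set.ncard_eq_toFinset_card _]
  have hmaps : ∀ v ∈ s, A ⊔ Submodule.span K {v} ∈ atoms A B := by
    intro v hv
    simp only [hs, Set.Finite.mem_toFinset, Set.mem_diff, SetLike.mem_coe] at hv
    rw [mem_atoms]
    refine ⟨le_sup_left, sup_le h (by simpa using hv.1), sup_span_dim A hv.2⟩
  have := Finset.card_eq_sum_card_fiberwise hmaps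
  have h2 : ∀ x ∈ atoms A B, (s.filter fun v => A ⊔ Submodule.span K {v} = x).card + q ^ finrank K A
      = q ^ (finrank K A + 1) := by
    intro x hx
    rw [mem_atoms] at hx
    rw [← hx.2.2, ← card_diff hx.1, Set.ncard_eq_toFinset_card _]
    congr 2
    ext v
    simp only [hs, mem_filter, Set.Finite.mem_toFinset, Set.mem_diff, SetLike.mem_coe]
    constructor
    · rintro ⟨⟨h1, h2⟩, rfl⟩
      exact ⟨Submodule.mem_sup_right (Submodule.mem_span_singleton_self v), h2⟩
    · rintro ⟨h1, h2⟩
      exact ⟨⟨hx.2.1 h1, h2⟩, eq_sup_span hx.1 hx.2.2 h1 h2⟩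
  have h3 : ∀ x ∈ atoms A B, (s.filter fun v => A ⊔ Submodule.span K {v} = x).card
      = q ^ (finrank K A + 1) - q ^ finrank K A := fun x hx => by have := h2 x hx; omega
  rw [Finset.sum_congr rfl h3, sum_const, smul_eq_mul] at this
  obtain ⟨r, hr⟩ := Nat.exists_eq_add_of_le (Submodule.finrank_mono h)
  rw [hr] at hsc ⊢
  rw [Nat.add_sub_cancel_left]
  have e1 := br_mul q r
  have hle : q ^ finrank K A ≤ q ^ (finrank K A + 1) := Nat.pow_le_pow_right (by omega) (by omega)
  rw [this] at hsc
  zify [hle] at hsc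
  have hp : (0:ℤ) < (q:ℤ) ^ finrank K A := by positivity
  have hq1 : (0:ℤ) < (q:ℤ) - 1 := by omega
  zify
  have : ((q:ℤ) ^ finrank K A * (q-1)) * (atoms A B).card = ((q:ℤ) ^ finrank K A * (q-1)) * br q r := by
    rw [mul_assoc _ _ (br q r : ℤ), ← e1]
    rw [pow_add, pow_add] at hsc
    linarith
  exact mul_left_cancel₀ (by positivity) this

lemma exists_atom {A B : Submodule K V} (h : A ≤ B) (hlt : finrank K A < finrank K B) :
    ∃ x, A ≤ x ∧ x ≤ B ∧ finrank K x = finrank K A + 1 := by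
  have : 0 < (atoms A B).card := by
    rw [card_atoms h]; exact br_pos (by omega)
  obtain ⟨x, hx⟩ := Finset.card_pos.1 this
  exact ⟨x, mem_atoms.1 hx⟩

lemma exists_between {A B : Submodule K V} (h : A ≤ B) (r : ℕ) (h1 : finrank K A ≤ r) (h2 : r ≤ finrank K B) :
    ∃ x, A ≤ x ∧ x ≤ B ∧ finrank K x = r := by
  induction r, h1 using Nat.le_induction with
  | base => exact ⟨A, le_rfl, h, rfl⟩
  | succ r hr ih =>
    obtain ⟨x, hx1, hx2, hx3⟩ := ih (by omega)
    obtain ⟨y, hy1, hy2, hy3⟩ := exists_atom hx2 (by omega)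
    exact ⟨y, hx1.trans hy1, hy2, by omega⟩

lemma card_coatoms {A B : Submodule K V} (h : A ≤ B) :
    (coatoms A B).card = br (Nat.card K) (finrank K B - finrank K A) := by
  obtain ⟨r, hr⟩ := Nat.exists_eq_add_of_le (Submodule.finrank_mono h)
  induction r generalizing A with
  | zero =>
    rw [hr]; simp only [add_zero, Nat.sub_self, br_zero, Finset.card_eq_zero]
    rw [Finset.eq_empty_iff_forall_notMem]
    intro x hx
    rw [mem_coatoms] at hx
    have := Submodule.finrank_mono hx.1
    omega
  | succ r ih =>
    rcases Nat.eq_zero_or_pos r with rfl | hrpos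
    · rw [hr]; simp only [zero_add, Nat.add_sub_cancel_left, br_one, Finset.card_eq_one]
      refine ⟨A, ?_⟩
      ext x
      rw [mem_coatoms, mem_singleton]
      constructor
      · rintro ⟨h1, h2, h3⟩
        exact (Submodule.eq_of_le_of_finrank_eq h1 (by omega)).symm
      · rintro rfl; exact ⟨le_rfl, h, by omega⟩
    · have key := Finset.card_mul_eq_card_mul (s := atoms A B) (t := coatoms A B) (fun a c => a ≤ c)
        (m := br (Nat.card K) r) (n := br (Nat.card K) r) ?_ ?_
      · rw [card_atoms h] at key
        exact (Nat.eq_of_mul_eq_mul_right (br_pos hrpos) key).symm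
      · intro a ha
        rw [mem_atoms] at ha
        have := ih ha.2.1 (by omega)
        rw [show finrank K B - finrank K a = r by omega] at this
        rw [← this]
        congr 1
        ext x
        simp only [Finset.bipartiteAbove, mem_filter, mem_coatoms]
        constructor
        · rintro ⟨⟨h1, h2, h3⟩, h4⟩; exact ⟨h4, h2, h3⟩
        · rintro ⟨h1, h2, h3⟩; exact ⟨⟨ha.1.trans h1, h2, h3⟩, h1⟩
      · intro c hc
        rw [mem_coatoms] at hc
        have := card_atoms hc.1
        rw [show finrank K c - finrank K A = r by omega] at this
        rw [← this]
        congr 1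
        ext x
        simp only [Finset.bipartiteBelow, mem_filter, mem_atoms]
        constructor
        · rintro ⟨⟨h1, h2, h3⟩, h4⟩; exact ⟨h1, h4, h3⟩
        · rintro ⟨h1, h2, h3⟩; exact ⟨⟨h1, h2.trans hc.2.1, h3⟩, h2⟩

/-- C1 -/
lemma card_C1 {P F E : Submodule K V} (hPF : P ≤ F) (hFE : F ≤ E) (h1 : finrank K F = finrank K P + 1)
    (h2 : finrank K E = finrank K F + 1) :
    (univ.filter fun z : Submodule K V => finrank K z = finrank K F ∧ z ⊓ F = P ∧ z ⊔ F = E).card = Nat.card K := by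
  have h := card_atoms (hPF.trans hFE)
  rw [show finrank K E - finrank K P = 2 by omega] at h
  have : (univ.filter fun z : Submodule K V => finrank K z = finrank K F ∧ z ⊓ F = P ∧ z ⊔ F = E) = (atoms P E).erase F := by
    ext z
    simp only [mem_filter, mem_univ, true_and, mem_erase, mem_atoms]
    constructor
    · rintro ⟨h0, rfl, rfl⟩
      refine ⟨?_, inf_le_left, le_sup_left, by omega⟩
      rintro rfl
      rw [inf_idem] at h1
      omega
    · rintro ⟨hne, h3, h4, h5⟩
      have hd := Submodule.finrank_sup_add_finrank_inf_eq z F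
      have hi : finrank K ↥(z ⊓ F) < finrank K F := by
        apply lt_of_le_of_ne (Submodule.finrank_mono inf_le_right)
        intro he
        have h6 : z ⊓ F = F := Submodule.eq_of_le_of_finrank_eq inf_le_right he
        have h7 : F ≤ z := by rw [← h6]; exact inf_le_left
        exact hne (Submodule.eq_of_le_of_finrank_eq h7 (by omega)).symm
      have h8 := Submodule.finrank_mono (le_inf h3 hPF)
      have h9 : P = z ⊓ F := Submodule.eq_of_le_of_finrank_eq (le_inf h3 hPF) (by omega)
      have h10 : z ⊔ F = E := Submodule.eq_of_le_of_finrank_eq (sup_le h4 hFE) (by omega)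
      exact ⟨by omega, h9.symm, h10⟩
  rw [this, Finset.card_erase_of_mem, h]
  · simp [br_succ]
  · rw [mem_atoms]; exact ⟨hPF, hFE, h1⟩

lemma adj_sup {F z : Submodule K V} (h1 : finrank K z = finrank K F) (h2 : finrank K ↥(z ⊓ F) + 1 = finrank K F) :
    finrank K ↥(z ⊔ F) = finrank K F + 1 := by
  have hd := Submodule.finrank_sup_add_finrank_inf_eq z F
  omega

/-- C3 -/
lemma card_C3 {S F W : Submodule K V} (hSF : S ≤ F) (hFW : F ≤ W) :
    (univ.filter fun z : Submodule K V => finrank K z = finrank K F ∧ finrank K ↥(z ⊓ F) + 1 = finrank K F ∧ S ≤ z ∧ z ≤ W).card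
      = Nat.card K * br (Nat.card K) (finrank K F - finrank K S) * br (Nat.card K) (finrank K W - finrank K F) := by
  rw [Finset.card_eq_sum_card_fiberwise (f := fun z => (z ⊓ F, z ⊔ F)) (t := coatoms S F ×ˢ atoms F W)]
  · rw [Finset.sum_congr rfl (g := fun _ => Nat.card K)]
    · rw [sum_const, card_product, card_coatoms hSF, card_atoms hFW, smul_eq_mul]; ring
    · rintro ⟨P, E⟩ hPE
      rw [mem_product, mem_coatoms, mem_atoms] at hPE
      obtain ⟨⟨h1, h2, h3⟩, h4, h5, h6⟩ := hPE
      dsimp only at h1 h2 h3 h4 h5 h6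
      rw [← card_C1 h2 h4 h3.symm h6]
      congr 1
      ext z
      simp only [mem_filter, mem_univ, true_and, Prod.mk.injEq]
      constructor
      · rintro ⟨⟨a1, a2, a3, a4⟩, a5, a6⟩; exact ⟨a1, a5, a6⟩
      · rintro ⟨a1, rfl, rfl⟩; exact ⟨⟨a1, h3, h1.trans inf_le_left, le_sup_left.trans h5⟩, rfl, rfl⟩
  · intro z hz
    simp only [coe_filter, mem_univ, true_and, Set.mem_setOf_eq] at hz
    simp only [coe_product, Set.mem_prod, mem_coe, mem_coatoms, mem_atoms]
    exact ⟨⟨le_inf hz.2.2.1 hSF, inf_le_right, hz.2.1⟩, le_sup_right, sup_le hz.2.2.2 hFW, adj_sup hz.1 hz.2.1⟩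

/-- C4 -/
lemma card_C4 {S F : Submodule K V} (hSF : finrank K ↥(S ⊓ F) + 1 = finrank K S) (hle : finrank K S ≤ finrank K F):
    (univ.filter fun z : Submodule K V => finrank K z = finrank K F ∧ finrank K ↥(z ⊓ F) + 1 = finrank K F ∧ S ≤ z).card
      = br (Nat.card K) (finrank K F + 1 - finrank K S) := by
  rw [show finrank K F + 1 - finrank K S = finrank K F - finrank K ↥(S ⊓ F) by omega,
    ← card_coatoms (inf_le_right : S ⊓ F ≤ F)]
  have hPS : ∀ P : Submodule K V, S ⊓ F ≤ P → P ≤ F → P ⊓ S = S ⊓ F := fun P h1 h2 =>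
    le_antisymm (le_inf inf_le_right (inf_le_left.trans h2)) (le_inf h1 inf_le_left)
  apply Finset.card_nbij' (fun z => z ⊓ F) (fun P => P ⊔ S)
  · intro z hz
    simp only [coe_filter, mem_univ, true_and, Set.mem_setOf_eq] at hz
    simp only [mem_coe, mem_coatoms]
    exact ⟨inf_le_inf_right _ hz.2.2, inf_le_right, hz.2.1⟩
  · intro P hP
    simp only [mem_coe, mem_coatoms] at hP
    simp only [coe_filter, mem_univ, true_and, Set.mem_setOf_eq]
    have h1 := Submodule.finrank_sup_add_finrank_inf_eq P S
    rw [hPS P hP.1 hP.2.1] at h1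
    have h2 : (P ⊔ S) ⊓ F = P := by
      rw [sup_inf_assoc_of_le S hP.2.1]; exact sup_eq_left.2 hP.1
    refine ⟨by omega, ?_, le_sup_right⟩
    rw [h2]; exact hP.2.2
  · intro z hz
    simp only [coe_filter, mem_univ, true_and, Set.mem_setOf_eq] at hz
    dsimp only
    apply Submodule.eq_of_le_of_finrank_eq (sup_le inf_le_left hz.2.2)
    have h1 := Submodule.finrank_sup_add_finrank_inf_eq (z ⊓ F) S
    rw [hPS _ (inf_le_inf_right _ hz.2.2) inf_le_right] at h1
    omega
  · intro P hP
    simp only [mem_coe, mem_coatoms] at hP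
    dsimp only
    rw [sup_inf_assoc_of_le S hP.2.1]; exact sup_eq_left.2 hP.1

lemma card_C5 {S F : Submodule K V} (hSF : finrank K ↥(S ⊓ F) + 1 < finrank K S) :
    (univ.filter fun z : Submodule K V => finrank K z = finrank K F ∧ finrank K ↥(z ⊓ F) + 1 = finrank K F ∧ S ≤ z) = ∅ := by
  rw [Finset.eq_empty_iff_forall_notMem]
  intro z hz
  simp only [mem_filter, mem_univ, true_and] at hz
  have h1 := Submodule.finrank_sup_add_finrank_inf_eq S (z ⊓ F)
  have h2 : S ⊓ (z ⊓ F) = S ⊓ F := by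
    rw [← inf_assoc, inf_eq_left.2 hz.2.2]
  rw [h2] at h1
  have h3 := Submodule.finrank_mono (sup_le hz.2.2 (inf_le_left : z ⊓ F ≤ z))
  omega

end EKR
end EKRA1

section EKRA2
set_option linter.unusedSectionVars false
set_option linter.deprecated false
open Finset Module
open scoped Classical

namespace EKR

def mu (q : ℕ) : ℕ → ℝ
  | 0 => 1
  | s+1 => - (q:ℝ)^s * mu q s

variable {K V : Type*} [Field K] [Finite K] [AddCommGroup V] [Module K V] [Finite V]

lemma card_C7 {p S : Submodule K V} (hp : finrank K p = 1) (hpS : p ≤ S) :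
    (univ.filter fun R : Submodule K V => R ≤ S ∧ ¬ p ≤ R ∧ R ⊔ p = S).card = Nat.card K ^ (finrank K S - 1) := by
  have h1 := card_coatoms (bot_le : ⊥ ≤ S)
  have h2 := card_coatoms hpS
  have h0 := Submodule.finrank_mono hpS
  obtain ⟨s, hs⟩ : ∃ s, finrank K S = s + 1 := ⟨finrank K S - 1, by omega⟩
  rw [hp, hs, Nat.add_sub_cancel] at h2
  rw [finrank_bot, hs, Nat.sub_zero, br_succ] at h1
  have h3 : (univ.filter fun R : Submodule K V => R ≤ S ∧ ¬ p ≤ R ∧ R ⊔ p = S) = coatoms ⊥ S \ coatoms p S := by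
    ext R
    simp only [mem_filter, mem_univ, true_and, mem_sdiff, mem_coatoms, bot_le]
    have key : ¬ p ≤ R → R ⊓ p = ⊥ := by
      intro hpR
      have : finrank K ↥(R ⊓ p) < 1 := by
        rw [← hp]
        apply Submodule.finrank_lt_finrank_of_lt
        exact lt_of_le_of_ne inf_le_right (fun h => hpR (by rw [← h]; exact inf_le_left))
      exact Submodule.finrank_eq_zero.1 (by omega)
    constructor
    · rintro ⟨a1, a2, a3⟩
      have hd := Submodule.finrank_sup_add_finrank_inf_eq R p
      rw [key a2, finrank_bot, a3] at hd
      exact ⟨⟨a1, by omega⟩, fun h => a2 h.1⟩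
    · rintro ⟨⟨a1, a2⟩, a3⟩
      have hpR : ¬ p ≤ R := fun h => a3 ⟨h, a1, a2⟩
      refine ⟨a1, hpR, ?_⟩
      have hd := Submodule.finrank_sup_add_finrank_inf_eq R p
      rw [key hpR, finrank_bot] at hd
      exact Submodule.eq_of_le_of_finrank_eq (sup_le a1 hpS) (by omega)
  rw [h3, card_sdiff_of_subset, h1, h2, hs]
  · simp
  · intro R
    simp only [mem_coatoms]
    exact fun h => ⟨bot_le, h.2⟩

lemma moebius (W : Submodule K V) :
    ∑ R ∈ univ.filter (fun R : Submodule K V => R ≤ W), mu (Nat.card K) (finrank K R) = if W = ⊥ then 1 else 0 := by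
  split_ifs with hW
  · subst hW
    have : univ.filter (fun R : Submodule K V => R ≤ ⊥) = {⊥} := by
      ext R; simp
    rw [this]; simp [mu]
  · obtain ⟨p, -, hpW, hp⟩ := exists_between (bot_le : ⊥ ≤ W) 1 (by simp) (by
      rcases Nat.eq_zero_or_pos (finrank K W) with h | h
      · exact (hW (Submodule.finrank_eq_zero.1 h)).elim
      · exact h)
    rw [← Finset.sum_filter_add_sum_filter_not _ (fun R => p ≤ R)]
    rw [← Finset.sum_fiberwise_of_maps_to (s := filter (fun R => ¬ p ≤ R) _) (g := fun R => R ⊔ p)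
      (t := filter (fun R => p ≤ R) (univ.filter (fun R : Submodule K V => R ≤ W)))]
    · rw [← Finset.sum_add_distrib]
      apply Finset.sum_eq_zero
      intro S hS
      simp only [mem_filter, mem_univ, true_and] at hS
      have h0 := Submodule.finrank_mono hS.2
      obtain ⟨s, hs⟩ : ∃ s, finrank K S = s + 1 := ⟨finrank K S - 1, by omega⟩
      have hset : filter (fun R => R ⊔ p = S) (filter (fun R => ¬ p ≤ R) (univ.filter (fun R : Submodule K V => R ≤ W)))
          = (univ.filter fun R : Submodule K V => R ≤ S ∧ ¬ p ≤ R ∧ R ⊔ p = S) := by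
        ext R
        simp only [mem_filter, mem_univ, true_and]
        constructor
        · rintro ⟨⟨a, b⟩, rfl⟩; exact ⟨le_sup_left, b, rfl⟩
        · rintro ⟨a, b, c⟩; exact ⟨⟨a.trans hS.1, b⟩, c⟩
      rw [hset, Finset.sum_congr rfl (g := fun _ => mu (Nat.card K) s)]
      · rw [sum_const, card_C7 hp hS.2, hs]
        simp [mu]
      · intro R hR
        simp only [mem_filter, mem_univ, true_and] at hR
        have hd := Submodule.finrank_sup_add_finrank_inf_eq R p
        have : R ⊓ p = ⊥ := by
          have : finrank K ↥(R ⊓ p) < 1 := by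
            rw [← hp]
            apply Submodule.finrank_lt_finrank_of_lt
            exact lt_of_le_of_ne inf_le_right (fun h => hR.2.1 (by rw [← h]; exact inf_le_left))
          exact Submodule.finrank_eq_zero.1 (by omega)
        rw [this, hR.2.2, finrank_bot] at hd
        congr 1; omega
    · intro R hR
      simp only [mem_filter, mem_univ, true_and] at hR ⊢
      exact ⟨sup_le hR.1 hpW, le_sup_right⟩

/-- number of disjoint complements-like; d = k - e -/
noncomputable def Nd (q k n : ℕ) : ℕ → ℝ
  | 0 => 1
  | d+1 => (q:ℝ)^k * br q (n - k - (k - (d+1))) * Nd q k n d / br q (d+1)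

lemma card_C6 {S F : Submodule K V} (d : ℕ) (hd : finrank K S + d = finrank K F) (hSF : S ⊓ F = ⊥)
    (hn : 2 * finrank K F ≤ finrank K V) :
    ((univ.filter fun z : Submodule K V => finrank K z = finrank K F ∧ z ⊓ F = ⊥ ∧ S ≤ z).card : ℝ)
      = Nd (Nat.card K) (finrank K F) (finrank K V) d := by
  induction d generalizing S with
  | zero =>
    have : (univ.filter fun z : Submodule K V => finrank K z = finrank K F ∧ z ⊓ F = ⊥ ∧ S ≤ z) = {S} := by
      ext z
      simp only [mem_filter, mem_univ, true_and, mem_singleton]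
      constructor
      · rintro ⟨h1, h2, h3⟩; exact (Submodule.eq_of_le_of_finrank_eq h3 (by omega)).symm
      · rintro rfl; exact ⟨by omega, hSF, le_rfl⟩
    rw [this]; simp [Nd]
  | succ d ih =>
    set q := Nat.card K
    set k := finrank K F with hk
    set n := finrank K V with hnn
    -- atoms S' of S disjoint from F
    set s := (atoms S ⊤).filter fun x => x ⊓ F = ⊥ with hs
    set T := (univ.filter fun z : Submodule K V => finrank K z = finrank K F ∧ z ⊓ F = ⊥ ∧ S ≤ z) with hT
    have hsc : s.card = q ^ k * br q (n - k - (k - (d+1))) := by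
      have h1 : s = atoms S ⊤ \ atoms S (S ⊔ F) := by
        ext x
        simp only [hs, mem_filter, mem_sdiff, mem_atoms, le_top, true_and]
        constructor
        · rintro ⟨⟨a, b⟩, c⟩
          refine ⟨⟨a, b⟩, fun h => ?_⟩
          have e1 := Submodule.finrank_sup_add_finrank_inf_eq x F
          have e2 := Submodule.finrank_sup_add_finrank_inf_eq S F
          rw [c, finrank_bot] at e1
          rw [hSF, finrank_bot] at e2
          have e3 := Submodule.finrank_mono (sup_le h.2.1 (le_sup_right : F ≤ S ⊔ F))
          omega
        · rintro ⟨⟨a, b⟩, c⟩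
          refine ⟨⟨a, b⟩, ?_⟩
          by_contra hne
          apply c
          refine ⟨a, ?_, b⟩
          have h2 : S ⊔ (x ⊓ F) = x := by
            apply Submodule.eq_of_le_of_finrank_eq (sup_le a inf_le_left)
            have e1 := Submodule.finrank_sup_add_finrank_inf_eq S (x ⊓ F)
            have e2 : S ⊓ (x ⊓ F) = ⊥ := by
              rw [eq_bot_iff, ← hSF]; exact inf_le_inf_left _ inf_le_right
            rw [e2, finrank_bot] at e1
            have e3 : finrank K ↥(x ⊓ F) ≠ 0 := fun h => hne (Submodule.finrank_eq_zero.1 h)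
            have e4 := Submodule.finrank_mono (sup_le a (inf_le_left : x ⊓ F ≤ x))
            omega
          rw [← h2]; exact sup_le_sup_left inf_le_right _
      have e2 := Submodule.finrank_sup_add_finrank_inf_eq S F
      rw [hSF, finrank_bot] at e2
      rw [h1, card_sdiff_of_subset, card_atoms le_top, card_atoms le_sup_left, finrank_top]
      · rw [show finrank K ↥(S ⊔ F) - finrank K S = k by omega,
          show n - finrank K S = k + (n - k - (k - (d+1))) by omega, br_add, Nat.add_sub_cancel_left]
      · intro x; simp only [mem_atoms]; exact fun h => ⟨h.1, le_top, h.2.2⟩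
    have hdc := Finset.sum_card_bipartiteAbove_eq_sum_card_bipartiteBelow (s := s) (t := T) (fun a c => a ≤ c)
    have hL : ∀ a ∈ s, ((T.bipartiteAbove (fun a c => a ≤ c) a).card : ℝ) = Nd q k n d := by
      intro a ha
      simp only [hs, mem_filter, mem_atoms] at ha
      rw [← ih (S := a) (by omega) ha.2]
      congr 2
      ext z
      simp only [Finset.bipartiteAbove, hT, mem_filter, mem_univ, true_and]
      constructor
      · rintro ⟨⟨h1, h2, h3⟩, h4⟩; exact ⟨h1, h2, h4⟩
      · rintro ⟨h1, h2, h3⟩; exact ⟨⟨h1, h2, ha.1.1.trans h3⟩, h3⟩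
    have hR : ∀ z ∈ T, (s.bipartiteBelow (fun a c => a ≤ c) z).card = br q (d+1) := by
      intro z hz
      simp only [hT, mem_filter, mem_univ, true_and] at hz
      rw [show d + 1 = finrank K z - finrank K S by omega, ← card_atoms hz.2.2]
      congr 1
      ext x
      simp only [Finset.bipartiteBelow, hs, mem_filter, mem_atoms, le_top, true_and]
      constructor
      · rintro ⟨⟨⟨h1, h2⟩, h3⟩, h4⟩; exact ⟨h1, h4, h2⟩
      · rintro ⟨h1, h2, h3⟩
        refine ⟨⟨⟨h1, h3⟩, ?_⟩, h2⟩
        rw [eq_bot_iff, ← hz.2.1]; exact inf_le_inf_right _ h2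
    rw [Finset.sum_congr rfl hR, sum_const, smul_eq_mul] at hdc
    have hdc' : (∑ a ∈ s, ((T.bipartiteAbove (fun a c => a ≤ c) a).card : ℝ)) = (T.card : ℝ) * br q (d+1) := by
      exact_mod_cast hdc
    rw [Finset.sum_congr rfl hL, sum_const, nsmul_eq_mul, hsc] at hdc'
    have hb : (0:ℝ) < br q (d+1) := by exact_mod_cast br_pos (Nat.succ_pos d)
    rw [Nd]
    field_simp
    push_cast at hdc'
    linarith

/-- G count -/
lemma card_G_step {S : Submodule K V} {k : ℕ} (hS : finrank K S < k) (c : ℕ)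
    (hc : ∀ S' : Submodule K V, finrank K S' = finrank K S + 1 →
      (univ.filter fun z : Submodule K V => finrank K z = k ∧ S' ≤ z).card = c) :
    br (Nat.card K) (finrank K V - finrank K S) * c =
      (univ.filter fun z : Submodule K V => finrank K z = k ∧ S ≤ z).card * br (Nat.card K) (k - finrank K S) := by
  have h := card_atoms (le_top : S ≤ ⊤)
  rw [finrank_top] at h
  rw [← h]
  apply Finset.card_mul_eq_card_mul (fun a c => a ≤ c)
  · intro a ha
    rw [mem_atoms] at ha
    rw [← hc a ha.2.2]
    congr 1
    ext z
    simp only [Finset.bipartiteAbove, mem_filter, mem_univ, true_and]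
    exact ⟨fun h => ⟨h.1.1, h.2⟩, fun h => ⟨⟨h.1, ha.1.trans h.2⟩, h.2⟩⟩
  · intro z hz
    simp only [mem_filter, mem_univ, true_and] at hz
    rw [← hz.1, ← card_atoms hz.2]
    congr 1
    ext z
    simp only [Finset.bipartiteBelow, mem_filter, mem_atoms, le_top, true_and]
    tauto

/-- product form of the gaussian coefficient -/
lemma card_G (k : ℕ) (d : ℕ) {S : Submodule K V} (hS : finrank K S + d = k) (hkn : k ≤ finrank K V) :
    (univ.filter fun z : Submodule K V => finrank K z = k ∧ S ≤ z).card * ∏ i ∈ range d, br (Nat.card K) (d - i)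
     = ∏ i ∈ range d, br (Nat.card K) (finrank K V - finrank K S - i) := by
  set q := Nat.card K
  induction d generalizing S with
  | zero =>
    have : (univ.filter fun z : Submodule K V => finrank K z = k ∧ S ≤ z) = {S} := by
      ext z
      simp only [mem_filter, mem_univ, true_and, mem_singleton]
      constructor
      · rintro ⟨h1, h3⟩; exact (Submodule.eq_of_le_of_finrank_eq h3 (by omega)).symm
      · rintro rfl; exact ⟨by omega, le_rfl⟩
    rw [this]; simp
  | succ d ih =>
    obtain ⟨S0, -, -, hS0⟩ := exists_atom (le_top : S ≤ ⊤) (by rw [finrank_top]; omega)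
    have hpp : 0 < ∏ i ∈ range d, br q (d - i) := by
      apply Finset.prod_pos; intro i hi; rw [mem_range] at hi; exact br_pos (by omega)
    have hconst : ∀ S' : Submodule K V, finrank K S' = finrank K S + 1 →
      (univ.filter fun z : Submodule K V => finrank K z = k ∧ S' ≤ z).card =
      (univ.filter fun z : Submodule K V => finrank K z = k ∧ S0 ≤ z).card := by
      intro S' hS'
      apply Nat.eq_of_mul_eq_mul_right hpp
      rw [ih (by omega), ih (by omega), hS', hS0]
    have h1 := card_G_step (S := S) (k := k) (by omega) _ hconst
    have h2 := ih (S := S0) (by omega)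
    rw [Finset.prod_range_succ', Finset.prod_range_succ' (n := d)]
    simp only [Nat.sub_zero]
    rw [show k - finrank K S = d + 1 by omega] at h1
    have e1 : ∏ i ∈ range d, br q (d + 1 - (i + 1)) = ∏ i ∈ range d, br q (d - i) := by
      apply Finset.prod_congr rfl; intro i _; congr 1; omega
    have e2 : ∏ i ∈ range d, br q (finrank K V - finrank K S - (i + 1)) = ∏ i ∈ range d, br q (finrank K V - finrank K S0 - i) := by
      apply Finset.prod_congr rfl; intro i _; congr 1; omega
    rw [e1, e2, ← h2, mul_comm _ (br q (d+1)), ← mul_assoc, ← h1]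
    ring

end EKR
end EKRA2

section EKRA3
set_option linter.unusedSectionVars false
set_option linter.deprecated false
open Finset Module
open scoped Classical

namespace EKR

section abstr
variable {X : Type*} [Fintype X]

lemma exists_proj (U : Submodule ℝ (X → ℝ)) (f : X → ℝ) :
    ∃ g ∈ U, ∀ u ∈ U, (f - g) ⬝ᵥ u = 0 := by
  let e : EuclideanSpace ℝ X ≃ₗ[ℝ] (X → ℝ) := WithLp.linearEquiv 2 ℝ (X → ℝ)
  let U' : Submodule ℝ (EuclideanSpace ℝ X) := U.comap e.toLinearMap
  obtain ⟨g, hg, h, hh, hf⟩ := U'.exists_add_mem_mem_orthogonal (e.symm f)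
  refine ⟨e g, hg, fun u hu => ?_⟩
  have h1 : f - e g = e h := by
    have := congrArg e hf
    rw [map_add, LinearEquiv.apply_symm_apply] at this
    rw [this]; simp
  rw [h1]
  have h2 := hh (e.symm u) (by simpa [U'] using hu)
  rw [EuclideanSpace.inner_eq_star_dotProduct] at h2
  simpa [e] using h2

lemma aeval_inv {E : Type*} [AddCommGroup E] [Module ℝ E] (A : E →ₗ[ℝ] E) (U : Submodule ℝ E) (h : ∀ f ∈ U, A f ∈ U)
    (P : Polynomial ℝ) : ∀ f ∈ U, Polynomial.aeval A P f ∈ U := by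
  have hpow : ∀ i : ℕ, ∀ f ∈ U, (A ^ i) f ∈ U := by
    intro i
    induction i with
    | zero => intro f hf; simpa using hf
    | succ i ih => intro f hf; rw [pow_succ]; exact ih _ (h f hf)
  induction P using Polynomial.induction_on' with
  | add p r hp hr => intro f hf; rw [map_add]; exact U.add_mem (hp f hf) (hr f hf)
  | monomial i c =>
    intro f hf
    rw [Polynomial.aeval_monomial]
    simpa using U.smul_mem c (hpow i f hf)

/-- abstract spectral lemma -/
lemma spectral (k t : ℕ) (W : ℕ → Submodule ℝ (X → ℝ)) (hmono : Monotone W) (hW0 : W 0 = ⊥)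
    (hW1 : ∀ f ∈ W 1, ∃ c : ℝ, f = fun _ => c) (hone : (fun _ => 1) ∈ W 1) (hX : 0 < Fintype.card X)
    (A B : (X → ℝ) →ₗ[ℝ] (X → ℝ)) (hA : ∀ f g, A f ⬝ᵥ g = f ⬝ᵥ A g) (hB : ∀ f g, B f ⬝ᵥ g = f ⬝ᵥ B g)
    (α b : ℕ → ℝ) (hAW : ∀ e ≤ k, ∀ f ∈ W (e+1), A f - α e • f ∈ W e)
    (hBW : ∀ e ≤ k, ∀ f ∈ W (e+1), B f - b e • f ∈ W e)
    (P : Polynomial ℝ) (htk : t ≤ k)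
    (hz : ∀ e, 1 ≤ e → e ≤ t → 1 + b e * P.eval (α e) = 0)
    (hp : ∀ e, t < e → e ≤ k → 0 < 1 + b e * P.eval (α e)) :
    ∀ f ∈ W (k+1), ∃ Q : ℝ, f ⬝ᵥ (f + B (Polynomial.aeval A P f)) = (1 + b 0 * P.eval (α 0)) * (f ⬝ᵥ (fun _ => 1))^2 / Fintype.card X + Q
      ∧ 0 ≤ Q ∧ (Q = 0 ↔ f ∈ W (t+1)) := by
  set L : ℕ → ℝ := fun e => 1 + b e * P.eval (α e) with hL
  set T : (X → ℝ) →ₗ[ℝ] (X → ℝ) := LinearMap.id + B ∘ₗ (Polynomial.aeval A P) with hT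
  have hAinv : ∀ e ≤ k+1, ∀ f ∈ W e, A f ∈ W e := by
    intro e he f hf
    cases e with
    | zero => rw [hW0, Submodule.mem_bot] at *; rw [hf, map_zero]
    | succ e =>
      have h1 := hmono (Nat.le_succ e) (hAW e (by omega) f hf)
      have := (W (e+1)).add_mem h1 ((W (e+1)).smul_mem (α e) hf)
      simpa using this
  have hBinv : ∀ e ≤ k+1, ∀ f ∈ W e, B f ∈ W e := by
    intro e he f hf
    cases e with
    | zero => rw [hW0, Submodule.mem_bot] at *; rw [hf, map_zero]
    | succ e =>
      have h1 := hmono (Nat.le_succ e) (hBW e (by omega) f hf)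
      have := (W (e+1)).add_mem h1 ((W (e+1)).smul_mem (b e) hf)
      simpa using this
  have hPinv : ∀ e ≤ k+1, ∀ f ∈ W e, Polynomial.aeval A P f ∈ W e := by
    intro e he f hf
    exact aeval_inv A (W e) (hAinv e he) P f hf
  have hTinv : ∀ e ≤ k+1, ∀ f ∈ W e, T f ∈ W e := by
    intro e he f hf
    exact (W e).add_mem hf (hBinv e he _ (hPinv e he f hf))
  -- eigenvectors
  have heigA : ∀ e ≤ k, ∀ h ∈ W (e+1), (∀ u ∈ W e, h ⬝ᵥ u = 0) → A h = α e • h := by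
    intro e he h hh ho
    have h1 := hAW e he h hh
    have h2 : (A h - α e • h) ⬝ᵥ (A h - α e • h) = 0 := by
      conv_lhs => rw [sub_dotProduct]
      rw [hA, smul_dotProduct, ho _ (hAinv e (by omega) _ h1), ho _ h1]; simp
    exact sub_eq_zero.1 (dotProduct_self_eq_zero.1 h2)
  have heigB : ∀ e ≤ k, ∀ h ∈ W (e+1), (∀ u ∈ W e, h ⬝ᵥ u = 0) → B h = b e • h := by
    intro e he h hh ho
    have h1 := hBW e he h hh
    have h2 : (B h - b e • h) ⬝ᵥ (B h - b e • h) = 0 := by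
      conv_lhs => rw [sub_dotProduct]
      rw [hB, smul_dotProduct, ho _ (hBinv e (by omega) _ h1), ho _ h1]; simp
    exact sub_eq_zero.1 (dotProduct_self_eq_zero.1 h2)
  have heig : ∀ e ≤ k, ∀ h ∈ W (e+1), (∀ u ∈ W e, h ⬝ᵥ u = 0) → T h = L e • h := by
    intro e he h hh ho
    have h1 : Polynomial.aeval A P h = P.eval (α e) • h :=
      Module.End.aeval_apply_of_mem_apply_eq_smul (heigA e he h hh ho)
    simp only [hT, LinearMap.add_apply, LinearMap.id_apply, LinearMap.comp_apply, h1, map_smul, heigB e he h hh ho, hL]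
    rw [add_smul, one_smul, smul_smul, mul_comm]
  have hTf : ∀ f, f + B (Polynomial.aeval A P f) = T f := fun f => rfl
  have main : ∀ j ≤ k, ∀ f ∈ W (j+1), ∃ Q : ℝ, f ⬝ᵥ T f = L 0 * (f ⬝ᵥ (fun _ => 1))^2 / Fintype.card X + Q
      ∧ 0 ≤ Q ∧ (Q = 0 ↔ f ∈ W (t+1)) := by
    intro j
    induction j with
    | zero =>
      intro _ f hf
      refine ⟨0, ?_, le_rfl, ⟨fun _ => hmono (by omega) hf, fun _ => rfl⟩⟩
      rw [heig 0 (by omega) f hf (by intro u hu; rw [hW0, Submodule.mem_bot] at hu; simp [hu])]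
      obtain ⟨c, rfl⟩ := hW1 f hf
      have : (Fintype.card X : ℝ) ≠ 0 := by positivity
      simp only [dotProduct, Pi.smul_apply, smul_eq_mul, sum_const, card_univ, nsmul_eq_mul, mul_one, add_zero]
      field_simp
    | succ j ih =>
      intro hj f hf
      obtain ⟨g, hg, hgo⟩ := exists_proj (W (j+1)) f
      obtain ⟨Q, hQ1, hQ2, hQ3⟩ := ih (by omega) g hg
      set h := f - g with hh
      have hf' : f = g + h := by simp [hh]
      have hhW : h ∈ W (j+1+1) := (W (j+1+1)).sub_mem hf (hmono (by omega) hg)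
      have hTh := heig (j+1) hj h hhW hgo
      have hTg := hTinv (j+1) (by omega) g hg
      have e1 : f ⬝ᵥ T f = g ⬝ᵥ T g + L (j+1) * (h ⬝ᵥ h) := by
        rw [hf', map_add, hTh, add_dotProduct, dotProduct_add, dotProduct_add, hgo _ hTg, dotProduct_smul, dotProduct_smul,
          dotProduct_comm g h, hgo g hg]
        simp
      have e2 : f ⬝ᵥ (fun _ => 1) = g ⬝ᵥ (fun _ => 1) := by
        rw [hf', add_dotProduct, hgo _ (hmono (by omega) hone), add_zero]
      have hhh : 0 ≤ h ⬝ᵥ h := by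
        simpa using dotProduct_star_self_nonneg h
      refine ⟨Q + L (j+1) * (h ⬝ᵥ h), by rw [e1, e2, hQ1]; ring, ?_, ?_⟩
      · by_cases hjt : j + 1 ≤ t
        · rw [show L (j+1) = 0 from hz (j+1) (by omega) hjt]; linarith
        · have := hp (j+1) (by omega) hj
          have : 0 ≤ L (j+1) * (h ⬝ᵥ h) := mul_nonneg this.le hhh
          linarith
      · by_cases hjt : j + 1 ≤ t
        · rw [show L (j+1) = 0 from hz (j+1) (by omega) hjt, zero_mul, add_zero]
          rw [hQ3]
          exact ⟨fun _ => hmono (by omega) hf, fun _ => hmono (by omega) hg⟩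
        · have hpos : 0 < L (j+1) := hp (j+1) (by omega) hj
          constructor
          · intro h0
            have h1 : 0 ≤ L (j+1) * (h ⬝ᵥ h) := mul_nonneg hpos.le hhh
            have h2 : Q = 0 := by linarith
            have h3 : L (j+1) * (h ⬝ᵥ h) = 0 := by linarith
            have h4 : h = 0 := dotProduct_self_eq_zero.1 ((mul_eq_zero.1 h3).resolve_left hpos.ne')
            rw [hf', h4, add_zero]; exact hQ3.1 h2
          · intro hft
            have h1 : h = 0 := by
              apply dotProduct_self_eq_zero.1
              have : h ∈ W (j+1) := (W (j+1)).sub_mem (hmono (by omega) hft) hg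
              exact hgo _ this
            rw [h1, dotProduct_zero, mul_zero, add_zero]
            rw [hf', h1, add_zero] at hft
            exact hQ3.2 hft
  exact fun f hf => main k le_rfl f hf

end abstr
end EKR
end EKRA3

section EKRA4
set_option linter.unusedSectionVars false
set_option linter.deprecated false
open Finset Module
open scoped Classical

namespace EKR

variable {K V : Type*} [Field K] [Finite K] [AddCommGroup V] [Module K V] [Finite V]

abbrev Gr (K V : Type*) [Field K] [AddCommGroup V] [Module K V] (k : ℕ) := {F : Submodule K V // finrank K F = k}

noncomputable instance instGr (k : ℕ) : Fintype (Gr K V k) := Fintype.ofFinite _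

variable {k : ℕ}

noncomputable def ind (k : ℕ) (A : Submodule K V) : Gr K V k → ℝ := fun F => if A ≤ F.1 then 1 else 0

noncomputable def Wl (K V : Type*) [Field K] [Finite K] [AddCommGroup V] [Module K V] [Finite V] (k : ℕ) (j : ℕ) : Submodule ℝ (Gr K V k → ℝ) :=
  Submodule.span ℝ {f | ∃ A : Submodule K V, finrank K A < j ∧ f = ind k A}

lemma ind_mem_Wl {A : Submodule K V} {j : ℕ} (h : finrank K A < j) : ind k A ∈ Wl K V k j :=
  Submodule.subset_span ⟨A, h, rfl⟩

lemma ind_mul (A B : Submodule K V) : ind k A * ind k B = ind k (A ⊔ B) := by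
  ext F; simp only [ind, Pi.mul_apply, sup_le_iff]
  split_ifs <;> simp_all

lemma ind_bot : ind k (⊥ : Submodule K V) = fun _ => 1 := by ext F; simp [ind]

lemma Wl_mono : Monotone (Wl K V k) := by
  intro i j hij
  apply Submodule.span_mono
  rintro f ⟨A, hA, rfl⟩
  exact ⟨A, by omega, rfl⟩

lemma Wl_zero : Wl K V k 0 = ⊥ := by
  simp [Wl]

lemma Wl_one : ∀ f ∈ Wl K V k 1, ∃ c : ℝ, f = fun _ => c := by
  intro f hf
  induction hf using Submodule.span_induction with
  | mem f hf =>
    obtain ⟨A, hA, rfl⟩ := hf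
    have : A = ⊥ := Submodule.finrank_eq_zero.1 (by omega)
    subst this
    exact ⟨1, ind_bot⟩
  | zero => exact ⟨0, rfl⟩
  | add f g _ _ hf hg =>
    obtain ⟨c, rfl⟩ := hf; obtain ⟨d, rfl⟩ := hg; exact ⟨c+d, rfl⟩
  | smul a f _ hf => obtain ⟨c, rfl⟩ := hf; exact ⟨a*c, rfl⟩

lemma one_mem_Wl : (fun _ => 1) ∈ Wl K V k 1 := by
  rw [← ind_bot]; exact ind_mem_Wl (by simp)

lemma Wl_top : ∀ f, f ∈ Wl K V k (k+1) := by
  intro f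
  have : f = ∑ F : Gr K V k, f F • ind k F.1 := by
    ext G
    rw [Finset.sum_apply, Finset.sum_eq_single G]
    · simp [ind]
    · intro F _ hF
      have : ¬ F.1 ≤ G.1 := by
        intro h
        apply hF
        apply Subtype.ext
        exact Submodule.eq_of_le_of_finrank_eq h (by rw [F.2, G.2])
      simp [ind, this]
    · simp
  rw [this]
  apply Submodule.sum_mem
  intro F _
  exact Submodule.smul_mem _ _ (ind_mem_Wl (by rw [F.2]; omega))

lemma Wl_mul {i j : ℕ} {f g : Gr K V k → ℝ} (hf : f ∈ Wl K V k (i+1)) (hg : g ∈ Wl K V k (j+1)) : f * g ∈ Wl K V k (i+j+1) := by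
  induction hf using Submodule.span_induction with
  | zero => rw [zero_mul]; exact Submodule.zero_mem _
  | add f f' _ _ h h' => rw [add_mul]; exact Submodule.add_mem _ h h'
  | smul a f _ h => rw [smul_mul_assoc]; exact Submodule.smul_mem _ _ h
  | mem f hf =>
    obtain ⟨A, hA, rfl⟩ := hf
    induction hg using Submodule.span_induction with
    | zero => rw [mul_zero]; exact Submodule.zero_mem _
    | add f f' _ _ h h' => rw [mul_add]; exact Submodule.add_mem _ h h'
    | smul a f _ h => rw [mul_smul_comm]; exact Submodule.smul_mem _ _ h
    | mem g hg =>
      obtain ⟨B, hB, rfl⟩ := hg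
      rw [ind_mul]
      apply ind_mem_Wl
      have := Submodule.finrank_sup_add_finrank_inf_eq A B
      omega

def adj (F z : Gr K V k) : Prop := finrank K ↥(z.1 ⊓ F.1) + 1 = k
def dsj (F z : Gr K V k) : Prop := z.1 ⊓ F.1 = ⊥

lemma adj_symm {F z : Gr K V k} : adj F z ↔ adj z F := by unfold adj; rw [inf_comm]
lemma dsj_symm {F z : Gr K V k} : dsj F z ↔ dsj z F := by unfold dsj; rw [inf_comm]

noncomputable def relOp (r : Gr K V k → Gr K V k → Prop) : (Gr K V k → ℝ) →ₗ[ℝ] (Gr K V k → ℝ) where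
  toFun f := fun F => ∑ z, if r F z then f z else 0
  map_add' f g := by
    ext F
    simp only [Pi.add_apply]
    rw [← Finset.sum_add_distrib]
    apply Finset.sum_congr rfl; intro z _; split_ifs <;> simp
  map_smul' c f := by
    ext F
    simp only [Pi.smul_apply, smul_eq_mul, RingHom.id_apply]
    rw [Finset.mul_sum]
    apply Finset.sum_congr rfl; intro z _; split_ifs <;> simp

lemma relOp_apply (r : Gr K V k → Gr K V k → Prop) (f : Gr K V k → ℝ) (F) : relOp r f F = ∑ z, if r F z then f z else 0 := rfl

lemma relOp_symm (r : Gr K V k → Gr K V k → Prop) (hr : ∀ F z, r F z ↔ r z F) (f g : Gr K V k → ℝ) :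
    relOp r f ⬝ᵥ g = f ⬝ᵥ relOp r g := by
  simp only [dotProduct, relOp_apply, Finset.sum_mul, Finset.mul_sum]
  rw [Finset.sum_comm]
  apply Finset.sum_congr rfl; intro z _
  apply Finset.sum_congr rfl; intro F _
  rw [hr F z]
  split_ifs <;> simp

lemma sum_Gr_ind (r : Submodule K V → Prop) (S : Submodule K V) :
    (∑ z : Gr K V k, if r z.1 then ind k S z else 0) =
      ((univ.filter fun z : Submodule K V => finrank K z = k ∧ r z ∧ S ≤ z).card : ℝ) := by
  have h1 : (∑ z : Gr K V k, if r z.1 then ind k S z else 0) = ∑ z : Gr K V k, if r z.1 ∧ S ≤ z.1 then (1:ℝ) else 0 := by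
    apply Finset.sum_congr rfl; intro z _; simp only [ind]; split_ifs <;> simp_all
  rw [h1, Finset.sum_boole]
  congr 1
  apply Finset.card_bij (fun z _ => z.1)
  · intro z hz; simp only [mem_filter, mem_univ, true_and] at hz ⊢; exact ⟨z.2, hz⟩
  · intro a _ b _ h; exact Subtype.ext h
  · intro b hb; simp only [mem_filter, mem_univ, true_and] at hb; exact ⟨⟨b, hb.1⟩, by simpa using hb.2, rfl⟩

noncomputable def alpha (q k n e : ℕ) : ℝ := q * br q (k - e) * br q (n - k) - br q e * br q (k + 1 - e)

lemma A_ind {S : Submodule K V} {e : ℕ} (he : finrank K S = e) (hek : e ≤ k) (hkn : k ≤ finrank K V) :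
    relOp adj (ind k S) = alpha (Nat.card K) k (finrank K V) e • ind k S +
      (br (Nat.card K) (k+1-e) : ℝ) • ∑ R ∈ coatoms ⊥ S, ind k R := by
  ext F
  rw [relOp_apply]
  have h0 : (∑ z : Gr K V k, if adj F z then ind k S z else 0) =
      ((univ.filter fun z : Submodule K V => finrank K z = k ∧ finrank K ↥(z ⊓ F.1) + 1 = k ∧ S ≤ z).card : ℝ) := by
    convert sum_Gr_ind (k := k) (fun z => finrank K ↥(z ⊓ F.1) + 1 = k) S
    rfl
  have hF := F.2
  rw [h0]
  simp only [Pi.add_apply, Pi.smul_apply, Finset.sum_apply, smul_eq_mul]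
  have hsum : ∑ R ∈ coatoms ⊥ S, ind k R F = (((coatoms ⊥ S).filter fun R => R ≤ F.1).card : ℝ) := by
    simp only [ind]; rw [Finset.sum_boole]
  rw [hsum]
  have hi := Submodule.finrank_mono (inf_le_left : S ⊓ F.1 ≤ S)
  by_cases h1 : S ≤ F.1
  · have h2 := card_C3 h1 le_top
    rw [hF] at h2
    simp only [le_top, and_true] at h2
    rw [h2, finrank_top, he]
    have h3 : ((coatoms ⊥ S).filter fun R => R ≤ F.1) = coatoms ⊥ S := by
      apply Finset.filter_true_of_mem; intro R hR; rw [mem_coatoms] at hR; exact hR.2.1.trans h1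
    rw [h3, card_coatoms bot_le, finrank_bot, he, Nat.sub_zero]
    simp only [ind, h1, if_true, alpha]
    push_cast; ring
  · have hlt : finrank K ↥(S ⊓ F.1) < e := by
      rw [← he]; apply Submodule.finrank_lt_finrank_of_lt
      exact lt_of_le_of_ne inf_le_left (fun h => h1 (by rw [← h]; exact inf_le_right))
    simp only [ind, h1, if_false, mul_zero, zero_add]
    by_cases h2 : finrank K ↥(S ⊓ F.1) + 1 = e
    · have h3 := card_C4 (S := S) (F := F.1) (by omega) (by omega)
      rw [hF] at h3
      rw [h3, he]
      have h4 : ((coatoms ⊥ S).filter fun R => R ≤ F.1) = {S ⊓ F.1} := by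
        ext R
        simp only [mem_filter, mem_coatoms, bot_le, true_and, mem_singleton]
        constructor
        · rintro ⟨⟨a, b⟩, c⟩
          exact Submodule.eq_of_le_of_finrank_eq (le_inf a c) (by omega)
        · rintro rfl; exact ⟨⟨inf_le_left, by omega⟩, inf_le_right⟩
      rw [h4]; simp
    · have h3 := card_C5 (S := S) (F := F.1) (by omega)
      rw [hF] at h3
      rw [h3]
      have h4 : ((coatoms ⊥ S).filter fun R => R ≤ F.1) = ∅ := by
        rw [Finset.eq_empty_iff_forall_notMem]
        intro R hR
        simp only [mem_filter, mem_coatoms, bot_le, true_and] at hR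
        have := Submodule.finrank_mono (le_inf hR.1.1 hR.2)
        omega
      rw [h4]; simp

lemma B_ind {S : Submodule K V} {e : ℕ} (he : finrank K S = e) (hek : e ≤ k) (hkn : 2 * k ≤ finrank K V) :
    relOp dsj (ind k S) = Nd (Nat.card K) k (finrank K V) (k - e) •
      ∑ R ∈ univ.filter (fun R : Submodule K V => R ≤ S), mu (Nat.card K) (finrank K R) • ind k R := by
  ext F
  rw [relOp_apply]
  have h0 : (∑ z : Gr K V k, if dsj F z then ind k S z else 0) =
      ((univ.filter fun z : Submodule K V => finrank K z = k ∧ z ⊓ F.1 = ⊥ ∧ S ≤ z).card : ℝ) := by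
    convert sum_Gr_ind (k := k) (fun z => z ⊓ F.1 = ⊥) S
    rfl
  have hF := F.2
  rw [h0]
  simp only [Pi.smul_apply, Finset.sum_apply, smul_eq_mul]
  have hsum : ∑ R ∈ univ.filter (fun R : Submodule K V => R ≤ S), mu (Nat.card K) (finrank K R) * ind k R F
      = if S ⊓ F.1 = ⊥ then 1 else 0 := by
    rw [← moebius]
    simp only [ind, mul_ite, mul_one, mul_zero]
    rw [← Finset.sum_filter]
    apply Finset.sum_congr _ (fun _ _ => rfl)
    ext R; simp
  rw [hsum]
  split_ifs with h
  · have h2 := card_C6 (S := S) (F := F.1) (k - e) (by omega) h (by omega)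
    rw [hF] at h2
    rw [h2, mul_one]
  · rw [mul_zero, Nat.cast_eq_zero, Finset.card_eq_zero, Finset.eq_empty_iff_forall_notMem]
    intro z hz
    simp only [mem_filter, mem_univ, true_and] at hz
    exact h (by rw [eq_bot_iff, ← hz.2.1]; exact inf_le_inf_right _ hz.2.2)

noncomputable def bb (q k n e : ℕ) : ℝ := mu q e * Nd q k n (k - e)

lemma A_W (hkn : k ≤ finrank K V) : ∀ e ≤ k, ∀ f ∈ Wl K V k (e+1),
    relOp adj f - alpha (Nat.card K) k (finrank K V) e • f ∈ Wl K V k e := by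
  intro e he f hf
  induction hf using Submodule.span_induction with
  | zero => simp
  | add f g _ _ hf hg =>
    rw [map_add, smul_add, add_sub_add_comm]; exact Submodule.add_mem _ hf hg
  | smul a f _ hf =>
    rw [map_smul, smul_comm, ← smul_sub]; exact Submodule.smul_mem _ _ hf
  | mem f hf =>
    obtain ⟨S, hS, rfl⟩ := hf
    rw [A_ind (S := S) rfl (by omega) hkn]
    have hsum : ∑ R ∈ coatoms ⊥ S, ind k R ∈ Wl K V k e := by
      apply Submodule.sum_mem; intro R hR; rw [mem_coatoms] at hR
      exact ind_mem_Wl (by omega)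
    have h2 := Submodule.smul_mem _ (br (Nat.card K) (k+1-finrank K S) : ℝ) hsum
    rcases Nat.lt_succ_iff_lt_or_eq.1 hS with h | h
    · have h3 := ind_mem_Wl (k := k) h
      exact Submodule.sub_mem _ (Submodule.add_mem _ (Submodule.smul_mem _ _ h3) h2) (Submodule.smul_mem _ _ h3)
    · subst h
      simpa using h2

lemma B_W (hkn : 2 * k ≤ finrank K V) : ∀ e ≤ k, ∀ f ∈ Wl K V k (e+1),
    relOp dsj f - bb (Nat.card K) k (finrank K V) e • f ∈ Wl K V k e := by
  intro e he f hf
  induction hf using Submodule.span_induction with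
  | zero => simp
  | add f g _ _ hf hg =>
    rw [map_add, smul_add, add_sub_add_comm]; exact Submodule.add_mem _ hf hg
  | smul a f _ hf =>
    rw [map_smul, smul_comm, ← smul_sub]; exact Submodule.smul_mem _ _ hf
  | mem f hf =>
    obtain ⟨S, hS, rfl⟩ := hf
    rw [B_ind (S := S) rfl (by omega) hkn]
    have hset : univ.filter (fun R : Submodule K V => R ≤ S) = insert S (univ.filter (fun R : Submodule K V => R < S)) := by
      ext R; simp [le_iff_lt_or_eq, or_comm]
    rw [hset, Finset.sum_insert (by simp)]
    have hsum : ∑ R ∈ univ.filter (fun R : Submodule K V => R < S), mu (Nat.card K) (finrank K R) • ind k R ∈ Wl K V k e := by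
      apply Submodule.sum_mem; intro R hR
      simp only [mem_filter, mem_univ, true_and] at hR
      have := Submodule.finrank_lt_finrank_of_lt hR
      exact Submodule.smul_mem _ _ (ind_mem_Wl (by omega))
    rw [smul_add, smul_smul]
    have h2 := Submodule.smul_mem _ (Nd (Nat.card K) k (finrank K V) (k - finrank K S)) hsum
    rcases Nat.lt_succ_iff_lt_or_eq.1 hS with h | h
    · have h3 := ind_mem_Wl (k := k) h
      exact Submodule.sub_mem _ (Submodule.add_mem _ (Submodule.smul_mem _ _ h3) h2) (Submodule.smul_mem _ _ h3)
    · subst h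
      rw [bb, mul_comm (mu _ _)]
      simpa using h2

/-- support lemma -/
lemma A_pow_support (i : ℕ) (g : Gr K V k → ℝ) (z : Gr K V k) (h : ((relOp adj) ^ i) g z ≠ 0) :
    ∃ w : Gr K V k, g w ≠ 0 ∧ k ≤ finrank K ↥(z.1 ⊓ w.1) + i := by
  induction i generalizing z with
  | zero => exact ⟨z, by simpa using h, by rw [inf_idem, z.2]; omega⟩
  | succ i ih =>
    rw [pow_succ'] at h
    rw [Module.End.mul_apply, relOp_apply] at h
    obtain ⟨y, -, hy⟩ := Finset.exists_ne_zero_of_sum_ne_zero h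
    rw [ne_eq, ite_eq_right_iff, Classical.not_imp] at hy
    obtain ⟨w, hw, hd⟩ := ih y hy.2
    refine ⟨w, hw, ?_⟩
    have h1 := hy.1
    unfold adj at h1
    have h2 := Submodule.finrank_sup_add_finrank_inf_eq (y.1 ⊓ z.1) (y.1 ⊓ w.1)
    have h3 := Submodule.finrank_mono (sup_le (inf_le_left : y.1 ⊓ z.1 ≤ y.1) (inf_le_left : y.1 ⊓ w.1 ≤ y.1))
    have h4 : (y.1 ⊓ z.1) ⊓ (y.1 ⊓ w.1) ≤ z.1 ⊓ w.1 := inf_le_inf inf_le_right inf_le_right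
    have h5 := Submodule.finrank_mono h4
    have := y.2
    omega

lemma aeval_support (P : Polynomial ℝ) (t : ℕ) (hP : P.degree < t) (g : Gr K V k → ℝ) (z : Gr K V k)
    (h : Polynomial.aeval (relOp adj) P g z ≠ 0) :
    ∃ w : Gr K V k, g w ≠ 0 ∧ k < finrank K ↥(z.1 ⊓ w.1) + t := by
  have hP0 : P ≠ 0 := by
    rintro rfl
    simp at h
  rw [Polynomial.aeval_eq_sum_range' (n := t) ((Polynomial.natDegree_lt_iff_degree_lt hP0).2 hP)] at h
  · rw [LinearMap.sum_apply, Finset.sum_apply] at h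
    obtain ⟨i, hi, hne⟩ := Finset.exists_ne_zero_of_sum_ne_zero h
    rw [mem_range] at hi
    rw [LinearMap.smul_apply, Pi.smul_apply] at hne
    obtain ⟨w, hw, hd⟩ := A_pow_support i g z (fun h0 => hne (by rw [h0, smul_zero]))
    exact ⟨w, hw, by omega⟩

end EKR
end EKRA4

section EKRA5
set_option linter.unusedSectionVars false
set_option linter.deprecated false
open Finset Module
open scoped Classical

namespace EKR

lemma prod_lower (m : ℕ) : (1/4 : ℝ) + 1/2 * (1/2)^m ≤ ∏ j ∈ range m, (1 - (1/2 : ℝ)^(j+1)) := by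
  induction m with
  | zero => norm_num
  | succ m ih =>
    rw [prod_range_succ]
    rcases Nat.eq_zero_or_pos m with rfl | hm
    · norm_num
    have h1 : (1/2:ℝ)^m ≤ 1/2 := by
      calc (1/2:ℝ)^m ≤ (1/2)^1 := pow_le_pow_of_le_one (by norm_num) (by norm_num) hm
        _ = _ := by norm_num
    have h0 : (0:ℝ) < (1/2)^m := by positivity
    have h2 : (0:ℝ) ≤ 1 - (1/2 : ℝ)^(m+1) := by rw [pow_succ]; linarith
    refine le_trans ?_ (mul_le_mul_of_nonneg_right ih h2)
    rw [pow_succ]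
    nlinarith [mul_nonneg h0.le (sub_nonneg.2 h1)]

lemma numeric (k t : ℕ) (htk : t ≤ k) (α b ρ : ℕ → ℝ)
    (h0 : ∀ r s, r < s → s ≤ k → α s < α r)
    (h1 : ∀ r s e, r < s → s < e → e ≤ k → (α r - α e) * (1 - (1/2)^(s-r)) ≤ α r - α s)
    (h2 : ∀ s r e, s < r → r < e → e ≤ k → α r - α e ≤ α s - α r)
    (hb : ∀ e < k, b (e+1) = - ρ e * b e) (hρ : ∀ e < k, 0 < ρ e) (hρ' : ∀ e < k, ρ e ≤ (1/2)^(k-e))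
    (hb0 : ∀ e ≤ k, b e ≠ 0) :
    ∃ P : Polynomial ℝ, P.degree < t ∧ (∀ e, 1 ≤ e → e ≤ t → 1 + b e * P.eval (α e) = 0) ∧
      (∀ e, t < e → e ≤ k → 0 < 1 + b e * P.eval (α e)) := by
  have hinj : Set.InjOn α (Icc 1 t : Finset ℕ) := by
    intro r hr s hs hrs
    simp only [coe_Icc, Set.mem_Icc] at hr hs
    rcases lt_trichotomy r s with h | h | h
    · exact absurd hrs (h0 r s h (by omega)).ne'
    · exact h
    · exact absurd hrs (h0 s r h (by omega)).ne
  refine ⟨Lagrange.interpolate (Icc 1 t) α (fun s => -1 / b s), ?_, ?_, ?_⟩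
  · have := Lagrange.degree_interpolate_lt (r := fun s => -1 / b s) hinj
    simpa using this
  · intro e he he'
    rw [Lagrange.eval_interpolate_at_node _ hinj (by simp [he, he'])]
    have := hb0 e (by omega)
    field_simp; norm_num
  · intro e hte hek
    set p1 : ℕ → ℝ := fun s => ∏ r ∈ Ico 1 s, ((α e - α r) / (α s - α r)) with hp1
    set p2 : ℕ → ℝ := fun s => ∏ r ∈ Ico (s+1) (t+1), ((α e - α r) / (α s - α r)) with hp2
    have hbe : ∀ s ≤ e, ∀ e' , s ≤ e' → e' ≤ k → b e' = b s * ∏ j ∈ Ico s e', (- ρ j) := by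
      intro s hs e' he' hek'
      induction e', he' using Nat.le_induction with
      | base => simp
      | succ e' he' ih =>
        rw [prod_Ico_succ_top he', hb e' (by omega), ih (by omega)]; ring
    have heval : 1 + b e * (Lagrange.interpolate (Icc 1 t) α (fun s => -1 / b s)).eval (α e)
        = 1 - ∑ s ∈ Icc 1 t, (∏ j ∈ Ico s e, (- ρ j)) * (p1 s * p2 s) := by
      rw [Lagrange.interpolate_apply, Polynomial.eval_finset_sum, mul_sum, sub_eq_add_neg, ← sum_neg_distrib]
      congr 1
      apply sum_congr rfl
      intro s hs
      rw [mem_Icc] at hs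
      rw [hbe s (by omega) e (by omega) hek]
      have hset : (Icc 1 t).erase s = Ico 1 s ∪ Ico (s+1) (t+1) := by
        ext x; simp only [mem_erase, mem_Icc, mem_union, mem_Ico]; omega
      have hdis : Disjoint (Ico 1 s) (Ico (s+1) (t+1)) := by
        rw [Finset.disjoint_left]; intro x; simp only [mem_Ico]; omega
      have hbas : (Lagrange.basis (Icc 1 t) α s).eval (α e) = p1 s * p2 s := by
        rw [Lagrange.basis, Polynomial.eval_prod, hset, prod_union hdis]
        simp only [hp1, hp2]
        congr 1 <;>
        · apply prod_congr rfl; intro r _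
          simp only [Lagrange.basisDivisor, Polynomial.eval_mul, Polynomial.eval_C, Polynomial.eval_sub, Polynomial.eval_X]
          rw [div_eq_inv_mul]
      rw [Polynomial.eval_mul, Polynomial.eval_C, hbas]
      have := hb0 s (by omega)
      field_simp
    rw [heval]
    have hp1pos : ∀ s ∈ Icc 1 t, 0 < p1 s := by
      intro s hs
      rw [mem_Icc] at hs
      apply prod_pos; intro r hr; rw [mem_Ico] at hr
      have a1 := h0 r e (by omega) hek
      have a2 := h0 r s (by omega) (by omega)
      exact div_pos_of_neg_of_neg (by linarith) (by linarith)
    rcases Nat.lt_or_ge (t+1) e with hlt | hge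
    · -- e ≥ t+2
      have hterm : ∀ s ∈ Icc 1 t, (∏ j ∈ Ico s e, (- ρ j)) * (p1 s * p2 s) ≤ (1/2)^(e-s-1) := by
        intro s hs
        have hs' := hs
        rw [mem_Icc] at hs
        refine (le_abs_self _).trans ?_
        rw [abs_mul, abs_mul, abs_of_pos (hp1pos s hs')]
        have q1 : p1 s ≤ 4 := by
          have e1 : p1 s ≤ ∏ r ∈ Ico 1 s, (1 - (1/2:ℝ)^(s-r))⁻¹ := by
            apply prod_le_prod
            · intro r hr; rw [mem_Ico] at hr
              have a1 := h0 r e (by omega) hek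
              have a2 := h0 r s (by omega) (by omega)
              exact (div_pos_of_neg_of_neg (by linarith) (by linarith)).le
            · intro r hr; rw [mem_Ico] at hr
              have a1 := h0 r e (by omega) hek
              have a2 := h0 r s (by omega) (by omega)
              have a3 := h1 r s e (by omega) (by omega) hek
              have a4 : (1/2:ℝ)^(s-r) < 1 := pow_lt_one₀ (by norm_num) (by norm_num) (by omega)
              rw [← neg_div_neg_eq, neg_sub, neg_sub, div_le_iff₀ (by linarith), inv_mul_eq_div, le_div_iff₀ (by linarith)]
              exact a3
          have e2 : ∏ r ∈ Ico 1 s, (1 - (1/2:ℝ)^(s-r))⁻¹ = (∏ j ∈ range (s-1), (1 - (1/2 : ℝ)^(j+1)))⁻¹ := by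
            rw [← Finset.prod_inv_distrib]
            rw [Finset.prod_Ico_eq_prod_range, ← Finset.prod_range_reflect]
            apply prod_congr rfl
            intro j hj; rw [mem_range] at hj
            rw [show s - (1 + (s - 1 - 1 - j)) = j + 1 by omega]
          have e3 := prod_lower (s-1)
          have e4 : (0:ℝ) < (1/2)^(s-1) := by positivity
          rw [e2] at e1
          refine e1.trans ?_
          rw [inv_le_comm₀ (by linarith) (by norm_num)]
          linarith
        have q2 : |p2 s| ≤ 1 := by
          rw [hp2, Finset.abs_prod]
          apply Finset.prod_le_one
          · intro r _; positivity
          · intro r hr; rw [mem_Ico] at hr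
            have a1 := h0 r e (by omega) hek
            have a2 := h0 s r (by omega) (by omega)
            have a3 := h2 s r e (by omega) (by omega) hek
            rw [abs_div, abs_of_pos (a := α s - α r) (by linarith), abs_of_neg (by linarith), div_le_one (by linarith)]
            linarith
        have q3 : ∀ u, u + s ≤ e → |∏ j ∈ Ico (e-u) e, (- ρ j)| ≤ ∏ i ∈ range u, (1/2:ℝ)^(i+1) := by
          intro u hu
          rw [Finset.abs_prod]
          rw [Finset.prod_Ico_eq_prod_range, ← Finset.prod_range_reflect, show e - (e-u) = u by omega]
          apply Finset.prod_le_prod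
          · intro i _; positivity
          · intro i hi
            rw [mem_range] at hi
            rw [abs_neg, abs_of_pos (hρ _ (by omega))]
            refine (hρ' _ (by omega)).trans ?_
            apply pow_le_pow_of_le_one (by norm_num) (by norm_num)
            omega
        have q4 : ∀ u, 2 ≤ u → (∏ i ∈ range u, (1/2:ℝ)^(i+1)) * 4 ≤ (1/2)^(u-1) := by
          intro u hu
          induction u, hu using Nat.le_induction with
          | base => norm_num [prod_range_succ]
          | succ u hu ih =>
            rw [prod_range_succ, mul_right_comm]
            obtain ⟨v, rfl⟩ : ∃ v, u = v + 1 := ⟨u-1, by omega⟩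
            simp only [Nat.add_sub_cancel] at ih ⊢
            rw [pow_succ (1/2:ℝ) v]
            apply mul_le_mul ih _ (by positivity) (by positivity)
            calc (1/2:ℝ)^(v+1+1) ≤ (1/2)^1 := pow_le_pow_of_le_one (by norm_num) (by norm_num) (by omega)
              _ = _ := by norm_num
        have q5 := q3 (e-s) (by omega)
        rw [show e - (e-s) = s by omega] at q5
        refine le_trans ?_ (q4 (e-s) (by omega))
        apply mul_le_mul q5 _ (by have := (hp1pos s hs').le; positivity) (prod_nonneg fun i _ => by positivity)
        calc p1 s * |p2 s| ≤ 4 * 1 := mul_le_mul q1 q2 (abs_nonneg _) (by norm_num)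
          _ = 4 := by norm_num
      have hsum : ∑ s ∈ Icc 1 t, (1/2:ℝ)^(e-s-1) < 1 := by
        have g1 : ∑ s ∈ Icc 1 t, (1/2:ℝ)^(e-s-1) ≤ ∑ i ∈ range t, (1/2:ℝ)^(i+1) := by
          rw [show Icc 1 t = Ico 1 (t+1) by ext; simp [Nat.lt_succ_iff], Finset.sum_Ico_eq_sum_range, ← Finset.sum_range_reflect]
          apply Finset.sum_le_sum
          intro i hi; rw [Nat.add_sub_cancel, mem_range] at hi
          apply pow_le_pow_of_le_one (by norm_num) (by norm_num)
          omega
        have g2 : ∀ t : ℕ, ∑ i ∈ range t, (1/2:ℝ)^(i+1) = 1 - (1/2)^t := by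
          intro t
          induction t with
          | zero => simp
          | succ t ih => rw [sum_range_succ, ih, pow_succ]; ring
        have g3 : (0:ℝ) < (1/2)^t := by positivity
        rw [g2] at g1; linarith
      have := Finset.sum_le_sum hterm
      linarith
    · have hee : e = t + 1 := by omega
      subst hee
      have hterm : ∀ s ∈ Icc 1 t, (∏ j ∈ Ico s (t+1), (- ρ j)) * (p1 s * p2 s) ≤ 0 := by
        intro s hs
        have hs' := hs
        rw [mem_Icc] at hs
        rw [prod_eq_prod_Ico_succ_bot (by omega)]
        have hpos : 0 ≤ (∏ j ∈ Ico (s+1) (t+1), (- ρ j)) * p2 s := by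
          rw [hp2, ← prod_mul_distrib]
          apply prod_nonneg
          intro r hr; rw [mem_Ico] at hr
          have a1 := h0 r (t+1) (by omega) hek
          have a2 := h0 s r (by omega) (by omega)
          have a3 := hρ r (by omega)
          exact mul_nonneg_of_nonpos_of_nonpos (by linarith) (div_nonpos_of_nonpos_of_nonneg (by linarith) (by linarith))
        have a3 := hρ s (by omega)
        have := mul_nonneg (mul_nonneg a3.le (hp1pos s hs').le) hpos
        linarith
      have := Finset.sum_nonpos hterm
      linarith


lemma Nd_pos {q k n : ℕ} (hq : 2 ≤ q) (hkn : 2 * k ≤ n) : ∀ d ≤ k, 0 < Nd q k n d := by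
  intro d
  induction d with
  | zero => intro _; simp [Nd]
  | succ d ih =>
    intro hd
    rw [Nd]
    have h1 : (0:ℝ) < br q (d+1) := by exact_mod_cast br_pos (Nat.succ_pos d)
    have h2 : (0:ℝ) < br q (n - k - (k - (d+1))) := by exact_mod_cast br_pos (by omega)
    have h3 := ih (by omega)
    have h4 : (0:ℝ) < q := by exact_mod_cast (by omega : 0 < q)
    positivity

lemma mu_ne {q : ℕ} (hq : 2 ≤ q) (e : ℕ) : mu q e ≠ 0 := by
  have h4 : (0:ℝ) < q := by exact_mod_cast (by omega : 0 < q)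
  induction e with
  | zero => simp [mu]
  | succ e ih => rw [mu]; exact mul_ne_zero (neg_ne_zero.2 (by positivity)) ih

lemma br_mulR (q r : ℕ) : ((q:ℝ) - 1) * br q r = (q:ℝ) ^ r - 1 := by
  have := br_mul q r
  exact_mod_cast this.symm

lemma alpha_diff {q k n r s : ℕ} (hrs : r < s) (hs : s ≤ k) (hkn : 2 * k ≤ n) :
    ((q:ℝ)-1)^2 * (alpha q k n r - alpha q k n s) = ((q:ℝ)^r + (q:ℝ)^(n+1-r)) - ((q:ℝ)^s + (q:ℝ)^(n+1-s)) := by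
  have key : ∀ e ≤ k, ((q:ℝ)-1)^2 * alpha q k n e = ((q:ℝ)^e + (q:ℝ)^(n+1-e)) + (q - 1 - (q:ℝ)^(k+1) - (q:ℝ)^(n-k+1)) := by
    intro e he
    have h1 : ((q:ℝ)-1)^2 * alpha q k n e = q * ((q-1) * br q (k-e)) * ((q-1) * br q (n-k)) - ((q-1) * br q e) * ((q-1) * br q (k+1-e)) := by
      unfold alpha; ring
    rw [h1, br_mulR, br_mulR, br_mulR, br_mulR]
    obtain ⟨d, rfl⟩ := Nat.exists_eq_add_of_le he
    obtain ⟨m, rfl⟩ := Nat.exists_eq_add_of_le hkn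
    rw [show e + d - e = d by omega, show 2*(e+d)+m - (e+d) = e + d + m by omega, show e+d+1-e = d+1 by omega,
      show 2*(e+d)+m+1-e = e+d+d+m+1 by omega]
    ring
  rw [mul_sub, key r (by omega), key s hs]; ring

lemma exists_poly {q k n t : ℕ} (hq : 2 ≤ q) (hkn : 2 * k ≤ n) (htk : t ≤ k) :
    ∃ P : Polynomial ℝ, P.degree < t ∧ (∀ e, 1 ≤ e → e ≤ t → 1 + bb q k n e * P.eval (alpha q k n e) = 0) ∧
      (∀ e, t < e → e ≤ k → 0 < 1 + bb q k n e * P.eval (alpha q k n e)) := by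
  have hqR : (2:ℝ) ≤ q := by exact_mod_cast hq
  have hq1 : (0:ℝ) < ((q:ℝ)-1)^2 := by
    have : (0:ℝ) < (q:ℝ) - 1 := by linarith
    positivity
  have hpm : ∀ a b : ℕ, a ≤ b → (q:ℝ)^a ≤ (q:ℝ)^b := fun a b h => pow_le_pow_right₀ (by linarith) h
  have hp2 : ∀ a b : ℕ, a < b → 2 * (q:ℝ)^a ≤ (q:ℝ)^b := by
    intro a b h
    refine le_trans ?_ (hpm (a+1) b h)
    rw [pow_succ, mul_comm]
    exact mul_le_mul_of_nonneg_left hqR (by positivity)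
  have hpp : ∀ a : ℕ, (0:ℝ) < (q:ℝ)^a := fun a => by positivity
  apply numeric k t htk (alpha q k n) (bb q k n) (fun e => (q:ℝ)^e * br q (k-e) / ((q:ℝ)^k * br q (n-k-e)))
  · intro r s hrs hs
    have h := alpha_diff (q := q) hrs hs hkn
    have : 0 < ((q:ℝ)-1)^2 * (alpha q k n r - alpha q k n s) := by
      rw [h]
      have a1 := hp2 (n+1-s) (n+1-r) (by omega)
      have a2 := hpm s (n+1-s) (by omega)
      have a3 := hpp r
      linarith
    have := (mul_pos_iff_of_pos_left hq1).1 this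
    linarith
  · intro r s e hrs hse he
    have h := alpha_diff (q := q) hrs (by omega) hkn
    have h' := alpha_diff (q := q) (hrs.trans hse) (by omega) hkn
    refine le_of_mul_le_mul_left ?_ hq1
    rw [← mul_assoc, h, h']
    have b1 : (q:ℝ)^(n+1-r) = (q:ℝ)^(n+1-s) * (q:ℝ)^(s-r) := by rw [← pow_add]; congr 1; omega
    have b2 : (q:ℝ)^s = (q:ℝ)^r * (q:ℝ)^(s-r) := by rw [← pow_add]; congr 1; omega
    have b3 : (q:ℝ)^r + (q:ℝ)^(n+1-r) - ((q:ℝ)^e + (q:ℝ)^(n+1-e)) ≤ (q:ℝ)^(n+1-r) - (q:ℝ)^s := by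
      have := hpm s e (by omega)
      have := hpm r (n+1-e) (by omega)
      linarith
    have b4 : (1/(q:ℝ))^(s-r) ≤ (1/2)^(s-r) := by
      apply pow_le_pow_left₀ (by positivity)
      exact one_div_le_one_div_of_le (by norm_num) hqR
    have b5 : (1/2:ℝ)^(s-r) ≤ 1 := pow_le_one₀ (by norm_num) (by norm_num)
    have b6 : (q:ℝ)^s ≤ (q:ℝ)^(n+1-r) := hpm _ _ (by omega)
    calc _ ≤ ((q:ℝ)^(n+1-r) - (q:ℝ)^s) * (1 - (1/2:ℝ)^(s-r)) := mul_le_mul_of_nonneg_right b3 (by linarith)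
      _ ≤ ((q:ℝ)^(n+1-r) - (q:ℝ)^s) * (1 - (1/(q:ℝ))^(s-r)) := mul_le_mul_of_nonneg_left (by linarith) (by linarith)
      _ = _ := by
        have := hpp (s-r)
        rw [b1, b2, one_div, inv_pow]
        field_simp
        ring
  · intro s r e hsr hre he
    have h := alpha_diff (q := q) hsr (by omega) hkn
    have h' := alpha_diff (q := q) hre (by omega) hkn
    refine le_of_mul_le_mul_left ?_ hq1
    rw [h, h']
    have a1 := hp2 (n+1-r) (n+1-s) (by omega)
    have a2 := hp2 r e (by omega)
    have a3 := hpp s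
    have a4 := hpp (n+1-e)
    linarith
  · intro e he
    unfold bb
    obtain ⟨d, hd⟩ : ∃ d, k - e = d + 1 := ⟨k-e-1, by omega⟩
    rw [show k - (e+1) = d by omega, hd, Nd, mu, show n - k - (k - (d+1)) = n - k - e by omega]
    have h1 : (0:ℝ) < br q (d+1) := by exact_mod_cast br_pos (Nat.succ_pos d)
    have h2 : (0:ℝ) < br q (n - k - e) := by exact_mod_cast br_pos (by omega)
    have h3 := hpp k
    field_simp
  · intro e he
    have h1 : (0:ℝ) < br q (k-e) := by exact_mod_cast br_pos (by omega)
    have h2 : (0:ℝ) < br q (n - k - e) := by exact_mod_cast br_pos (by omega)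
    have h3 := hpp k
    have h4 := hpp e
    positivity
  · intro e he
    have h2 : (0:ℝ) < br q (n - k - e) := by exact_mod_cast br_pos (by omega)
    have h1 : (br q (k-e) : ℝ) ≤ br q (n-k-e) := by exact_mod_cast br_mono (by omega)
    have h3 := hpp k
    rw [div_le_iff₀ (by positivity), ← mul_assoc]
    apply mul_le_mul _ h1 (by positivity) (by positivity)
    conv_rhs => rw [show k = (k - e) + e by omega, pow_add, ← mul_assoc]
    rw [show k - e + e - e = k - e by omega, ← mul_pow]
    have : (1:ℝ) ≤ (1/2 * q)^(k-e) := one_le_pow₀ (by linarith)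
    nlinarith [hpp e]
  · intro e he
    exact mul_ne_zero (mu_ne hq e) (Nd_pos hq hkn _ (by omega)).ne'

end EKR
end EKRA5

section EKRA6
set_option linter.unusedSectionVars false
set_option linter.deprecated false
open Finset Module
open scoped Classical

namespace EKR

variable {K V : Type*} [Field K] [Finite K] [AddCommGroup V] [Module K V] [Finite V] {k t : ℕ}

noncomputable def chi (𝓕 : Finset (Gr K V k)) : Gr K V k → ℝ := fun F => if F ∈ 𝓕 then 1 else 0

noncomputable def star (k : ℕ) (T : Submodule K V) : Finset (Gr K V k) := univ.filter fun F => T ≤ F.1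

lemma mem_star {T : Submodule K V} {F : Gr K V k} : F ∈ star k T ↔ T ≤ F.1 := by simp [star]

lemma chi_star (T : Submodule K V) : chi (star k T) = ind k T := by
  ext F; simp [chi, star, ind]

def TInt (t : ℕ) (𝓕 : Finset (Gr K V k)) : Prop := ∀ F ∈ 𝓕, ∀ G ∈ 𝓕, t ≤ finrank K ↥(F.1 ⊓ G.1)

lemma star_card_pos {T : Submodule K V} (hT : finrank K T ≤ k) (hkn : k ≤ finrank K V) : 0 < (star k T).card := by
  obtain ⟨x, h1, h2, h3⟩ := exists_between (le_top : T ≤ ⊤) k hT (by rw [finrank_top]; exact hkn)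
  exact Finset.card_pos.2 ⟨⟨x, h3⟩, mem_star.2 h1⟩

lemma star_TInt (T : Submodule K V) (hT : finrank K T = t) : TInt t (star k T) := by
  intro F hF G hG
  rw [mem_star] at hF hG
  rw [← hT]
  exact Submodule.finrank_mono (le_inf hF hG)

lemma ekr_core (ht : t ≤ k) (hkn : 2 * k ≤ finrank K V) {T : Submodule K V} (hT : finrank K T = t)
    (𝓕 : Finset (Gr K V k)) (h𝓕 : TInt t 𝓕) :
    𝓕.card ≤ (star k T).card ∧ (𝓕.card = (star k T).card → chi 𝓕 ∈ Wl K V k (t+1)) := by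
  set q := Nat.card K
  have hq : 2 ≤ q := q_pos
  obtain ⟨P, hPd, hz, hp⟩ := exists_poly (q := q) hq hkn ht
  have hGpos := star_card_pos (k := k) (T := T) (by omega) (by omega)
  have hXpos : 0 < Fintype.card (Gr K V k) := by
    obtain ⟨x, hx⟩ := Finset.card_pos.1 hGpos
    exact Fintype.card_pos_iff.2 ⟨x⟩
  have spec := spectral k t (Wl K V k) Wl_mono Wl_zero Wl_one one_mem_Wl hXpos (relOp adj) (relOp dsj)
    (relOp_symm _ fun _ _ => adj_symm) (relOp_symm _ fun _ _ => dsj_symm) _ _ (A_W (by omega)) (B_W hkn) P ht hz hp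
  have key : ∀ 𝓖 : Finset (Gr K V k), TInt t 𝓖 → chi 𝓖 ⬝ᵥ (chi 𝓖 + relOp dsj (Polynomial.aeval (relOp adj) P (chi 𝓖))) = 𝓖.card
      ∧ chi 𝓖 ⬝ᵥ (fun _ => 1) = 𝓖.card := by
    intro 𝓖 h𝓖
    have hc : ∑ F, chi 𝓖 F = 𝓖.card := by
      simp only [chi]; rw [Finset.sum_boole]; simp
    refine ⟨?_, by simp only [dotProduct, mul_one]; exact hc⟩
    rw [← hc]
    simp only [dotProduct]
    apply Finset.sum_congr rfl
    intro F _
    by_cases hF : F ∈ 𝓖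
    · have : relOp dsj (Polynomial.aeval (relOp adj) P (chi 𝓖)) F = 0 := by
        rw [relOp_apply]
        apply Finset.sum_eq_zero
        intro z _
        rw [ite_eq_right_iff]
        intro hzF
        by_contra hne
        obtain ⟨w, hw, hd⟩ := aeval_support P t hPd (chi 𝓖) z hne
        have hw' : w ∈ 𝓖 := by
          by_contra h; simp [chi, h] at hw
        have h1 := h𝓖 w hw' F hF
        have h2 := Submodule.finrank_sup_add_finrank_inf_eq (z.1 ⊓ w.1) (w.1 ⊓ F.1)
        have h3 := Submodule.finrank_mono (sup_le (inf_le_right : z.1 ⊓ w.1 ≤ w.1) (inf_le_left : w.1 ⊓ F.1 ≤ w.1))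
        have h4 : (z.1 ⊓ w.1) ⊓ (w.1 ⊓ F.1) = ⊥ := by
          unfold dsj at hzF
          rw [eq_bot_iff, ← hzF]
          exact inf_le_inf inf_le_left inf_le_right
        rw [h4, finrank_bot] at h2
        have := w.2
        omega
      rw [Pi.add_apply, this]
      simp [chi, hF]
    · simp [chi, hF]
  obtain ⟨Q, hQ1, hQ2, hQ3⟩ := spec (chi 𝓕) (Wl_top _)
  obtain ⟨Q', hQ1', hQ2', hQ3'⟩ := spec (chi (star k T)) (Wl_top _)
  have hmem : chi (star k T) ∈ Wl K V k (t+1) := by rw [chi_star]; exact ind_mem_Wl (by omega)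
  rw [hQ3'.2 hmem, (key _ (star_TInt T hT)).1, (key _ (star_TInt T hT)).2] at hQ1'
  rw [(key _ h𝓕).1, (key _ h𝓕).2] at hQ1
  set l := 1 + bb q k (finrank K V) 0 * Polynomial.eval (alpha q k (finrank K V) 0) P
  have hX : (0:ℝ) < Fintype.card (Gr K V k) := by exact_mod_cast hXpos
  have hG : (0:ℝ) < (star k T).card := by exact_mod_cast hGpos
  set G : ℝ := ((star k T).card : ℝ)
  set X : ℝ := (Fintype.card (Gr K V k) : ℝ)
  have hl : l = X / G := by
    have e1 : G * G * l = G * X := by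
      have e2 : G * X = (l * G^2 / X + 0) * X := by rw [← hQ1']
      rw [e2, add_zero, div_mul_cancel₀ _ hX.ne']; ring
    rw [eq_div_iff hG.ne']
    exact mul_left_cancel₀ hG.ne' (by linarith)
  rw [hl] at hQ1
  have hQ4 : G * (𝓕.card : ℝ) = (𝓕.card : ℝ)^2 + G * Q := by
    have e1 : X / G * (𝓕.card : ℝ)^2 / X = (𝓕.card : ℝ)^2 / G := by
      rw [div_mul_eq_mul_div, div_div, mul_comm G X, mul_div_mul_left _ _ hX.ne']
    rw [e1] at hQ1
    have e2 : G * (𝓕.card : ℝ) = G * ((𝓕.card : ℝ)^2 / G + Q) := by rw [← hQ1]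
    rw [e2, mul_add, mul_div_cancel₀ _ hG.ne']
  have h5 : 0 ≤ G * Q := mul_nonneg hG.le hQ2
  constructor
  · have : (𝓕.card : ℝ) ≤ G := by
      by_contra hlt
      push Not at hlt
      have : (0:ℝ) < (𝓕.card : ℝ) := hG.trans hlt
      nlinarith
    exact Nat.cast_le.1 this
  · intro heq
    have heq' : (𝓕.card : ℝ) = G := by rw [heq]
    apply hQ3.1
    rw [heq'] at hQ4
    have : G * Q = 0 := by nlinarith
    exact (mul_eq_zero.1 this).resolve_left hG.ne'

end EKR
end EKRA6

section EKRA7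
set_option linter.unusedSectionVars false
set_option linter.deprecated false
open Finset Module
open scoped Classical

namespace EKR

variable {K V : Type*} [Field K] [Finite K] [AddCommGroup V] [Module K V] [Finite V] {k t : ℕ}

lemma br_sub (q i k : ℕ) (h : i ≤ k) : (br q k : ℝ) - br q i = (q:ℝ)^i * br q (k-i) := by
  obtain ⟨d, rfl⟩ := Nat.exists_eq_add_of_le h
  rw [br_add, Nat.add_sub_cancel_left]; push_cast; ring

lemma tele (c : ℕ → ℝ) (h1 : c 1 = 1) (m : ℕ) :
    ∏ i ∈ range m, c (m + 1 - i) = c (m+1) * ∏ i ∈ range m, c (m - i) := by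
  rw [← Finset.prod_range_reflect, ← Finset.prod_range_reflect (fun i => c (m - i))]
  have e1 : ∏ j ∈ range m, c (m + 1 - (m - 1 - j)) = ∏ j ∈ range m, c (j + 1 + 1) := by
    apply prod_congr rfl; intro j hj; rw [mem_range] at hj; congr 1; omega
  have e2 : ∏ j ∈ range m, c (m - (m - 1 - j)) = ∏ j ∈ range m, c (j + 1) := by
    apply prod_congr rfl; intro j hj; rw [mem_range] at hj; congr 1; omega
  rw [e1, e2, mul_comm, ← Finset.prod_range_succ (fun j => c (j+1)), Finset.prod_range_succ' (fun j => c (j+1))]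
  simp [h1]

/-- the localisation of the family at `y` -/
noncomputable def hloc (t : ℕ) (𝓕 : Finset (Gr K V k)) (y : Gr K V k) : Gr K V k → ℝ :=
  fun z => if z = y then (br (Nat.card K) (k - t) : ℝ) else if z ∈ 𝓕 ∧ adj y z then 1 else 0

lemma eq_of_inf_dim {y z : Gr K V k} (h : k ≤ finrank K ↥(z.1 ⊓ y.1)) : z = y := by
  apply Subtype.ext
  have h1 : z.1 ⊓ y.1 = z.1 := Submodule.eq_of_le_of_finrank_eq inf_le_left (le_antisymm (Submodule.finrank_mono inf_le_left) (by rw [z.2]; exact h))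
  have h2 : z.1 ⊓ y.1 = y.1 := Submodule.eq_of_le_of_finrank_eq inf_le_right (le_antisymm (Submodule.finrank_mono inf_le_right) (by rw [y.2]; exact h))
  exact h1.symm.trans h2

lemma hloc_mem (htk : t < k) {𝓕 : Finset (Gr K V k)} (h𝓕 : TInt t 𝓕) (hchi : chi 𝓕 ∈ Wl K V k (t+1))
    {y : Gr K V k} (hy : y ∈ 𝓕) : hloc t 𝓕 y ∈ Wl K V k k := by
  set q := Nat.card K with hq
  have hq2 : 2 ≤ q := q_pos
  obtain ⟨m, hm⟩ : ∃ m, k = t + m + 1 := ⟨k - t - 1, by omega⟩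
  set g : ℕ → (Gr K V k → ℝ) := fun i => (∑ p ∈ atoms ⊥ y.1, ind k p) - (br q i : ℝ) • (fun _ => 1) with hg
  have hgz : ∀ i z, g i z = (br q (finrank K ↥(z.1 ⊓ y.1)) : ℝ) - br q i := by
    intro i z
    simp only [hg, Pi.sub_apply, Finset.sum_apply, Pi.smul_apply, smul_eq_mul, mul_one]
    congr 1
    simp only [ind]
    rw [Finset.sum_boole]
    have := card_atoms (bot_le : ⊥ ≤ z.1 ⊓ y.1)
    rw [finrank_bot, Nat.sub_zero] at this
    rw [← this]
    congr 2
    ext p; simp only [mem_filter, mem_atoms, le_inf_iff]; tauto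
  have hgW : ∀ i, g i ∈ Wl K V k (1+1) := by
    intro i
    apply Submodule.sub_mem
    · apply Submodule.sum_mem; intro p hp; rw [mem_atoms, finrank_bot] at hp
      exact ind_mem_Wl (by omega)
    · exact Submodule.smul_mem _ _ (Wl_mono (by omega) one_mem_Wl)
  have hprod : ∀ l, chi 𝓕 * ∏ i ∈ range l, g (t+i) ∈ Wl K V k (t+l+1) := by
    intro l
    induction l with
    | zero => simpa using hchi
    | succ l ih =>
      rw [prod_range_succ, ← mul_assoc]
      have := Wl_mul (i := t+l) (j := 1) ih (hgW (t+l))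
      exact this
  have h1 := hprod m
  set N1 : ℝ := ∏ i ∈ range m, ((q:ℝ)^(t+i) * br q (m-i)) with hN1
  have hN1pos : 0 < N1 := by
    apply prod_pos; intro i hi; rw [mem_range] at hi
    have : (0:ℝ) < br q (m-i) := by exact_mod_cast br_pos (by omega)
    have : (0:ℝ) < q := by exact_mod_cast (by omega : 0 < q)
    positivity
  have key : chi 𝓕 * ∏ i ∈ range m, g (t+i) = N1 • hloc t 𝓕 y := by
    ext z
    rw [Pi.mul_apply, Finset.prod_apply, Pi.smul_apply, smul_eq_mul]
    simp only [hgz, hloc]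
    have hcoef : ∀ l, t + m ≤ l → ∏ i ∈ range m, ((br q l : ℝ) - br q (t+i)) = ∏ i ∈ range m, ((q:ℝ)^(t+i) * br q (l - t - i)) := by
      intro l hl
      apply prod_congr rfl; intro i hi; rw [mem_range] at hi
      rw [br_sub q _ _ (by omega)]; congr 3; omega
    by_cases hz : z ∈ 𝓕
    · have hzt := h𝓕 z hz y hy
      simp only [chi, hz, if_true, one_mul, true_and]
      by_cases hzy : z = y
      · subst hzy
        rw [inf_idem, z.2, if_pos rfl, hcoef k (by omega), prod_mul_distrib, hN1, prod_mul_distrib]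
        have := tele (fun i => (br q i : ℝ)) (by simp) m
        rw [show k - t = m + 1 by omega]
        refine Eq.trans (congrArg _ this) ?_
        ring
      · rw [if_neg hzy]
        by_cases ha : adj y z
        · rw [if_pos ha, mul_one]
          unfold adj at ha
          rw [hcoef _ (by omega), hN1]
          apply prod_congr rfl; intro i hi; congr 3; omega
        · rw [if_neg ha, mul_zero]
          unfold adj at ha
          have h2 : finrank K ↥(z.1 ⊓ y.1) < k := by
            by_contra h; exact hzy (eq_of_inf_dim (by omega))
          apply Finset.prod_eq_zero (i := finrank K ↥(z.1 ⊓ y.1) - t) (by rw [mem_range]; omega)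
          rw [show t + (finrank K ↥(z.1 ⊓ y.1) - t) = finrank K ↥(z.1 ⊓ y.1) by omega, sub_self]
    · have hzy : z ≠ y := by rintro rfl; exact hz hy
      simp [chi, hz, hzy]
  rw [key] at h1
  have h2 := Submodule.smul_mem _ N1⁻¹ h1
  rw [smul_smul, inv_mul_cancel₀ hN1pos.ne', one_smul] at h2
  have e : Wl K V k k = Wl K V k (t+m+1) := congrArg (Wl K V k) hm
  rw [e]; exact h2

noncomputable def Ed (q k n : ℕ) : ℕ → ℝ
  | 0 => 1
  | d+1 => - Ed q k n d * br q (d+1) / ((q:ℝ)^(d+1) * br q (n-k-d))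

noncomputable def phi (x : Gr K V k) : Gr K V k → ℝ :=
  fun z => Ed (Nat.card K) k (finrank K V) (k - finrank K ↥(x.1 ⊓ z.1))

lemma phi_orth_P (hkn : 2 * k ≤ finrank K V) (x : Gr K V k) {P : Submodule K V} (hP : finrank K P + 1 = k) :
    ∑ z : Gr K V k, phi x z * ind k P z = 0 := by
  set q := Nat.card K with hq
  have hq2 : 2 ≤ q := q_pos
  set n := finrank K V with hn
  have h1 : ∑ z : Gr K V k, phi x z * ind k P z = ∑ z ∈ atoms P ⊤, Ed q k n (k - finrank K ↥(x.1 ⊓ z)) := by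
    simp only [ind, mul_ite, mul_one, mul_zero]
    rw [← Finset.sum_filter]
    apply Finset.sum_bij (fun z _ => z.1)
    · intro z hz; simp only [mem_filter, mem_univ, true_and] at hz; rw [mem_atoms]; exact ⟨hz, le_top, by rw [z.2]; omega⟩
    · intro a _ b _ h; exact Subtype.ext h
    · intro b hb; rw [mem_atoms] at hb; exact ⟨⟨b, by omega⟩, by simpa using hb.1, rfl⟩
    · intro z _; rfl
  rw [h1]
  set j := finrank K ↥(P ⊓ x.1) with hj
  have hd := Submodule.finrank_sup_add_finrank_inf_eq P x.1
  have hjk : j < k := by have := Submodule.finrank_mono (inf_le_left : P ⊓ x.1 ≤ P); omega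
  have hx := x.2
  rw [← Finset.sum_filter_add_sum_filter_not _ (fun z => z ≤ P ⊔ x.1)]
  have hs1 : (atoms P ⊤).filter (fun z => z ≤ P ⊔ x.1) = atoms P (P ⊔ x.1) := by
    ext z; simp only [mem_filter, mem_atoms]; simp; tauto
  have hc1 := card_atoms (le_sup_left : P ≤ P ⊔ x.1)
  have hc2 := Finset.card_filter_add_card_filter_not (s := atoms P ⊤) (fun z => z ≤ P ⊔ x.1)
  rw [hs1, hc1, card_atoms le_top, finrank_top] at hc2
  rw [show finrank K ↥(P ⊔ x.1) - finrank K P = k - j by omega] at hc1 hc2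
  rw [show finrank K V - finrank K P = (k - j) + (n - k - (k - j - 1)) by omega, br_add] at hc2
  have hc3 : ((atoms P ⊤).filter (fun z => ¬ z ≤ P ⊔ x.1)).card = q ^ (k-j) * br q (n - k - (k-j-1)) := Nat.add_left_cancel hc2
  rw [Finset.sum_congr rfl (g := fun _ => Ed q k n (k-(j+1))), sum_const, hs1, hc1,
    Finset.sum_congr rfl (g := fun _ => Ed q k n (k-j)), sum_const, hc3]
  · obtain ⟨d, hdd⟩ : ∃ d, k - j = d + 1 := ⟨k-j-1, by omega⟩
    rw [hdd, show k - (j+1) = d by omega, Ed, Nat.add_sub_cancel]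
    have h2 : (0:ℝ) < br q (n-k-d) := by exact_mod_cast br_pos (by omega)
    have h3 : (0:ℝ) < q := by exact_mod_cast (by omega : 0 < q)
    simp only [nsmul_eq_mul]
    push_cast
    field_simp
    ring
  · intro z hz
    simp only [mem_filter, mem_atoms] at hz
    congr 2
    apply le_antisymm
    · by_contra hlt
      push Not at hlt
      apply hz.2
      have e1 := Submodule.finrank_sup_add_finrank_inf_eq P (x.1 ⊓ z)
      have e2 : P ⊓ (x.1 ⊓ z) = P ⊓ x.1 := by
        rw [inf_left_comm, inf_eq_left.2 hz.1.1, inf_comm]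
      have e3 : P ⊔ (x.1 ⊓ z) = z := by
        apply Submodule.eq_of_le_of_finrank_le (sup_le hz.1.1 inf_le_right)
        rw [e2] at e1; omega
      rw [← e3]; exact sup_le_sup_left inf_le_left _
    · exact Submodule.finrank_mono (le_inf inf_le_right (inf_le_left.trans hz.1.1))
  · intro z hz
    simp only [mem_filter, mem_atoms] at hz
    have e1 := Submodule.finrank_sup_add_finrank_inf_eq z x.1
    have e2 : z ⊔ x.1 = P ⊔ x.1 := le_antisymm (sup_le hz.2 le_sup_right) (sup_le_sup_right hz.1.1 _)
    rw [e2, inf_comm] at e1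
    rw [show finrank K ↥(x.1 ⊓ z) = j + 1 by omega]

lemma phi_orth (hkn : 2 * k ≤ finrank K V) (x : Gr K V k) : ∀ f ∈ Wl K V k k, ∑ z : Gr K V k, phi x z * f z = 0 := by
  have hA : ∀ d, ∀ A : Submodule K V, finrank K A + d + 1 = k → ∑ z : Gr K V k, phi x z * ind k A z = 0 := by
    intro d
    induction d with
    | zero => intro A hA; exact phi_orth_P hkn x (by omega)
    | succ d ih =>
      intro A hA
      have hb : (0:ℝ) < br (Nat.card K) (k - finrank K A) := by exact_mod_cast br_pos (by omega)
      have h1 : ∀ z : Gr K V k, (br (Nat.card K) (k - finrank K A) : ℝ) * ind k A z = ∑ A' ∈ atoms A ⊤, ind k A' z := by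
        intro z
        simp only [ind]
        rw [Finset.sum_boole]
        split_ifs with h
        · have hca := card_atoms h
          rw [z.2] at hca
          rw [mul_one, ← hca]
          congr 2; ext p; simp only [mem_filter, mem_atoms]; simp; tauto
        · rw [mul_zero, eq_comm, Nat.cast_eq_zero, Finset.card_eq_zero, Finset.eq_empty_iff_forall_notMem]
          intro p hp
          simp only [mem_filter, mem_atoms] at hp
          exact h (hp.1.1.trans hp.2)
      have h2 : (br (Nat.card K) (k - finrank K A) : ℝ) * ∑ z : Gr K V k, phi x z * ind k A z = 0 := by
        rw [mul_sum]
        simp_rw [mul_left_comm _ (phi x _), h1, mul_sum]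
        rw [sum_comm]
        apply sum_eq_zero
        intro A' hA'
        rw [mem_atoms] at hA'
        exact ih A' (by omega)
      exact (mul_eq_zero.1 h2).resolve_left hb.ne'
  intro f hf
  induction hf using Submodule.span_induction with
  | zero => simp
  | add f g _ _ hf hg => simp only [Pi.add_apply, mul_add, sum_add_distrib, hf, hg, add_zero]
  | smul a f _ hf => simp only [Pi.smul_apply, smul_eq_mul, mul_left_comm _ a, ← mul_sum, hf, mul_zero]
  | mem f hf =>
    obtain ⟨A, hA', rfl⟩ := hf
    exact hA (k - 1 - finrank K A) A (by omega)

end EKR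
end EKRA7

section EKRA8
set_option linter.unusedSectionVars false
set_option linter.deprecated false
open Finset Module
open scoped Classical

namespace EKR

variable {K V : Type*} [Field K] [Finite K] [AddCommGroup V] [Module K V] [Finite V] {k t : ℕ}

lemma card_Gr_filter (p : Submodule K V → Prop) :
    (univ.filter fun z : Gr K V k => p z.1).card = (univ.filter fun z : Submodule K V => finrank K z = k ∧ p z).card := by
  apply Finset.card_bij (fun z _ => z.1)
  · intro z hz; simp only [mem_filter, mem_univ, true_and] at hz ⊢; exact ⟨z.2, hz⟩
  · intro a _ b _ h; exact Subtype.ext h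
  · intro b hb; simp only [mem_filter, mem_univ, true_and] at hb; exact ⟨⟨b, hb.1⟩, by simpa using hb.2, rfl⟩

noncomputable def nb (𝓕 : Finset (Gr K V k)) (F : Gr K V k) : Finset (Gr K V k) := 𝓕.filter fun z => adj F z

lemma mem_nb {𝓕 : Finset (Gr K V k)} {F z : Gr K V k} : z ∈ nb 𝓕 F ↔ z ∈ 𝓕 ∧ adj F z := by simp [nb]

lemma not_adj_self {F : Gr K V k} : ¬ adj F F := by
  unfold adj; rw [inf_idem, F.2]; omega

lemma sum_hloc (𝓕 : Finset (Gr K V k)) (F : Gr K V k) (f : Gr K V k → ℝ) :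
    ∑ z, f z * hloc t 𝓕 F z = f F * br (Nat.card K) (k-t) + ∑ z ∈ nb 𝓕 F, f z := by
  have : ∀ z, f z * hloc t 𝓕 F z = (if z = F then f F * br (Nat.card K) (k-t) else 0) + (if z ∈ nb 𝓕 F then f z else 0) := by
    intro z
    simp only [hloc, mem_nb]
    by_cases h : z = F
    · subst h; simp [not_adj_self]
    · simp [h]
  simp_rw [this]
  rw [sum_add_distrib, Finset.sum_ite_eq' univ F, if_pos (mem_univ _), Finset.sum_ite_mem, univ_inter]

/-- cell existence -/
lemma exists_cell {F : Gr K V k} {P E : Submodule K V} (hP : P ≤ F.1) (hE : F.1 ≤ E) (h1 : finrank K P + 1 = k)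
    (h2 : finrank K E = k + 1) : ∃ z : Gr K V k, adj F z ∧ z.1 ⊓ F.1 = P ∧ z.1 ⊔ F.1 = E := by
  have := card_C1 hP hE (by rw [F.2]; omega) (by rw [F.2]; omega)
  have h0 : 0 < Nat.card K := by have := q_pos (K := K); omega
  rw [← this] at h0
  obtain ⟨z, hz⟩ := Finset.card_pos.1 h0
  simp only [mem_filter, mem_univ, true_and] at hz
  refine ⟨⟨z, by rw [hz.1, F.2]⟩, ?_, hz.2.1, hz.2.2⟩
  unfold adj; rw [hz.2.1]; exact h1

lemma adj_sup' {F z : Gr K V k} (h : adj F z) : finrank K ↥(z.1 ⊔ F.1) = k + 1 := by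
  have := adj_sup (F := F.1) (z := z.1) (by rw [z.2, F.2]) (by rw [F.2]; exact h)
  rw [this, F.2]

/-- relation between two neighbours -/
lemma nbr_inf_same {F x z : Gr K V k} (hx : adj F x) (hz : adj F z) (hne : z ≠ x)
    (h : z.1 ⊓ F.1 = x.1 ⊓ F.1 ∨ z.1 ⊔ F.1 = x.1 ⊔ F.1) : finrank K ↥(x.1 ⊓ z.1) + 1 = k := by
  have hlt : finrank K ↥(x.1 ⊓ z.1) < k := by
    by_contra hh; exact hne (eq_of_inf_dim (by rw [inf_comm]; omega))
  rcases h with h | h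
  · have h1 : x.1 ⊓ F.1 ≤ x.1 ⊓ z.1 := le_inf inf_le_left (h ▸ inf_le_left)
    have := Submodule.finrank_mono h1
    unfold adj at hx; omega
  · have h1 : x.1 ⊔ z.1 ≤ x.1 ⊔ F.1 := sup_le le_sup_left (h ▸ le_sup_left)
    have h2 := Submodule.finrank_mono h1
    have h3 := Submodule.finrank_sup_add_finrank_inf_eq x.1 z.1
    rw [adj_sup' hx] at h2
    rw [x.2, z.2] at h3; omega

lemma nbr_inf_diff {F x z : Gr K V k} (hx : adj F x) (hz : adj F z)
    (h1 : z.1 ⊓ F.1 ≠ x.1 ⊓ F.1) (h2 : z.1 ⊔ F.1 ≠ x.1 ⊔ F.1) : finrank K ↥(x.1 ⊓ z.1) + 2 = k := by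
  -- x ⊓ z ≤ F
  have hF := F.2
  have e2 := Submodule.finrank_sup_add_finrank_inf_eq (x.1 ⊔ F.1) (z.1 ⊔ F.1)
  have hEE : (x.1 ⊔ F.1) ⊓ (z.1 ⊔ F.1) = F.1 := by
    symm
    apply Submodule.eq_of_le_of_finrank_le (le_inf le_sup_right le_sup_right)
    rw [hF]
    by_contra hc
    have h3 := Submodule.eq_of_le_of_finrank_le (inf_le_left : (x.1 ⊔ F.1) ⊓ (z.1 ⊔ F.1) ≤ _) (by rw [adj_sup' hx]; omega)
    have h4 := Submodule.eq_of_le_of_finrank_le (inf_le_right : (x.1 ⊔ F.1) ⊓ (z.1 ⊔ F.1) ≤ _) (by rw [adj_sup' hz]; omega)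
    exact h2 (h4.symm.trans h3)
  have hle : x.1 ⊓ z.1 ≤ F.1 := (inf_le_inf le_sup_left le_sup_left).trans hEE.le
  have heq : x.1 ⊓ z.1 = (x.1 ⊓ F.1) ⊓ (z.1 ⊓ F.1) := by
    apply le_antisymm
    · exact le_inf (le_inf inf_le_left hle) (le_inf inf_le_right hle)
    · exact inf_le_inf inf_le_left inf_le_left
  have e3 := Submodule.finrank_sup_add_finrank_inf_eq (x.1 ⊓ F.1) (z.1 ⊓ F.1)
  rw [heq]
  have e4 : finrank K ↥((x.1 ⊓ F.1) ⊔ (z.1 ⊓ F.1)) ≤ k := by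
    exact (Submodule.finrank_mono (sup_le inf_le_right inf_le_right)).trans hF.le
  have e5 : finrank K ↥((x.1 ⊓ F.1) ⊓ (z.1 ⊓ F.1)) < finrank K ↥(x.1 ⊓ F.1) := by
    by_contra hc
    unfold adj at hx hz
    have h3 := Submodule.eq_of_le_of_finrank_le (inf_le_left : (x.1 ⊓ F.1) ⊓ (z.1 ⊓ F.1) ≤ _) (by omega)
    have h4 := Submodule.eq_of_le_of_finrank_le (inf_le_right : (x.1 ⊓ F.1) ⊓ (z.1 ⊓ F.1) ≤ _) (by omega)
    exact h1 (h4.symm.trans h3)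
  unfold adj at hx hz
  omega

section loc
variable (htk : t < k) (hkn : 2 * k ≤ finrank K V) {𝓕 : Finset (Gr K V k)} (h𝓕 : TInt t 𝓕)
  (hchi : chi 𝓕 ∈ Wl K V k (t+1)) {F : Gr K V k} (hF : F ∈ 𝓕)
include htk hkn h𝓕 hchi hF

lemma nb_card : (nb 𝓕 F).card = Nat.card K * br (Nat.card K) (k-t) * br (Nat.card K) (finrank K V - k) := by
  have h := phi_orth hkn F _ (hloc_mem htk h𝓕 hchi hF)
  rw [sum_hloc] at h
  have h1 : ∀ z ∈ nb 𝓕 F, phi F z = Ed (Nat.card K) k (finrank K V) 1 := by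
    intro z hz
    have := (mem_nb.1 hz).2
    unfold adj at this
    unfold phi; congr 1; rw [inf_comm]; omega
  rw [sum_congr rfl h1, sum_const, nsmul_eq_mul] at h
  have h2 : phi F F = 1 := by unfold phi; rw [inf_idem, F.2, Nat.sub_self]; rfl
  rw [h2] at h
  simp only [Ed, Nat.sub_zero, zero_add, br_one, pow_one] at h
  have hb : (0:ℝ) < br (Nat.card K) (finrank K V - k) := by exact_mod_cast br_pos (by omega)
  have hq : (0:ℝ) < Nat.card K := by have := q_pos (K := K); exact_mod_cast (by omega : 0 < Nat.card K)
  have : ((nb 𝓕 F).card : ℝ) = Nat.card K * br (Nat.card K) (k-t) * br (Nat.card K) (finrank K V - k) := by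
    field_simp at h
    push_cast at h
    linarith
  exact_mod_cast this

lemma M2_card {x : Gr K V k} (hx : adj F x) (hk : 2 ≤ k) :
    (((nb 𝓕 F).filter fun z => z.1 ⊓ F.1 ≠ x.1 ⊓ F.1 ∧ z.1 ⊔ F.1 ≠ x.1 ⊔ F.1).card : ℝ) =
      (Nat.card K : ℝ)^2 * br (Nat.card K) (finrank K V - k - 1) * (br (Nat.card K) (k-t) - (if x ∈ 𝓕 then 1 else 0)) := by
  have h := phi_orth hkn x _ (hloc_mem htk h𝓕 hchi hF)
  rw [sum_hloc] at h
  have hc := nb_card htk hkn h𝓕 hchi hF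
  set q := Nat.card K with hq
  set n := finrank K V with hn
  set p : Gr K V k → Prop := fun z => z.1 ⊓ F.1 ≠ x.1 ⊓ F.1 ∧ z.1 ⊔ F.1 ≠ x.1 ⊔ F.1 with hp
  rw [show phi x F = Ed q k n 1 by unfold phi; unfold adj at hx; congr 1; omega] at h
  have h1 : ∀ z ∈ nb 𝓕 F, phi x z = Ed q k n 1 + (if z = x then 1 - Ed q k n 1 else 0) + (if p z then Ed q k n 2 - Ed q k n 1 else 0) := by
    intro z hz
    have hz := (mem_nb.1 hz).2
    by_cases hzx : z = x
    · subst hzx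
      have h0 : phi z z = 1 := by unfold phi; rw [inf_idem, z.2, Nat.sub_self]; rfl
      rw [h0]
      simp only [hp, if_true, ne_eq, not_true_eq_false, false_and, if_false]
      ring
    · rw [if_neg hzx]
      by_cases hpz : p z
      · rw [if_pos hpz]
        have := nbr_inf_diff hx hz hpz.1 hpz.2
        unfold phi; rw [show k - finrank K ↥(x.1 ⊓ z.1) = 2 by omega]; ring
      · rw [if_neg hpz]
        have := nbr_inf_same hx hz hzx (by simp only [hp] at hpz; tauto)
        unfold phi; rw [show k - finrank K ↥(x.1 ⊓ z.1) = 1 by omega]; ring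
  rw [sum_congr rfl h1, sum_add_distrib, sum_add_distrib, sum_const, nsmul_eq_mul, Finset.sum_ite_eq',
    ← Finset.sum_filter, sum_const, nsmul_eq_mul, hc] at h
  have hnb : x ∈ nb 𝓕 F ↔ x ∈ 𝓕 := by rw [mem_nb]; tauto
  simp only [hnb] at h
  have hb : (0:ℝ) < br q (n - k) := by exact_mod_cast br_pos (by omega)
  have hb1 : (0:ℝ) < br q (n - k - 1) := by exact_mod_cast br_pos (by omega)
  have hq0 : (0:ℝ) < q := by have := q_pos (K := K); exact_mod_cast (by omega : 0 < Nat.card K)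
  have hrec : (br q (n-k) : ℝ) = 1 + q * br q (n-k-1) := by
    rw [show n - k = (n-k-1)+1 by omega, br_succ', Nat.add_sub_cancel]; push_cast; rfl
  have h2 : (br q 2 : ℝ) = 1 + q := by rw [show 2 = 1+1 by rfl, br_succ', br_one]; push_cast; ring
  simp only [Ed, Nat.sub_zero, zero_add, br_one, pow_one, Nat.reduceAdd, h2] at h
  set M := ((nb 𝓕 F).filter p).card with hM
  push_cast at h
  rw [hrec] at h
  have hb' : (0:ℝ) < 1 + q * br q (n - k - 1) := by rw [← hrec]; exact hb
  generalize (br q (n - k - 1) : ℝ) = B at *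
  generalize (br q (k-t) : ℝ) = D at *
  generalize (M : ℝ) = M' at *
  generalize (q : ℝ) = Q at *
  have hB1 : (0:ℝ) < Q * (Q * B + 1) + 1 := by positivity
  split_ifs at h ⊢
  · field_simp at h
    have : (Q * (Q * B + 1) + 1) * (M' - Q^2 * B * (D - 1)) = 0 := by linear_combination h
    rcases mul_eq_zero.1 this with h | h
    · exact absurd h hB1.ne'
    · linarith
  · field_simp at h
    have : (Q * (Q * B + 1) + 1) * (M' - Q^2 * B * (D - 0)) = 0 := by linear_combination h
    rcases mul_eq_zero.1 this with h | h
    · exact absurd h hB1.ne'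
    · linarith

lemma loc_same (hk : 2 ≤ k) {x x' : Gr K V k} (hx : adj F x) (hx' : adj F x') (h1 : x.1 ⊓ F.1 = x'.1 ⊓ F.1)
    (h2 : x.1 ⊔ F.1 = x'.1 ⊔ F.1) : x ∈ 𝓕 ↔ x' ∈ 𝓕 := by
  have e1 := M2_card htk hkn h𝓕 hchi hF hx hk
  have e2 := M2_card htk hkn h𝓕 hchi hF hx' hk
  simp only [h1, h2] at e1
  rw [e1] at e2
  have hb1 : (0:ℝ) < br (Nat.card K) (finrank K V - k - 1) := by exact_mod_cast br_pos (by omega)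
  have hq0 : (0:ℝ) < Nat.card K := by have := q_pos (K := K); exact_mod_cast (by omega : 0 < Nat.card K)
  have e3 := mul_left_cancel₀ (by positivity) e2
  by_cases a : x ∈ 𝓕 <;> by_cases b : x' ∈ 𝓕 <;> simp [a, b] at e3 ⊢
  linarith

lemma loc_RS (hk : 2 ≤ k) {x : Gr K V k} (hx : adj F x) :
    ((nb 𝓕 F).filter fun z => z.1 ⊓ F.1 = x.1 ⊓ F.1).card + ((nb 𝓕 F).filter fun z => z.1 ⊔ F.1 = x.1 ⊔ F.1).card
     = Nat.card K * br (Nat.card K) (k-t) + (if x ∈ 𝓕 then Nat.card K * br (Nat.card K) (finrank K V - k) else 0) := by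
  have e1 := M2_card htk hkn h𝓕 hchi hF hx hk
  have hc := nb_card htk hkn h𝓕 hchi hF
  set q := Nat.card K with hq
  set n := finrank K V with hn
  -- cell
  have hcell : ((nb 𝓕 F).filter fun z => z.1 ⊓ F.1 = x.1 ⊓ F.1 ∧ z.1 ⊔ F.1 = x.1 ⊔ F.1).card = if x ∈ 𝓕 then q else 0 := by
    split_ifs with hxF
    · have := card_C1 (inf_le_right : x.1 ⊓ F.1 ≤ F.1) (le_sup_right : F.1 ≤ x.1 ⊔ F.1) (by rw [F.2]; exact hx.symm) (by rw [F.2, adj_sup' hx])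
      rw [hq, ← this]
      refine Eq.trans ?_ (Eq.trans (card_Gr_filter (k := k) (fun z => z ⊓ F.1 = x.1 ⊓ F.1 ∧ z ⊔ F.1 = x.1 ⊔ F.1)) ?_)
      rotate_left
      · congr 1; ext z; simp only [mem_filter, F.2]
      congr 1
      ext z
      simp only [mem_filter, mem_univ, true_and, mem_nb]
      constructor
      · rintro ⟨_, h⟩; exact h
      · intro h
        have hz : adj F z := by unfold adj; rw [h.1]; exact hx
        exact ⟨⟨(loc_same htk hkn h𝓕 hchi hF hk hz hx h.1 h.2).2 hxF, hz⟩, h⟩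
    · rw [Finset.card_eq_zero, Finset.eq_empty_iff_forall_notMem]
      intro z hz
      simp only [mem_filter, mem_nb] at hz
      exact hxF ((loc_same htk hkn h𝓕 hchi hF hk hz.1.2 hx hz.2.1 hz.2.2).1 hz.1.1)
  have hu := Finset.card_union_add_card_inter ((nb 𝓕 F).filter fun z => z.1 ⊓ F.1 = x.1 ⊓ F.1) ((nb 𝓕 F).filter fun z => z.1 ⊔ F.1 = x.1 ⊔ F.1)
  rw [← Finset.filter_or, ← Finset.filter_and, hcell] at hu
  have hu2 := Finset.card_filter_add_card_filter_not (s := nb 𝓕 F) (fun z => z.1 ⊓ F.1 = x.1 ⊓ F.1 ∨ z.1 ⊔ F.1 = x.1 ⊔ F.1)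
  simp only [not_or] at hu2
  rw [hc] at hu2
  rw [← hu]
  have hrec : (br q (n-k) : ℝ) = 1 + q * br q (n-k-1) := by
    rw [show n - k = (n-k-1)+1 by omega, br_succ', Nat.add_sub_cancel]; push_cast; rfl
  have hu3 := congrArg (Nat.cast (R := ℝ)) hu2
  push_cast at hu3
  have : ((filter (fun z : Gr K V k => ¬ z.1 ⊓ F.1 = x.1 ⊓ F.1 ∧ ¬ z.1 ⊔ F.1 = x.1 ⊔ F.1) (nb 𝓕 F)).card : ℝ) =
      (q:ℝ)^2 * br q (n - k - 1) * (br q (k-t) - (if x ∈ 𝓕 then 1 else 0)) := by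
    convert e1 using 3
  rw [this] at hu3
  rw [← Nat.cast_inj (R := ℝ)]
  push_cast
  rw [hrec] at *
  split_ifs at * <;> push_cast <;> linear_combination hu3

end loc

end EKR
end EKRA8

section EKRA9
set_option linter.unusedSectionVars false
set_option linter.deprecated false
open Finset Module
open scoped Classical

namespace EKR

variable {K V : Type*} [Field K] [Finite K] [AddCommGroup V] [Module K V] [Finite V] {k t : ℕ}

lemma card_adj_filter (F : Gr K V k) (p : Submodule K V → Prop) :
    (univ.filter fun z : Gr K V k => adj F z ∧ p z.1).card =
      (univ.filter fun z : Submodule K V => finrank K z = k ∧ finrank K ↥(z ⊓ F.1) + 1 = k ∧ p z).card := by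
  apply Finset.card_bij (fun z _ => z.1)
  · intro z hz; simp only [mem_filter, mem_univ, true_and] at hz ⊢; exact ⟨z.2, hz⟩
  · intro a _ b _ h; exact Subtype.ext h
  · intro b hb; simp only [mem_filter, mem_univ, true_and] at hb
    exact ⟨⟨b, hb.1⟩, by simp only [mem_filter, mem_univ, true_and]; exact hb.2, rfl⟩

lemma br_lt {q a b : ℕ} (hq : 2 ≤ q) (h : a < b) : br q a < br q b := by
  have h1 := br_mono (q := q) (a := a+1) (b := b) h
  rw [br_succ] at h1
  have : 0 < q ^ a := by positivity
  omega

lemma av1 {A F C : Submodule K V} (hA : A ≤ F) (hC : C ≤ F) (h : ¬ C ≤ A) :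
    ∃ P, A ≤ P ∧ P ≤ F ∧ finrank K P + 1 = finrank K F ∧ ¬ C ≤ P := by
  by_contra hc
  push Not at hc
  have h1 : coatoms A F ⊆ coatoms (A ⊔ C) F := by
    intro P hP
    rw [mem_coatoms] at hP ⊢
    exact ⟨sup_le hP.1 (hc P hP.1 hP.2.1 hP.2.2), hP.2⟩
  have h2 := Finset.card_le_card h1
  rw [card_coatoms hA, card_coatoms (sup_le hA hC)] at h2
  have h3 : A < A ⊔ C := by
    refine lt_of_le_of_ne le_sup_left ?_
    intro h4; exact h (h4 ▸ le_sup_right)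
  have h4 := Submodule.finrank_lt_finrank_of_lt h3
  have h5 := Submodule.finrank_mono (sup_le hA hC)
  have := br_lt (q := Nat.card K) (a := finrank K F - finrank K ↥(A ⊔ C)) (b := finrank K F - finrank K A) q_pos (by omega)
  omega

lemma br_two {q r : ℕ} (hq : 2 ≤ q) (h : 0 < r) : 2 * br q (r-1) < br q r := by
  obtain ⟨s, rfl⟩ : ∃ s, r = s + 1 := ⟨r-1, by omega⟩
  rw [br_succ', Nat.add_sub_cancel]
  have := Nat.mul_le_mul_right (br q s) hq
  omega

lemma av1' {F C D : Submodule K V} (hC : C ≤ F) (hD : D ≤ F) (h : C ≠ ⊥) (h' : D ≠ ⊥) :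
    ∃ P, P ≤ F ∧ finrank K P + 1 = finrank K F ∧ ¬ C ≤ P ∧ ¬ D ≤ P := by
  by_contra hc
  push Not at hc
  have h1 : coatoms ⊥ F ⊆ coatoms C F ∪ coatoms D F := by
    intro P hP
    rw [mem_union, mem_coatoms, mem_coatoms]
    rw [mem_coatoms] at hP
    by_cases hCP : C ≤ P
    · left; exact ⟨hCP, hP.2⟩
    · right; exact ⟨hc P hP.2.1 hP.2.2 hCP, hP.2⟩
  have h2 := (Finset.card_le_card h1).trans (Finset.card_union_le _ _)
  rw [card_coatoms bot_le, card_coatoms hC, card_coatoms hD, finrank_bot, Nat.sub_zero] at h2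
  have hc1 : 0 < finrank K C := Nat.pos_of_ne_zero (fun h0 => h (Submodule.finrank_eq_zero.1 h0))
  have hd1 : 0 < finrank K D := Nat.pos_of_ne_zero (fun h0 => h' (Submodule.finrank_eq_zero.1 h0))
  have h3 := Submodule.finrank_mono hC
  have h4 := br_two (q := Nat.card K) (r := finrank K F) q_pos (by omega)
  have h5 := br_mono (q := Nat.card K) (a := finrank K F - finrank K C) (b := finrank K F - 1) (by omega)
  have h6 := br_mono (q := Nat.card K) (a := finrank K F - finrank K D) (b := finrank K F - 1) (by omega)
  omega

lemma av2 {F S C D : Submodule K V} (hS : F ≤ S) (hC : F ≤ C) (hD : F ≤ D) (h : ¬ S ≤ C) (h' : ¬ S ≤ D) :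
    ∃ E, F ≤ E ∧ E ≤ S ∧ finrank K E = finrank K F + 1 ∧ ¬ E ≤ C ∧ ¬ E ≤ D := by
  by_contra hc
  push Not at hc
  have h1 : atoms F S ⊆ atoms F (S ⊓ C) ∪ atoms F (S ⊓ D) := by
    intro P hP
    rw [mem_union, mem_atoms, mem_atoms]
    rw [mem_atoms] at hP
    by_cases hCP : P ≤ C
    · left; exact ⟨hP.1, le_inf hP.2.1 hCP, hP.2.2⟩
    · right; exact ⟨hP.1, le_inf hP.2.1 (hc P hP.1 hP.2.1 hP.2.2 hCP), hP.2.2⟩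
  have h2 := (Finset.card_le_card h1).trans (Finset.card_union_le _ _)
  rw [card_atoms hS, card_atoms (le_inf hS hC), card_atoms (le_inf hS hD)] at h2
  have hc1 : finrank K ↥(S ⊓ C) < finrank K S := Submodule.finrank_lt_finrank_of_lt (lt_of_le_of_ne inf_le_left (fun h0 => h (inf_eq_left.1 h0)))
  have hd1 : finrank K ↥(S ⊓ D) < finrank K S := Submodule.finrank_lt_finrank_of_lt (lt_of_le_of_ne inf_le_left (fun h0 => h' (inf_eq_left.1 h0)))
  have h3 := Submodule.finrank_mono (le_inf hS hC)
  have h4 := br_two (q := Nat.card K) (r := finrank K S - finrank K F) q_pos (by omega)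
  have h5 := br_mono (q := Nat.card K) (a := finrank K ↥(S ⊓ C) - finrank K F) (b := finrank K S - finrank K F - 1) (by omega)
  have h6 := br_mono (q := Nat.card K) (a := finrank K ↥(S ⊓ D) - finrank K F) (b := finrank K S - finrank K F - 1) (by omega)
  omega

lemma cut {F z : Gr K V k} {D : Submodule K V} (hz : adj F z) (hD : F.1 ≤ D) (h : ¬ z.1 ⊔ F.1 ≤ D) :
    z.1 ⊓ D = z.1 ⊓ F.1 := by
  symm
  apply Submodule.eq_of_le_of_finrank_le (inf_le_inf_left _ hD)
  have : finrank K ↥(z.1 ⊓ D) < finrank K z.1 := by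
    apply Submodule.finrank_lt_finrank_of_lt
    exact lt_of_le_of_ne inf_le_left (fun h0 => h (sup_le (inf_eq_left.1 h0) hD))
  rw [z.2] at this
  unfold adj at hz; omega

lemma coatom_sup {P F C : Submodule K V} (hP : P ≤ F) (hC : C ≤ F) (h : finrank K P + 1 = finrank K F) (hn : ¬ C ≤ P) :
    P ⊔ C = F := by
  apply Submodule.eq_of_le_of_finrank_le (sup_le hP hC)
  have : finrank K P < finrank K ↥(P ⊔ C) := Submodule.finrank_lt_finrank_of_lt
    (lt_of_le_of_ne le_sup_left (fun h0 => hn (h0 ▸ le_sup_right)))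
  omega

lemma coatom_inf {P F C : Submodule K V} (hP : P ≤ F) (hC : C ≤ F) (h : finrank K P + 1 = finrank K F) (hn : ¬ C ≤ P) :
    finrank K ↥(P ⊓ C) + 1 = finrank K C := by
  have e := Submodule.finrank_sup_add_finrank_inf_eq P C
  rw [coatom_sup hP hC h hn] at e
  omega

section loc
variable (htk : t < k) (hkn : 2 * k ≤ finrank K V) {𝓕 : Finset (Gr K V k)} (h𝓕 : TInt t 𝓕)
  (hchi : chi 𝓕 ∈ Wl K V k (t+1)) {F : Gr K V k} (hF : F ∈ 𝓕) (ht : 1 ≤ t)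
include htk hkn h𝓕 hchi hF ht

lemma dichotomy :
    (∀ z z' : Gr K V k, adj F z → adj F z' → z.1 ⊓ F.1 = z'.1 ⊓ F.1 → z ∈ 𝓕 → z' ∈ 𝓕) ∨
    (finrank K V = 2 * k ∧ ∀ z z' : Gr K V k, adj F z → adj F z' → z.1 ⊔ F.1 = z'.1 ⊔ F.1 → z ∈ 𝓕 → z' ∈ 𝓕) := by
  by_cases hI : (∀ z z' : Gr K V k, adj F z → adj F z' → z.1 ⊓ F.1 = z'.1 ⊓ F.1 → z ∈ 𝓕 → z' ∈ 𝓕)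
  · exact Or.inl hI
  right
  push Not at hI
  obtain ⟨z, z', hz, hz', hzz, hzF, hzF'⟩ := hI
  have hq2 : 2 ≤ Nat.card K := q_pos
  have e1 := loc_RS htk hkn h𝓕 hchi hF (by omega) hz
  have e2 := loc_RS htk hkn h𝓕 hchi hF (by omega) hz'
  rw [if_pos hzF] at e1
  rw [if_neg hzF', ← hzz] at e2
  have hle : ((nb 𝓕 F).filter fun w => w.1 ⊔ F.1 = z.1 ⊔ F.1) ⊆ univ.filter (fun w : Gr K V k => adj F w ∧ w.1 ≤ z.1 ⊔ F.1) := by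
    intro w hw
    simp only [mem_filter, mem_nb, mem_univ, true_and] at hw ⊢
    exact ⟨hw.1.2, hw.2 ▸ le_sup_left⟩
  have hcc : (univ.filter (fun w : Gr K V k => adj F w ∧ w.1 ≤ z.1 ⊔ F.1)).card = Nat.card K * br (Nat.card K) k := by
    have h1 := card_C3 (bot_le : ⊥ ≤ F.1) (le_sup_right : F.1 ≤ z.1 ⊔ F.1)
    rw [adj_sup' hz, finrank_bot, Nat.sub_zero, F.2, Nat.add_sub_cancel_left, br_one, mul_one] at h1
    rw [← h1]
    refine Eq.trans (card_adj_filter F (fun w => w ≤ z.1 ⊔ F.1)) ?_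
    congr 1; ext w; simp only [mem_filter, bot_le, true_and]
  have hle2 := Finset.card_le_card hle
  rw [hcc] at hle2
  have hbk : br (Nat.card K) k ≤ br (Nat.card K) (finrank K V - k) := br_mono (by omega)
  have hbk2 := Nat.mul_le_mul_left (Nat.card K) hbk
  have hn : finrank K V = 2 * k := by
    by_contra hne
    have := br_lt (q := Nat.card K) (a := k) (b := finrank K V - k) hq2 (by omega)
    have := Nat.mul_lt_mul_of_pos_left this (by omega : 0 < Nat.card K)
    omega
  refine ⟨hn, ?_⟩
  have hfull : ∀ w : Gr K V k, adj F w → w.1 ⊔ F.1 = z.1 ⊔ F.1 → w ∈ 𝓕 := by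
    have h1 := Finset.eq_of_subset_of_card_le hle (by rw [hcc]; omega)
    intro w hw hwz
    have h2 : w ∈ univ.filter (fun w : Gr K V k => adj F w ∧ w.1 ≤ z.1 ⊔ F.1) := by
      simp only [mem_filter, mem_univ, true_and]; exact ⟨hw, hwz ▸ le_sup_left⟩
    rw [← h1, mem_filter, mem_nb] at h2
    exact h2.1.1
  have hR : ∀ x : Gr K V k, adj F x → ((nb 𝓕 F).filter fun w => w.1 ⊔ F.1 = x.1 ⊔ F.1).card = if x ∈ 𝓕 then Nat.card K * br (Nat.card K) (finrank K V - k) else 0 := by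
    intro x hx
    have hz1 := adj_sup' hz
    obtain ⟨w, hw, hwP, hwE⟩ := exists_cell (F := F) (P := x.1 ⊓ F.1) (E := z.1 ⊔ F.1) inf_le_right le_sup_right hx hz1
    have e3 := loc_RS htk hkn h𝓕 hchi hF (by omega) hw
    rw [if_pos (hfull w hw hwE), hwP, hwE] at e3
    have e4 := loc_RS htk hkn h𝓕 hchi hF (by omega) hx
    omega
  intro w w' hw hw' hww hwF
  have e5 := hR w hw
  have e6 := hR w' hw'
  rw [if_pos hwF] at e5
  by_contra hc
  rw [if_neg hc, ← hww, e5] at e6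
  have := br_pos (q := Nat.card K) (r := finrank K V - k) (by omega)
  rcases Nat.mul_eq_zero.1 e6 with h | h <;> omega

omit ht hchi in
lemma loc_weak {G z : Gr K V k} (hG : G ∈ 𝓕) (hFG : finrank K ↥(F.1 ⊓ G.1) = t) (hz : z ∈ 𝓕) (hza : adj F z) :
    F.1 ⊓ G.1 ≤ z.1 ∨ z.1 ⊔ F.1 ≤ F.1 ⊔ G.1 := by
  by_contra hc
  push Not at hc
  apply hc.2
  have h1 := h𝓕 z hz G hG
  have h2 : ¬ z.1 ⊓ G.1 ≤ F.1 := by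
    intro h3
    apply hc.1
    have h4 : z.1 ⊓ G.1 = F.1 ⊓ G.1 := Submodule.eq_of_le_of_finrank_le (le_inf h3 inf_le_right) (by omega)
    rw [← h4]; exact inf_le_left
  have h5 : F.1 ⊔ (z.1 ⊓ G.1) = z.1 ⊔ F.1 := by
    apply Submodule.eq_of_le_of_finrank_le (sup_le le_sup_right (inf_le_left.trans le_sup_left))
    rw [adj_sup' hza]
    have : finrank K F.1 < finrank K ↥(F.1 ⊔ (z.1 ⊓ G.1)) := Submodule.finrank_lt_finrank_of_lt
      (lt_of_le_of_ne le_sup_left (fun h0 => h2 (h0 ▸ le_sup_right)))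
    rw [F.2] at this; omega
  rw [← h5]
  exact sup_le_sup_left inf_le_right _

omit htk h𝓕 hchi hF hkn ht in
lemma sup_dim {G : Gr K V k} (hFG : finrank K ↥(F.1 ⊓ G.1) = t) : finrank K ↥(F.1 ⊔ G.1) + t = 2 * k := by
  have := Submodule.finrank_sup_add_finrank_inf_eq F.1 G.1
  rw [F.2, G.2] at this; omega

lemma local_lemma {G : Gr K V k} (hG : G ∈ 𝓕) (hFG : finrank K ↥(F.1 ⊓ G.1) = t) :
    (∀ z, adj F z → (z ∈ 𝓕 ↔ F.1 ⊓ G.1 ≤ z.1)) ∨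
    (finrank K V = 2 * k ∧ ∀ z, adj F z → (z ∈ 𝓕 ↔ z.1 ≤ F.1 ⊔ G.1)) := by
  have hw : ∀ z ∈ 𝓕, adj F z → _ := fun z hz hza => loc_weak htk hkn h𝓕 hF hG hFG hz hza
  have hsd := sup_dim hFG
  have hnbc := nb_card htk hkn h𝓕 hchi hF
  have hFd := F.2
  rcases dichotomy htk hkn h𝓕 hchi hF ht with hI | ⟨hn, hII⟩
  · left
    have hsub : nb 𝓕 F ⊆ univ.filter (fun w : Gr K V k => adj F w ∧ F.1 ⊓ G.1 ≤ w.1) := by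
      intro z hz
      rw [mem_nb] at hz
      simp only [mem_filter, mem_univ, true_and]
      refine ⟨hz.2, ?_⟩
      have hlt : ¬ (⊤ : Submodule K V) ≤ F.1 ⊔ G.1 := by
        intro h; have := Submodule.finrank_mono h; rw [finrank_top] at this; omega
      obtain ⟨E, h1, -, h3, h4, -⟩ := av2 (le_top : F.1 ≤ ⊤) (le_sup_left : F.1 ≤ F.1 ⊔ G.1) (le_sup_left : F.1 ≤ F.1 ⊔ G.1) hlt hlt
      obtain ⟨w, hw1, hw2, hw3⟩ := exists_cell (F := F) (P := z.1 ⊓ F.1) (E := E) inf_le_right h1 hz.2 (by omega)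
      have hwF := hI z w hz.2 hw1 hw2.symm hz.1
      rcases hw w hwF hw1 with h | h
      · have : F.1 ⊓ G.1 ≤ w.1 ⊓ F.1 := le_inf h inf_le_left
        rw [hw2] at this; exact this.trans inf_le_left
      · exact absurd (hw3 ▸ h) h4
    have hcc : (univ.filter (fun w : Gr K V k => adj F w ∧ F.1 ⊓ G.1 ≤ w.1)).card = (nb 𝓕 F).card := by
      have h1 := card_C3 (inf_le_left : F.1 ⊓ G.1 ≤ F.1) (le_top : F.1 ≤ ⊤)
      rw [hFG, finrank_top, F.2] at h1
      rw [hnbc, ← h1]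
      refine Eq.trans (card_adj_filter F (fun w => F.1 ⊓ G.1 ≤ w)) ?_
      congr 1; ext w; simp only [mem_filter, le_top, and_true]
    have heq := Finset.eq_of_subset_of_card_le hsub hcc.le
    intro z hz
    have : z ∈ nb 𝓕 F ↔ z ∈ univ.filter (fun w : Gr K V k => adj F w ∧ F.1 ⊓ G.1 ≤ w.1) := by rw [heq]
    simp only [mem_nb, mem_filter, mem_univ, true_and] at this
    tauto
  · right
    refine ⟨hn, ?_⟩
    have hsub : nb 𝓕 F ⊆ univ.filter (fun w : Gr K V k => adj F w ∧ w.1 ≤ F.1 ⊔ G.1) := by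
      intro z hz
      rw [mem_nb] at hz
      simp only [mem_filter, mem_univ, true_and]
      refine ⟨hz.2, ?_⟩
      have hne : F.1 ⊓ G.1 ≠ ⊥ := by intro h; rw [h, finrank_bot] at hFG; omega
      obtain ⟨P, h1, h2, h3, -⟩ := av1' (inf_le_left : F.1 ⊓ G.1 ≤ F.1) (inf_le_left : F.1 ⊓ G.1 ≤ F.1) hne hne
      obtain ⟨w, hw1, hw2, hw3⟩ := exists_cell (F := F) (P := P) (E := z.1 ⊔ F.1) h1 le_sup_right (by omega) (adj_sup' hz.2)
      have hwF := hII z w hz.2 hw1 hw3.symm hz.1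
      rcases hw w hwF hw1 with h | h
      · have : F.1 ⊓ G.1 ≤ w.1 ⊓ F.1 := le_inf h inf_le_left
        rw [hw2] at this; exact absurd this h3
      · rw [hw3] at h; exact le_sup_left.trans h
    have hcc : (univ.filter (fun w : Gr K V k => adj F w ∧ w.1 ≤ F.1 ⊔ G.1)).card = (nb 𝓕 F).card := by
      have h1 := card_C3 (bot_le : ⊥ ≤ F.1) (le_sup_left : F.1 ≤ F.1 ⊔ G.1)
      rw [finrank_bot, Nat.sub_zero, F.2] at h1
      rw [hnbc, show finrank K V - k = k by omega, mul_right_comm, show k - t = finrank K ↥(F.1 ⊔ G.1) - k by omega, ← h1]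
      refine Eq.trans (card_adj_filter F (fun w => w ≤ F.1 ⊔ G.1)) ?_
      congr 1; ext w; simp only [mem_filter, bot_le, true_and]
    have heq := Finset.eq_of_subset_of_card_le hsub hcc.le
    intro z hz
    have : z ∈ nb 𝓕 F ↔ z ∈ univ.filter (fun w : Gr K V k => adj F w ∧ w.1 ≤ F.1 ⊔ G.1) := by rw [heq]
    simp only [mem_nb, mem_filter, mem_univ, true_and] at this
    tauto

end loc

section prop
variable (htk : t < k) (hkn : 2 * k ≤ finrank K V) {𝓕 : Finset (Gr K V k)} (h𝓕 : TInt t 𝓕)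
  (hchi : chi 𝓕 ∈ Wl K V k (t+1)) (ht : 1 ≤ t)
include htk hkn h𝓕 hchi ht

lemma propI (d : ℕ) : ∀ F ∈ 𝓕, ∀ G ∈ 𝓕, ∀ H ∈ 𝓕, finrank K ↥(F.1 ⊓ G.1) = t → finrank K ↥(F.1 ⊓ H.1) = t + d →
    (∀ z, adj F z → (z ∈ 𝓕 ↔ F.1 ⊓ G.1 ≤ z.1)) → F.1 ⊓ G.1 ≤ H.1 := by
  induction d with
  | zero =>
    intro F hF G hG H hH hFG hFH hty
    have hFd := F.2
    have hne : F.1 ⊓ G.1 ≠ ⊥ := by intro h; rw [h, finrank_bot] at hFG; omega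
    have hsd := sup_dim hFG
    have hsd' := sup_dim hFH
    by_contra hcon
    rcases local_lemma htk hkn h𝓕 hchi hF ht hH hFH with h | ⟨hn, h⟩
    · obtain ⟨P, h1, h2, h3, h4⟩ := av1 (inf_le_left : F.1 ⊓ H.1 ≤ F.1) (inf_le_left : F.1 ⊓ G.1 ≤ F.1) (fun h => hcon (h.trans inf_le_right))
      obtain ⟨E, e1, e2, e3⟩ := exists_atom (le_top : F.1 ≤ ⊤) (by rw [finrank_top]; omega)
      obtain ⟨w, hw1, hw2, hw3⟩ := exists_cell (F := F) h2 e1 (by omega) (by omega)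
      have h5 := (h w hw1).2 (h1.trans (hw2 ▸ inf_le_left))
      have h6 := (hty w hw1).1 h5
      exact h4 (hw2 ▸ le_inf h6 inf_le_left)
    · obtain ⟨P, h1, h2, h3, -⟩ := av1' (inf_le_left : F.1 ⊓ G.1 ≤ F.1) (inf_le_left : F.1 ⊓ G.1 ≤ F.1) hne hne
      obtain ⟨E, e1, e2, e3⟩ := exists_atom (le_sup_left : F.1 ≤ F.1 ⊔ H.1) (by omega)
      obtain ⟨w, hw1, hw2, hw3⟩ := exists_cell (F := F) h1 e1 (by omega) (by omega)
      have h5 := (h w hw1).2 ((hw3 ▸ le_sup_left : w.1 ≤ E).trans e2)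
      have h6 := (hty w hw1).1 h5
      exact h3 (hw2 ▸ le_inf h6 inf_le_left)
  | succ d ih =>
    intro F hF G hG H hH hFG hFH hty
    have hFd := F.2
    have hsd := sup_dim hFG
    have hsd' := sup_dim hFH
    obtain ⟨P, h1, h2, h3, h4⟩ := av1 (inf_le_left : F.1 ⊓ G.1 ≤ F.1) (inf_le_left : F.1 ⊓ H.1 ≤ F.1)
      (fun h => by have := Submodule.finrank_mono h; omega)
    obtain ⟨E, e1, -, e3, e4, e5⟩ := av2 (le_top : F.1 ≤ ⊤) (le_sup_left : F.1 ≤ F.1 ⊔ G.1) (le_sup_left : F.1 ≤ F.1 ⊔ H.1)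
      (fun h => by have := Submodule.finrank_mono h; rw [finrank_top] at this; omega)
      (fun h => by have := Submodule.finrank_mono h; rw [finrank_top] at this; omega)
    obtain ⟨w, hw1, hw2, hw3⟩ := exists_cell (F := F) h2 e1 (by omega) (by omega)
    have hPw : P ≤ w.1 := hw2 ▸ inf_le_left
    have hwF := (hty w hw1).2 (h1.trans hPw)
    have hwG : w.1 ⊓ G.1 = F.1 ⊓ G.1 := by
      apply le_antisymm
      · have := cut hw1 (le_sup_left : F.1 ≤ F.1 ⊔ G.1) (hw3 ▸ e4)
        have h6 : w.1 ⊓ G.1 ≤ w.1 ⊓ F.1 := this ▸ inf_le_inf_left _ le_sup_right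
        exact le_inf (h6.trans inf_le_right) inf_le_right
      · exact le_inf (h1.trans hPw) inf_le_right
    have hwH : w.1 ⊓ H.1 = P ⊓ (F.1 ⊓ H.1) := by
      apply le_antisymm
      · have := cut hw1 (le_sup_left : F.1 ≤ F.1 ⊔ H.1) (hw3 ▸ e5)
        have h6 : w.1 ⊓ H.1 ≤ w.1 ⊓ F.1 := this ▸ inf_le_inf_left _ le_sup_right
        exact le_inf (hw2 ▸ h6) (le_inf (h6.trans inf_le_right) inf_le_right)
      · exact inf_le_inf hPw inf_le_right
    have hd := coatom_inf h2 (inf_le_left : F.1 ⊓ H.1 ≤ F.1) h3 h4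
    rw [← hwH] at hd
    rw [← hwG]
    have hwGt : finrank K ↥(w.1 ⊓ G.1) = t := by rw [hwG]; exact hFG
    rcases local_lemma htk hkn h𝓕 hchi hwF ht hG hwGt with h | ⟨hn, h⟩
    · exact ih w hwF G hG H hH hwGt (by omega) h
    · exfalso
      have h7 := (h F (adj_symm.1 hw1)).1 hF
      have h8 : F.1 ⊔ G.1 = w.1 ⊔ G.1 := Submodule.eq_of_le_of_finrank_le (sup_le h7 le_sup_right) (by
        have := sup_dim hwGt; omega)
      apply e4
      rw [← hw3]
      exact sup_le (h8 ▸ le_sup_left) le_sup_left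

lemma propII (hn : finrank K V = 2 * k) (d : ℕ) : ∀ F ∈ 𝓕, ∀ G ∈ 𝓕, ∀ H ∈ 𝓕, finrank K ↥(F.1 ⊓ G.1) = t → finrank K ↥(F.1 ⊓ H.1) = t + d →
    (∀ z, adj F z → (z ∈ 𝓕 ↔ z.1 ≤ F.1 ⊔ G.1)) → H.1 ≤ F.1 ⊔ G.1 := by
  induction d with
  | zero =>
    intro F hF G hG H hH hFG hFH hty
    have hFd := F.2
    have hsd := sup_dim hFG
    have hsd' := sup_dim hFH
    by_contra hcon
    rcases local_lemma htk hkn h𝓕 hchi hF ht hH hFH with h | ⟨hn, h⟩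
    · obtain ⟨P, h1, h2, h3⟩ := exists_between (inf_le_left : F.1 ⊓ H.1 ≤ F.1) (k-1) (by omega) (by omega)
      have hlt : ¬ (⊤ : Submodule K V) ≤ F.1 ⊔ G.1 := by
        intro h; have := Submodule.finrank_mono h; rw [finrank_top] at this; omega
      obtain ⟨E, e1, -, e3, e4, -⟩ := av2 (le_top : F.1 ≤ ⊤) (le_sup_left : F.1 ≤ F.1 ⊔ G.1) (le_sup_left : F.1 ≤ F.1 ⊔ G.1) hlt hlt
      obtain ⟨w, hw1, hw2, hw3⟩ := exists_cell (F := F) h2 e1 (by omega) (by omega)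
      have h5 := (h w hw1).2 (h1.trans (hw2 ▸ inf_le_left))
      have h6 := (hty w hw1).1 h5
      exact e4 (hw3 ▸ sup_le h6 le_sup_left)
    · have hlt : ¬ F.1 ⊔ H.1 ≤ F.1 ⊔ G.1 := fun h => hcon (le_sup_right.trans h)
      obtain ⟨E, e1, e2, e3, e4, -⟩ := av2 (le_sup_left : F.1 ≤ F.1 ⊔ H.1) (le_sup_left : F.1 ≤ F.1 ⊔ G.1) (le_sup_left : F.1 ≤ F.1 ⊔ G.1) hlt hlt
      obtain ⟨P, h1, h2, h3⟩ := exists_between (bot_le : ⊥ ≤ F.1) (k-1) (by rw [finrank_bot]; omega) (by omega)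
      obtain ⟨w, hw1, hw2, hw3⟩ := exists_cell (F := F) h2 e1 (by omega) (by omega)
      have h5 := (h w hw1).2 ((hw3 ▸ le_sup_left : w.1 ≤ E).trans e2)
      have h6 := (hty w hw1).1 h5
      exact e4 (hw3 ▸ sup_le h6 le_sup_left)
  | succ d ih =>
    intro F hF G hG H hH hFG hFH hty
    have hFd := F.2
    have hsd := sup_dim hFG
    have hsd' := sup_dim hFH
    have hne : F.1 ⊓ G.1 ≠ ⊥ := by intro h; rw [h, finrank_bot] at hFG; omega
    have hne' : F.1 ⊓ H.1 ≠ ⊥ := by intro h; rw [h, finrank_bot] at hFH; omega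
    obtain ⟨P, h2, h3, h4, h5⟩ := av1' (inf_le_left : F.1 ⊓ G.1 ≤ F.1) (inf_le_left : F.1 ⊓ H.1 ≤ F.1) hne hne'
    have hlt : ¬ F.1 ⊔ G.1 ≤ F.1 ⊔ H.1 := fun h => by have := Submodule.finrank_mono h; omega
    obtain ⟨E, e1, e2, e3, e4, -⟩ := av2 (le_sup_left : F.1 ≤ F.1 ⊔ G.1) (le_sup_left : F.1 ≤ F.1 ⊔ H.1) (le_sup_left : F.1 ≤ F.1 ⊔ H.1) hlt hlt
    obtain ⟨w, hw1, hw2, hw3⟩ := exists_cell (F := F) h2 e1 (by omega) (by omega)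
    have hPw : P ≤ w.1 := hw2 ▸ inf_le_left
    have hwS : w.1 ≤ F.1 ⊔ G.1 := (hw3 ▸ le_sup_left : w.1 ≤ E).trans e2
    have hwF := (hty w hw1).2 hwS
    have hwH : w.1 ⊓ H.1 = P ⊓ (F.1 ⊓ H.1) := by
      apply le_antisymm
      · have := cut hw1 (le_sup_left : F.1 ≤ F.1 ⊔ H.1) (hw3 ▸ e4)
        have h6 : w.1 ⊓ H.1 ≤ w.1 ⊓ F.1 := this ▸ inf_le_inf_left _ le_sup_right
        exact le_inf (hw2 ▸ h6) (le_inf (h6.trans inf_le_right) inf_le_right)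
      · exact inf_le_inf hPw inf_le_right
    have hd := coatom_inf h2 (inf_le_left : F.1 ⊓ H.1 ≤ F.1) h3 h5
    rw [← hwH] at hd
    have hFPG : F.1 ≤ P ⊔ G.1 := by
      have h7 := coatom_sup h2 (inf_le_left : F.1 ⊓ G.1 ≤ F.1) h3 h4
      exact h7.symm.le.trans (sup_le_sup_left inf_le_right _)
    have hwG : w.1 ⊔ G.1 = F.1 ⊔ G.1 := le_antisymm (sup_le hwS le_sup_right)
      (sup_le (hFPG.trans (sup_le_sup_right hPw _)) le_sup_right)
    have hwGt : finrank K ↥(w.1 ⊓ G.1) = t := by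
      have e := Submodule.finrank_sup_add_finrank_inf_eq w.1 G.1
      rw [hwG, w.2, G.2] at e; omega
    rw [← hwG]
    rcases local_lemma htk hkn h𝓕 hchi hwF ht hG hwGt with h | ⟨hn, h⟩
    · exfalso
      have h7 := (h F (adj_symm.1 hw1)).1 hF
      have h8 : w.1 ⊓ G.1 = F.1 ⊓ G.1 := Submodule.eq_of_le_of_finrank_le (le_inf h7 inf_le_right) (by omega)
      apply h4
      rw [← hw2]
      exact le_inf (h8 ▸ inf_le_left) inf_le_left
    · exact ih w hwF G hG H hH hwGt (by omega) h

end prop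

theorem ekr_field (ht : 1 ≤ t) (htk : t < k) (hkn : 2 * k ≤ finrank K V) {T0 : Submodule K V} (hT0 : finrank K T0 = t)
    {𝓕 : Finset (Gr K V k)} (h𝓕 : TInt t 𝓕) (hc : 𝓕.card = (star k T0).card) :
    (∃ T : Submodule K V, finrank K T = t ∧ ∀ F ∈ 𝓕, T ≤ F.1) ∨
    (finrank K V = 2 * k ∧ ∃ S : Submodule K V, finrank K S = 2 * k - t ∧ ∀ F ∈ 𝓕, F.1 ≤ S) := by
  have hchi := (ekr_core htk.le hkn hT0 𝓕 h𝓕).2 hc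
  by_cases hopp : ∃ F ∈ 𝓕, ∃ G ∈ 𝓕, finrank K ↥(F.1 ⊓ G.1) = t
  · obtain ⟨F, hF, G, hG, hFG⟩ := hopp
    rcases local_lemma htk hkn h𝓕 hchi hF ht hG hFG with h | ⟨hn, h⟩
    · left
      refine ⟨F.1 ⊓ G.1, hFG, fun H hH => ?_⟩
      exact propI htk hkn h𝓕 hchi ht (finrank K ↥(F.1 ⊓ H.1) - t) F hF G hG H hH hFG (by have := h𝓕 F hF H hH; omega) h
    · right
      refine ⟨hn, F.1 ⊔ G.1, by have := sup_dim hFG; omega, fun H hH => ?_⟩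
      exact propII htk hkn h𝓕 hchi ht hn (finrank K ↥(F.1 ⊓ H.1) - t) F hF G hG H hH hFG (by have := h𝓕 F hF H hH; omega) h
  · exfalso
    push Not at hopp
    have h1 : TInt (t+1) 𝓕 := by
      intro F hF G hG
      have := h𝓕 F hF G hG
      have := hopp F hF G hG
      omega
    obtain ⟨T1, hT1, -, hd1⟩ := exists_atom (le_top : T0 ≤ ⊤) (by rw [finrank_top]; omega)
    have h2 := (ekr_core (t := t+1) htk hkn (by omega) 𝓕 h1 (T := T1)).1
    have h3 : star k T1 ⊂ star k T0 := by
      rw [Finset.ssubset_iff_of_subset (fun F hF => by rw [mem_star] at hF ⊢; exact hT1.trans hF)]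
      obtain ⟨P, p1, -, p3, p4⟩ := av1 (le_top : T0 ≤ ⊤) (le_top : T1 ≤ ⊤) (fun h => by have := Submodule.finrank_mono h; omega)
      rw [finrank_top] at p3
      obtain ⟨F, f1, f2, f3⟩ := exists_between p1 k (by omega) (by omega)
      exact ⟨⟨F, f3⟩, by rw [mem_star]; exact f1, by rw [mem_star]; exact fun h => p4 (h.trans f2)⟩
    have := Finset.card_lt_card h3
    omega

end EKR
end EKRA9

section EKRB1
set_option linter.unusedSectionVars false
set_option linter.deprecated false
set_option linter.unusedVariables false
open Finset Module
open scoped Classical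

namespace EKR

structure CR {R K : Type*} [Ring R] [Field K] (ρ : R →+* K) (π : R) (m : ℕ) : Prop where
  pos : 1 ≤ m
  unit : ∀ x, ρ x ≠ 0 → IsUnit x
  kerl : ∀ x, ρ x = 0 → ∃ y, x = y * π
  kerr : ∀ x, ρ x = 0 → ∃ y, x = π * y
  rpi : ρ π = 0
  nil : π ^ m = 0
  nil' : π ^ (m-1) ≠ 0

variable {R K : Type*} [Ring R] [Field K]

def red (ρ : R →+* K) (n : ℕ) : (Fin n → R) →ₛₗ[ρ] (Fin n → K) where
  toFun v := fun c => ρ (v c)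
  map_add' x y := by ext c; simp
  map_smul' r x := by ext c; simp

variable {ρ : R →+* K} [RingHomSurjective ρ] {π : R} {m n : ℕ}

lemma red_apply (x : Fin n → R) (c : Fin n) : red ρ n x c = ρ (x c) := rfl

lemma red_surj : Function.Surjective (red ρ n) := by
  intro v
  choose f hf using (RingHomSurjective.is_surjective (σ := ρ))
  exact ⟨fun c => f (v c), by ext c; exact hf _⟩

def res (ρ : R →+* K) [RingHomSurjective ρ] (F : Submodule R (Fin n → R)) : Submodule K (Fin n → K) := F.map (red ρ n)

lemma mem_res {F : Submodule R (Fin n → R)} {a : Fin n → K} : a ∈ res ρ F ↔ ∃ x ∈ F, red ρ n x = a := Submodule.mem_map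

lemma red_mem_res {F : Submodule R (Fin n → R)} {x : Fin n → R} (h : x ∈ F) : red ρ n x ∈ res ρ F := mem_res.2 ⟨x, h, rfl⟩

lemma res_mono {F G : Submodule R (Fin n → R)} (h : F ≤ G) : res ρ F ≤ res ρ G := Submodule.map_mono h

lemma res_inf {F G : Submodule R (Fin n → R)} : res ρ (F ⊓ G) ≤ res ρ F ⊓ res ρ G :=
  le_inf (res_mono inf_le_left) (res_mono inf_le_right)

lemma res_sup {F G : Submodule R (Fin n → R)} : res ρ (F ⊔ G) = res ρ F ⊔ res ρ G := Submodule.map_sup _ _ _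

lemma res_span (s : Set (Fin n → R)) : res ρ (Submodule.span R s) = Submodule.span K (red ρ n '' s) := Submodule.map_span _ _

def Pure (ρ : R →+* K) (π : R) (F : Submodule R (Fin n → R)) : Prop :=
  ∀ x ∈ F, red ρ n x = 0 → ∃ y ∈ F, x = π • y

namespace CR
variable (h : CR ρ π m)
include h

lemma pow_ne {s : ℕ} (hs : s < m) : π ^ s ≠ 0 := by
  intro h0
  apply h.nil'
  rw [show m - 1 = s + (m - 1 - s) by omega, pow_add, h0, zero_mul]

lemma red_pi (x : Fin n → R) : red ρ n (π • x) = 0 := by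
  rw [LinearMap.map_smulₛₗ, h.rpi, zero_smul]

lemma K0 {s : ℕ} (hs : s < m) {x : Fin n → R} (hx : π ^ s • x = 0) : red ρ n x = 0 := by
  ext c
  by_contra hc
  obtain ⟨u, hu⟩ := h.unit (x c) hc
  have h1 : π ^ s * x c = 0 := congrFun hx c
  rw [← hu] at h1
  exact h.pow_ne hs (by simpa using h1)

lemma ker_red {x : Fin n → R} (hx : red ρ n x = 0) : ∃ y, x = π • y := by
  choose f hf using fun c => h.kerr (x c) (congrFun hx c)
  exact ⟨f, by ext c; exact hf c⟩

lemma pure_top : Pure ρ π (⊤ : Submodule R (Fin n → R)) := by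
  intro x _ hx
  obtain ⟨y, hy⟩ := h.ker_red hx
  exact ⟨y, trivial, hy⟩

lemma nak {F S : Submodule R (Fin n → R)} (hF : Pure ρ π F) (hS : S ≤ F) (hr : res ρ F ≤ res ρ S) : S = F := by
  apply le_antisymm hS
  intro x hx
  have key : ∀ s : ℕ, ∀ x ∈ F, ∃ y ∈ S, ∃ z ∈ F, x = y + π ^ s • z := by
    intro s
    induction s with
    | zero => intro x hx; exact ⟨0, S.zero_mem, x, hx, by simp⟩
    | succ s ih =>
      intro x hx
      obtain ⟨y, hy, hyx⟩ := mem_res.1 (hr (red_mem_res hx))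
      obtain ⟨z, hz, hz'⟩ := hF (x - y) (F.sub_mem hx (hS hy)) (by rw [map_sub, hyx, sub_self])
      obtain ⟨y1, hy1, z1, hz1, e⟩ := ih z hz
      refine ⟨y + π • y1, S.add_mem hy (S.smul_mem _ hy1), z1, hz1, ?_⟩
      rw [eq_add_of_sub_eq' hz', e, smul_add, smul_smul, pow_succ', add_assoc]
  obtain ⟨y, hy, z, hz, e⟩ := key m x hx
  rw [h.nil, zero_smul, add_zero] at e
  rw [e]; exact hy

lemma comb_ker {ι : Type*} [Fintype ι] {b : ι → Fin n → R} (hb : LinearIndependent K (fun i => red ρ n (b i))) {r : ι → R}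
    (hr : red ρ n (∑ i, r i • b i) = 0) : ∀ i, ρ (r i) = 0 := by
  rw [map_sum] at hr
  simp only [LinearMap.map_smulₛₗ] at hr
  exact Fintype.linearIndependent_iff.1 hb _ hr

lemma pure_span {ι : Type*} [Fintype ι] {b : ι → Fin n → R} (hb : LinearIndependent K (fun i => red ρ n (b i))) :
    Pure ρ π (Submodule.span R (Set.range b)) := by
  intro x hx hr
  obtain ⟨r, rfl⟩ := (Submodule.mem_span_range_iff_exists_fun R).1 hx
  choose y hy using fun i => h.kerr (r i) (h.comb_ker hb hr i)
  refine ⟨∑ i, y i • b i, Submodule.sum_mem _ fun i _ => Submodule.smul_mem _ _ (Submodule.subset_span ⟨i, rfl⟩), ?_⟩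
  rw [Finset.smul_sum]
  apply Finset.sum_congr rfl; intro i _
  rw [smul_smul, ← hy]

lemma linInd {ι : Type*} [Fintype ι] {b : ι → Fin n → R} (hb : LinearIndependent K (fun i => red ρ n (b i))) :
    LinearIndependent R b := by
  rw [Fintype.linearIndependent_iff]
  intro r hr
  have key : ∀ s, s ≤ m → ∃ y : ι → R, ∀ i, r i = π ^ s * y i := by
    intro s
    induction s with
    | zero => intro _; exact ⟨r, by simp⟩
    | succ s ih =>
      intro hs
      obtain ⟨y, hy⟩ := ih (by omega)
      have h1 : π ^ s • (∑ i, y i • b i) = 0 := by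
        rw [← hr, Finset.smul_sum]; apply Finset.sum_congr rfl; intro i _; rw [smul_smul, ← hy]
      have h2 := h.K0 (by omega) h1
      choose z hz using fun i => h.kerr (y i) (h.comb_ker hb h2 i)
      exact ⟨z, fun i => by rw [hy, hz, pow_succ, mul_assoc]⟩
  obtain ⟨y, hy⟩ := key m le_rfl
  intro i; rw [hy, h.nil, zero_mul]

/-- lifts of subspaces -/
lemma exists_lift {X : Submodule R (Fin n → R)} {C : Submodule K (Fin n → K)} (hC : C ≤ res ρ X) :
    ∃ F, F ≤ X ∧ Pure ρ π F ∧ res ρ F = C ∧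
      ∃ b : Fin (finrank K C) → Fin n → R, LinearIndependent K (fun i => red ρ n (b i)) ∧ F = Submodule.span R (Set.range b) := by
  let B := finBasis K C
  choose b hb using fun i => mem_res.1 (hC (B i).2)
  have hbe : (fun i => red ρ n (b i)) = fun i => ((B i : C) : Fin n → K) := by ext1 i; exact (hb i).2
  have hli : LinearIndependent K (fun i => red ρ n (b i)) := by
    rw [hbe]; exact B.linearIndependent.map' C.subtype (Submodule.ker_subtype _)
  refine ⟨Submodule.span R (Set.range b), ?_, h.pure_span hli, ?_, b, hli, rfl⟩
  · rw [Submodule.span_le]; rintro _ ⟨i, rfl⟩; exact (hb i).1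
  · rw [res_span, ← Set.range_comp]
    have : (red ρ n) ∘ b = fun i => ((B i : C) : Fin n → K) := hbe
    rw [this]
    have h2 := congrArg (Submodule.map C.subtype) B.span_eq
    rw [Submodule.map_span, ← Set.range_comp, Submodule.map_subtype_top] at h2
    exact h2

lemma exists_basis {F : Submodule R (Fin n → R)} (hF : Pure ρ π F) {j : ℕ} (hj : finrank K (res ρ F) = j) :
    ∃ b : Fin j → Fin n → R, LinearIndependent K (fun i => red ρ n (b i)) ∧ F = Submodule.span R (Set.range b) := by
  subst hj
  obtain ⟨G, hG, hGp, hGr, b, hb, hGb⟩ := h.exists_lift (le_refl (res ρ F))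
  have := h.nak hF hG hGr.symm.le
  exact ⟨b, hb, this.symm.trans hGb⟩

lemma pure_sup {U D : Submodule R (Fin n → R)} (hU : Pure ρ π U) (hD : Pure ρ π D) (hUD : res ρ U ⊓ res ρ D = ⊥) :
    Pure ρ π (U ⊔ D) := by
  intro x hx hr
  obtain ⟨u, hu, d, hd, rfl⟩ := Submodule.mem_sup.1 hx
  rw [map_add] at hr
  have h1 : red ρ n u = - red ρ n d := eq_neg_of_add_eq_zero_left hr
  have h2 : red ρ n u ∈ res ρ U ⊓ res ρ D := ⟨red_mem_res hu, h1 ▸ (res ρ D).neg_mem (red_mem_res hd)⟩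
  rw [hUD, Submodule.mem_bot] at h2
  obtain ⟨u', hu', e1⟩ := hU u hu h2
  obtain ⟨d', hd', e2⟩ := hD d hd (by rw [h2, zero_add] at hr; exact hr)
  exact ⟨u' + d', Submodule.add_mem_sup hu' hd', by rw [smul_add, ← e1, ← e2]⟩

lemma exists_lift_ge {U : Submodule R (Fin n → R)} (hU : Pure ρ π U) {C : Submodule K (Fin n → K)} (hC : res ρ U ≤ C) :
    ∃ F, U ≤ F ∧ Pure ρ π F ∧ res ρ F = C := by
  obtain ⟨D0, hD0⟩ := Submodule.exists_isCompl (res ρ U)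
  have htop : res ρ (⊤ : Submodule R (Fin n → R)) = ⊤ := by
    rw [eq_top_iff]; intro v _; obtain ⟨x, hx⟩ := red_surj (ρ := ρ) v; exact mem_res.2 ⟨x, trivial, hx⟩
  obtain ⟨D, -, hDp, hDr, -⟩ := h.exists_lift (X := ⊤) (C := C ⊓ D0) (by rw [htop]; exact le_top)
  refine ⟨U ⊔ D, le_sup_left, h.pure_sup hU hDp ?_, ?_⟩
  · rw [hDr, ← le_bot_iff, ← hD0.inf_eq_bot]; exact inf_le_inf_left _ inf_le_right
  · rw [res_sup, hDr, inf_comm, ← sup_inf_assoc_of_le _ hC, hD0.sup_eq_top, top_inf_eq]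

lemma pure_pow {F : Submodule R (Fin n → R)} (hF : Pure ρ π F) {s : ℕ} (hs : s ≤ m) {z : Fin n → R} (hz : π ^ s • z ∈ F) :
    ∃ f ∈ F, π ^ s • z = π ^ s • f := by
  have key : ∀ j, j ≤ s → ∃ f ∈ F, π ^ s • z = π ^ j • f := by
    intro j
    induction j with
    | zero => intro _; exact ⟨_, hz, by simp⟩
    | succ j ih =>
      intro hj
      obtain ⟨f, hf, e⟩ := ih (by omega)
      have h1 : π ^ j • (f - π ^ (s - j) • z) = 0 := by
        rw [smul_sub, ← e, smul_smul, ← pow_add, show j + (s - j) = s by omega, sub_self]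
      have h2 := h.K0 (by omega) h1
      rw [map_sub, show s - j = (s - j - 1) + 1 by omega, pow_succ', ← smul_smul, h.red_pi, sub_zero] at h2
      obtain ⟨f', hf', e'⟩ := hF f hf h2
      exact ⟨f', hf', by rw [e, e', smul_smul, pow_succ]⟩
  exact key s le_rfl

/-- intersection lemma -/
lemma inf_le_of {F G U : Submodule R (Fin n → R)} (hF : Pure ρ π F) (hG : Pure ρ π G) (hUF : U ≤ F) (hUG : U ≤ G)
    (hr : res ρ F ⊓ res ρ G ≤ res ρ U) : F ⊓ G ≤ U := by
  rintro x ⟨hxF, hxG⟩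
  have key : ∀ s, s ≤ m → ∃ y ∈ U, ∃ f ∈ F, ∃ g ∈ G, x = y + π ^ s • f ∧ x = y + π ^ s • g := by
    intro s
    induction s with
    | zero => intro _; exact ⟨0, U.zero_mem, x, hxF, x, hxG, by simp, by simp⟩
    | succ s ih =>
      intro hs
      obtain ⟨y, hy, f, hf, g, hg, e1, e2⟩ := ih (by omega)
      have h1 : π ^ s • (f - g) = 0 := by
        rw [smul_sub, sub_eq_zero]; exact add_left_cancel (e1.symm.trans e2)
      have h2 := h.K0 (by omega) h1
      rw [map_sub, sub_eq_zero] at h2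
      obtain ⟨u, hu, hur⟩ := mem_res.1 (hr ⟨red_mem_res hf, h2 ▸ red_mem_res hg⟩)
      obtain ⟨f', hf', ef⟩ := hF (f - u) (F.sub_mem hf (hUF hu)) (by rw [map_sub, hur, sub_self])
      obtain ⟨g', hg', eg⟩ := hG (g - u) (G.sub_mem hg (hUG hu)) (by rw [map_sub, hur, h2, sub_self])
      refine ⟨y + π ^ s • u, U.add_mem hy (U.smul_mem _ hu), f', hf', g', hg', ?_, ?_⟩
      · rw [e1, eq_add_of_sub_eq' ef, smul_add, smul_smul, pow_succ, add_assoc]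
      · rw [e2, eq_add_of_sub_eq' eg, smul_add, smul_smul, pow_succ, add_assoc]
  obtain ⟨y, hy, f, hf, g, hg, e1, e2⟩ := key m le_rfl
  rw [h.nil, zero_smul, add_zero] at e1
  rw [e1]; exact hy

lemma val (x : R) : ∃ a : ℕ, ∃ u : R, IsUnit u ∧ x = u * π ^ a := by
  have key : ∀ s : ℕ, (∃ y, x = y * π ^ s) ∨ ∃ a : ℕ, ∃ u : R, IsUnit u ∧ x = u * π ^ a := by
    intro s
    induction s with
    | zero => left; exact ⟨x, by simp⟩
    | succ s ih =>
      rcases ih with ⟨y, hy⟩ | ih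
      · by_cases h0 : ρ y = 0
        · obtain ⟨z, hz⟩ := h.kerl y h0
          left; exact ⟨z, by rw [hy, hz, pow_succ', mul_assoc]⟩
        · right; exact ⟨s, y, h.unit y h0, hy⟩
      · right; exact ih
  rcases key m with ⟨y, hy⟩ | hh
  · exact ⟨m, 1, isUnit_one, by rw [hy, h.nil, mul_zero, mul_zero]⟩
  · exact hh

lemma exists_gen {ι : Type*} [Fintype ι] [Nonempty ι] (r : ι → R) : ∃ j, ∀ i, ∃ s, r i = s * r j := by
  choose a u hu e using fun i => h.val (r i)
  obtain ⟨j, -, hj⟩ := Finset.exists_min_image univ a ⟨Classical.arbitrary ι, mem_univ _⟩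
  refine ⟨j, fun i => ?_⟩
  obtain ⟨v, hv⟩ := hu j
  refine ⟨u i * π ^ (a i - a j) * ↑(v⁻¹), ?_⟩
  have := hj i (mem_univ _)
  conv_rhs => rw [e j, ← hv]
  rw [e i, mul_assoc, Units.inv_mul_cancel_left, mul_assoc, ← pow_add, show a i - a j + a j = a i by omega]

lemma step_dim {X Y : Submodule R (Fin n → R)} {v : Fin n → R} (hX : X ≤ Y ⊔ Submodule.span R {v}) :
    finrank K (res ρ X) ≤ finrank K (res ρ (X ⊓ Y)) + 1 := by
  let B := finBasis K (res ρ X)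
  rcases Nat.eq_zero_or_pos (finrank K (res ρ X)) with h0 | hpos
  · omega
  haveI : Nonempty (Fin (finrank K (res ρ X))) := ⟨⟨0, hpos⟩⟩
  choose b hb hbr using fun i => mem_res.1 (B i).2
  have hli : LinearIndependent K (fun i => red ρ n (b i)) := by
    have : (fun i => red ρ n (b i)) = fun i => ((B i : res ρ X) : Fin n → K) := by ext1 i; exact hbr i
    rw [this]; exact B.linearIndependent.map' (res ρ X).subtype (Submodule.ker_subtype _)
  have hd : ∀ i, ∃ y ∈ Y, ∃ r : R, b i = y + r • v := by
    intro i
    obtain ⟨y, hy, z, hz, e⟩ := Submodule.mem_sup.1 (hX (hb i))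
    obtain ⟨r, rfl⟩ := Submodule.mem_span_singleton.1 hz
    exact ⟨y, hy, r, e.symm⟩
  choose y hy r hyr using hd
  obtain ⟨j, hj⟩ := h.exists_gen r
  choose s hs using hj
  have hmem : ∀ i, b i - s i • b j ∈ X ⊓ Y := by
    intro i
    refine ⟨X.sub_mem (hb i) (X.smul_mem _ (hb j)), ?_⟩
    have : b i - s i • b j = y i - s i • y j := by
      rw [hyr i, hyr j, smul_add, smul_smul, ← hs i]; abel
    rw [this]; exact Y.sub_mem (hy i) (Y.smul_mem _ (hy j))
  have hle : res ρ X ≤ res ρ (X ⊓ Y) ⊔ Submodule.span K {red ρ n (b j)} := by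
    intro a ha
    have h1 : (⟨a, ha⟩ : res ρ X) ∈ Submodule.span K (Set.range B) := by rw [B.span_eq]; trivial
    obtain ⟨c, hc⟩ := (Submodule.mem_span_range_iff_exists_fun K).1 h1
    have h2 := congrArg Subtype.val hc
    simp only [AddSubmonoidClass.coe_finset_sum, SetLike.val_smul] at h2
    rw [← h2]
    apply Submodule.sum_mem; intro i _
    apply Submodule.smul_mem
    rw [← hbr i]
    have h3 : red ρ n (b i) = red ρ n (b i - s i • b j) + ρ (s i) • red ρ n (b j) := by
      rw [map_sub, LinearMap.map_smulₛₗ, sub_add_cancel]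
    rw [h3]
    exact Submodule.add_mem_sup (red_mem_res (hmem i)) (Submodule.smul_mem _ _ (Submodule.mem_span_singleton_self _))
  have h4 := Submodule.finrank_mono hle
  have h5 := Submodule.finrank_add_le_finrank_add_finrank (res ρ (X ⊓ Y)) (Submodule.span K {red ρ n (b j)})
  have h6 := finrank_span_le_card (R := K) ({red ρ n (b j)} : Set (Fin n → K))
  simp at h6
  omega

lemma steps_dim (d : ℕ) (v : Fin d → Fin n → R) {X Y : Submodule R (Fin n → R)} (hX : X ≤ Y ⊔ Submodule.span R (Set.range v)) :
    finrank K (res ρ X) ≤ finrank K (res ρ (X ⊓ Y)) + d := by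
  induction d generalizing Y with
  | zero =>
    have : Set.range v = ∅ := Set.range_eq_empty _
    rw [this, Submodule.span_empty, sup_bot_eq] at hX
    rw [inf_eq_left.2 hX]; omega
  | succ d ih =>
    have h1 : Y ⊔ Submodule.span R (Set.range v) = (Y ⊔ Submodule.span R {v 0}) ⊔ Submodule.span R (Set.range (Fin.tail v)) := by
      rw [sup_assoc, ← Submodule.span_union]
      congr 2
      conv_lhs => rw [← Fin.cons_self_tail v, Fin.range_cons]
      rfl
    rw [h1] at hX
    have h2 := ih _ hX
    have h3 := h.step_dim (X := X ⊓ (Y ⊔ Submodule.span R {v 0})) (Y := Y) inf_le_right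
    have h4 : X ⊓ (Y ⊔ Submodule.span R {v 0}) ⊓ Y ≤ X ⊓ Y := inf_le_inf_right _ inf_le_left
    have h5 := Submodule.finrank_mono (res_mono (ρ := ρ) h4)
    omega

/-- two pure submodules of a pure submodule -/
lemma inf_dim {Q F G : Submodule R (Fin n → R)} (hQ : Pure ρ π Q) (hG : Pure ρ π G) (hFQ : F ≤ Q) (hGQ : G ≤ Q) :
    finrank K (res ρ F) + finrank K (res ρ G) ≤ finrank K (res ρ (F ⊓ G)) + finrank K (res ρ Q) := by
  obtain ⟨D0, hD0⟩ := Submodule.exists_isCompl (res ρ G)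
  obtain ⟨D, hDQ, hDp, hDr, v, hv, hDv⟩ := h.exists_lift (X := Q) (C := res ρ Q ⊓ D0) inf_le_left
  have hsup : res ρ G ⊔ (res ρ Q ⊓ D0) = res ρ Q := by
    rw [inf_comm, ← sup_inf_assoc_of_le _ (res_mono hGQ), hD0.sup_eq_top, top_inf_eq]
  have hinf : res ρ G ⊓ (res ρ Q ⊓ D0) = ⊥ := by
    rw [← le_bot_iff, ← hD0.inf_eq_bot]; exact inf_le_inf_left _ inf_le_right
  have e1 : G ⊔ D = Q := h.nak hQ (sup_le hGQ hDQ) (by rw [res_sup, hDr, hsup])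
  have e2 := h.steps_dim _ v (X := F) (Y := G) (by rw [← hDv, e1]; exact hFQ)
  have e3 := Submodule.finrank_sup_add_finrank_inf_eq (res ρ G) (res ρ Q ⊓ D0)
  rw [hsup, hinf, finrank_bot] at e3
  omega

lemma free_of {F : Submodule R (Fin n → R)} (hF : Pure ρ π F) {j : ℕ} (hj : finrank K (res ρ F) = j) :
    Nonempty (F ≃ₗ[R] (Fin j → R)) := by
  obtain ⟨b, hb, rfl⟩ := h.exists_basis hF hj
  exact ⟨(Basis.span (h.linInd hb)).equivFun⟩

lemma of_free {F : Submodule R (Fin n → R)} {j : ℕ} (hf : Nonempty (F ≃ₗ[R] (Fin j → R))) :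
    Pure ρ π F ∧ finrank K (res ρ F) = j := by
  obtain ⟨e⟩ := hf
  let B : Basis (Fin j) R F := Basis.ofEquivFun e
  have hli : LinearIndependent K (fun i => red ρ n (B i : Fin n → R)) := by
    rw [Fintype.linearIndependent_iff]
    intro c hc
    choose r hr using fun i => RingHomSurjective.is_surjective (σ := ρ) (c i)
    have h1 : red ρ n (∑ i, r i • (B i : Fin n → R)) = 0 := by
      rw [map_sum, ← hc]; apply Finset.sum_congr rfl; intro i _; rw [LinearMap.map_smulₛₗ, hr]
    obtain ⟨y, hy⟩ := h.ker_red h1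
    have h2 : ∑ i, (π ^ (m-1) * r i) • B i = 0 := by
      apply Subtype.ext
      simp only [AddSubmonoidClass.coe_finset_sum, SetLike.val_smul, mul_smul, ZeroMemClass.coe_zero]
      rw [← Finset.smul_sum, hy, smul_smul, ← pow_succ, show m - 1 + 1 = m by have := h.pos; omega, h.nil, zero_smul]
    have h3 := Fintype.linearIndependent_iff.1 B.linearIndependent _ h2
    intro i
    rw [← hr i]
    by_contra hne
    obtain ⟨u, hu⟩ := h.unit _ hne
    have h4 := h3 i
    rw [← hu] at h4
    exact h.nil' (by simpa using h4)
  have hF : F = Submodule.span R (Set.range fun i => (B i : Fin n → R)) := by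
    have h2 := congrArg (Submodule.map F.subtype) B.span_eq
    rw [Submodule.map_span, ← Set.range_comp, Submodule.map_subtype_top] at h2
    exact h2.symm
  constructor
  · rw [hF]; exact h.pure_span hli
  · rw [hF, res_span, ← Set.range_comp]
    exact (finrank_span_eq_card hli).trans (by simp)

end CR
end EKR
end EKRB1

section EKRB2
set_option linter.unusedSectionVars false
set_option linter.deprecated false
set_option linter.unusedVariables false
open Finset Module
open scoped Classical

namespace EKR

structure Step {R R' K : Type*} [Ring R] [Ring R'] [Field K] (ρ : R →+* K) (π : R) (m n : ℕ) (ρ' : R' →+* K) (σ : R →+* R')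
    (ι : (Fin n → K) →+ (Fin n → R)) (τ : K →+* K) : Prop where
  hm : 2 ≤ m
  comp : ∀ r, ρ' (σ r) = ρ r
  cr : CR ρ π m
  cr' : CR ρ' (σ π) (m-1)
  ker : ∀ r, σ r = 0 → ∃ y, r = π ^ (m-1) * y
  iota_red : ∀ v, ι (red ρ n v) = π ^ (m-1) • v
  smul_iota : ∀ r v, r • ι v = ι (τ (ρ r) • v)

section
universe u v
variable {R : Type u} {K : Type v} [Ring R] [Field K] {ρ : R →+* K} [RingHomSurjective ρ] {π : R} {m n : ℕ}

lemma CR.top_mul (h : CR ρ π m) {x : R} (hx : ρ x = 0) : π ^ (m-1) * x = 0 := by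
  obtain ⟨y, rfl⟩ := h.kerr x hx
  rw [← mul_assoc, ← pow_succ, show m - 1 + 1 = m by have := h.pos; omega, h.nil, zero_mul]

lemma CR.mul_top (h : CR ρ π m) {x : R} (hx : ρ x = 0) : x * π ^ (m-1) = 0 := by
  obtain ⟨y, rfl⟩ := h.kerl x hx
  rw [mul_assoc, ← pow_succ', show m - 1 + 1 = m by have := h.pos; omega, h.nil, mul_zero]

lemma CR.top_inj (h : CR ρ π m) {x : R} (hx : π ^ (m-1) * x = 0) : ρ x = 0 := by
  by_contra hc
  obtain ⟨u, hu⟩ := h.unit x hc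
  rw [← hu] at hx
  exact h.nil' (by simpa using hx)

lemma CR.top_eq (h : CR ρ π m) {x y : R} : π ^ (m-1) * x = π ^ (m-1) * y ↔ ρ x = ρ y := by
  rw [← sub_eq_zero, ← mul_sub, ← sub_eq_zero (a := ρ x), ← map_sub]
  exact ⟨h.top_inj, h.top_mul⟩

lemma CR.comm (h : CR ρ π m) (r : R) (s : ℕ) : ∃ r', r * π ^ s = π ^ s * r' := by
  induction s with
  | zero => exact ⟨r, by simp⟩
  | succ s ih =>
    obtain ⟨r', hr'⟩ := ih
    obtain ⟨y, hy⟩ := h.kerr (r' * π) (by rw [map_mul, h.rpi, mul_zero])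
    exact ⟨y, by rw [pow_succ, ← mul_assoc, hr', mul_assoc, hy, mul_assoc]⟩

lemma CR.comm' (h : CR ρ π m) (r : R) (s : ℕ) : ∃ r', π ^ s * r = r' * π ^ s := by
  induction s with
  | zero => exact ⟨r, by simp⟩
  | succ s ih =>
    obtain ⟨r', hr'⟩ := ih
    obtain ⟨y, hy⟩ := h.kerl (π * r') (by rw [map_mul, h.rpi, zero_mul])
    exact ⟨y, by rw [pow_succ', mul_assoc, hr', ← mul_assoc, hy, mul_assoc]⟩

theorem CR.exists_step (h : CR ρ π m) (hm : 2 ≤ m) (n : ℕ) :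
    ∃ (R' : Type u) (_ : Ring R') (ρ' : R' →+* K) (_ : RingHomSurjective ρ') (σ : R →+* R') (_ : RingHomSurjective σ)
      (ι : (Fin n → K) →+ (Fin n → R)) (τ : K →+* K), Step ρ π m n ρ' σ ι τ := by
  obtain ⟨f, hf⟩ := (RingHomSurjective.is_surjective (σ := ρ)).hasRightInverse
  choose g hg using fun r => h.comm r (m-1)
  let I : Ideal R := Ideal.span {π ^ (m-1)}
  have hI : ∀ x, x ∈ I ↔ ∃ y, x = y * π ^ (m-1) := by
    intro x
    rw [Ideal.mem_span_singleton']; simp only [eq_comm]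
  haveI : I.IsTwoSided := ⟨fun {a} b ha => by
    obtain ⟨y, rfl⟩ := (hI _).1 ha
    obtain ⟨z, hz⟩ := h.comm' b (m-1)
    exact (hI _).2 ⟨y * z, by rw [mul_assoc, hz, mul_assoc]⟩⟩
  have hrI : ∀ x, x ∈ I → ρ x = 0 := by
    intro x hx
    obtain ⟨y, rfl⟩ := (hI _).1 hx
    rw [map_mul, map_pow, h.rpi, zero_pow (by omega), mul_zero]
  let ρ' : R ⧸ I →+* K := Ideal.Quotient.lift I ρ hrI
  let σ : R →+* R ⧸ I := Ideal.Quotient.mk I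
  have hcomp : ∀ r, ρ' (σ r) = ρ r := fun r => Ideal.Quotient.lift_mk _ _ _
  have hσs : Function.Surjective σ := Ideal.Quotient.mk_surjective
  have hσ0 : ∀ r, σ r = 0 ↔ r ∈ I := fun r => Ideal.Quotient.eq_zero_iff_mem
  let ι : (Fin n → K) →+ (Fin n → R) :=
    { toFun := fun v c => π ^ (m-1) * f (v c)
      map_zero' := by ext c; exact h.top_mul (hf _)
      map_add' := by
        intro v w; ext c
        simp only [Pi.add_apply]
        rw [← mul_add, h.top_eq, map_add, hf, hf, hf] }
  have hgρ : ∀ r s, r * π ^ (m-1) = π ^ (m-1) * s → ρ (g r) = ρ s := by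
    intro r s hs
    rw [← h.top_eq (m := m), ← hg, hs]
  have hgρ' : ∀ r s, ρ r = ρ s → ρ (g r) = ρ (g s) := by
    intro r s hs
    apply hgρ
    rw [← hg, ← sub_eq_zero, ← sub_mul]
    exact h.mul_top (by rw [map_sub, hs, sub_self])
  let τ : K →+* K :=
    { toFun := fun c => ρ (g (f c))
      map_one' := by
        rw [hgρ' _ 1 (by rw [hf, map_one]), hgρ 1 1 (by simp), map_one]
      map_mul' := by
        intro c d
        rw [hgρ' _ (f c * f d) (by rw [hf, map_mul, hf, hf]), ← map_mul]
        apply hgρ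
        rw [mul_assoc, hg, ← mul_assoc, hg, mul_assoc]
      map_zero' := by
        rw [hgρ' _ 0 (by rw [hf, map_zero]), hgρ 0 0 (by simp), map_zero]
      map_add' := by
        intro c d
        rw [hgρ' _ (f c + f d) (by rw [hf, map_add, hf, hf]), ← map_add]
        apply hgρ
        rw [add_mul, hg, hg, mul_add] }
  have hτ : ∀ r, τ (ρ r) = ρ (g r) := fun r => hgρ' _ _ (hf _)
  refine ⟨R ⧸ I, inferInstance, ρ', ⟨fun c => ⟨σ (f c), by rw [hcomp, hf]⟩⟩, σ, ⟨hσs⟩, ι, τ, ?_⟩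
  refine ⟨hm, hcomp, h, ⟨by omega, ?_, ?_, ?_, ?_, ?_, ?_⟩, ?_, ?_, ?_⟩
  · intro x hx
    obtain ⟨r, rfl⟩ := hσs x
    exact (h.unit r (by rwa [hcomp] at hx)).map σ
  · intro x hx
    obtain ⟨r, rfl⟩ := hσs x
    rw [hcomp] at hx
    obtain ⟨y, rfl⟩ := h.kerl r hx
    exact ⟨σ y, map_mul _ _ _⟩
  · intro x hx
    obtain ⟨r, rfl⟩ := hσs x
    rw [hcomp] at hx
    obtain ⟨y, rfl⟩ := h.kerr r hx
    exact ⟨σ y, map_mul _ _ _⟩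
  · rw [hcomp, h.rpi]
  · rw [← map_pow, hσ0, hI]; exact ⟨1, by simp⟩
  · rw [← map_pow, Ne, hσ0, hI]
    rintro ⟨y, hy⟩
    have h1 : π ^ (m - 1 - 1) * π = 0 * π := by
      rw [hy, mul_assoc, ← pow_succ, show m - 1 + 1 = m by omega, h.nil, mul_zero, zero_mul]
    rw [zero_mul, ← pow_succ, show m - 1 - 1 + 1 = m - 1 by omega] at h1
    exact h.nil' h1
  · intro r hr
    obtain ⟨y, rfl⟩ := (hI _).1 ((hσ0 _).1 hr)
    exact ⟨_, hg y⟩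
  · intro v; ext c
    exact h.top_eq.2 (hf _)
  · intro r v; ext c
    change r * (π ^ (m-1) * f (v c)) = π ^ (m-1) * f (τ (ρ r) * v c)
    rw [← mul_assoc, hg, mul_assoc, h.top_eq, map_mul, hf, hf, hτ]
end

section
variable {R R' K : Type*} [Ring R] [Ring R'] [Field K] {ρ : R →+* K} [RingHomSurjective ρ] {π : R} {m n : ℕ}
  {ρ' : R' →+* K} [RingHomSurjective ρ'] {σ : R →+* R'} [RingHomSurjective σ] {ι : (Fin n → K) →+ (Fin n → R)} {τ : K →+* K}

def sM (σ : R →+* R') (n : ℕ) : (Fin n → R) →ₛₗ[σ] (Fin n → R') where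
  toFun v := fun c => σ (v c)
  map_add' x y := by ext c; simp
  map_smul' r x := by ext c; simp

def dn (σ : R →+* R') [RingHomSurjective σ] (F : Submodule R (Fin n → R)) : Submodule R' (Fin n → R') := F.map (sM σ n)

lemma mem_dn {F : Submodule R (Fin n → R)} {a : Fin n → R'} : a ∈ dn σ F ↔ ∃ x ∈ F, sM σ n x = a := Submodule.mem_map

lemma sM_mem_dn {F : Submodule R (Fin n → R)} {x : Fin n → R} (h : x ∈ F) : sM σ n x ∈ dn σ F := mem_dn.2 ⟨x, h, rfl⟩

lemma dn_mono {F G : Submodule R (Fin n → R)} (h : F ≤ G) : dn σ F ≤ dn σ G := Submodule.map_mono h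

lemma sM_surj : Function.Surjective (sM σ n) := by
  intro v
  choose f hf using (RingHomSurjective.is_surjective (σ := σ))
  exact ⟨fun c => f (v c), by ext c; exact hf _⟩

namespace Step
variable (h : Step ρ π m n ρ' σ ι τ)
include h

lemma red_sM (x : Fin n → R) : red ρ' n (sM σ n x) = red ρ n x := by
  ext c; exact h.comp _

lemma iota_inj {v : Fin n → K} (hv : ι v = 0) : v = 0 := by
  obtain ⟨x, rfl⟩ := red_surj (ρ := ρ) v
  rw [h.iota_red] at hv
  exact h.cr.K0 (by have := h.hm; omega) hv

lemma sM_iota (v : Fin n → K) : sM σ n (ι v) = 0 := by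
  obtain ⟨x, rfl⟩ := red_surj (ρ := ρ) v
  rw [h.iota_red, LinearMap.map_smulₛₗ, map_pow, h.cr'.nil, zero_smul]

lemma red_iota (v : Fin n → K) : red ρ n (ι v) = 0 := by
  rw [← h.red_sM, h.sM_iota, map_zero]

lemma sM_ker {x : Fin n → R} (hx : sM σ n x = 0) : ∃ v, x = ι v := by
  choose f hf using fun c => h.ker (x c) (congrFun hx c)
  exact ⟨red ρ n f, by rw [h.iota_red]; ext c; exact hf c⟩

lemma sM_eq {x y : Fin n → R} (hx : sM σ n x = sM σ n y) : ∃ v, x = y + ι v := by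
  obtain ⟨v, hv⟩ := h.sM_ker (x := x - y) (by rw [map_sub, hx, sub_self])
  exact ⟨v, by rw [← hv]; abel⟩

lemma pi_iota (v : Fin n → K) : π • ι v = 0 := by
  rw [h.smul_iota, h.cr.rpi, map_zero, zero_smul, map_zero]

lemma iota_mem {F : Submodule R (Fin n → R)} (hF : Pure ρ π F) {v : Fin n → K} : ι v ∈ F ↔ v ∈ res ρ F := by
  constructor
  · intro hv
    obtain ⟨x, rfl⟩ := red_surj (ρ := ρ) v
    rw [h.iota_red] at hv
    obtain ⟨f, hf, e⟩ := h.cr.pure_pow hF (by omega) hv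
    rw [← h.iota_red, ← h.iota_red] at e
    have : red ρ n x = red ρ n f := by
      rw [← sub_eq_zero]; apply h.iota_inj; rw [map_sub, e, sub_self]
    rw [this]; exact red_mem_res hf
  · intro hv
    obtain ⟨x, hx, rfl⟩ := mem_res.1 hv
    rw [h.iota_red]; exact F.smul_mem _ hx

lemma res_dn (F : Submodule R (Fin n → R)) : res ρ' (dn σ F) = res ρ F := by
  ext a
  rw [mem_res, mem_res]
  constructor
  · rintro ⟨y, hy, rfl⟩
    obtain ⟨x, hx, rfl⟩ := mem_dn.1 hy
    exact ⟨x, hx, (h.red_sM x).symm⟩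
  · rintro ⟨x, hx, rfl⟩
    exact ⟨_, sM_mem_dn hx, h.red_sM x⟩

lemma pure_dn {F : Submodule R (Fin n → R)} (hF : Pure ρ π F) : Pure ρ' (σ π) (dn σ F) := by
  intro y hy hr
  obtain ⟨x, hx, rfl⟩ := mem_dn.1 hy
  rw [h.red_sM] at hr
  obtain ⟨z, hz, rfl⟩ := hF x hx hr
  exact ⟨_, sM_mem_dn hz, LinearMap.map_smulₛₗ _ _ _⟩

lemma res_inf_dn (F G : Submodule R (Fin n → R)) : res ρ (F ⊓ G) ≤ res ρ' (dn σ F ⊓ dn σ G) := by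
  rw [← h.res_dn]
  exact res_mono (le_inf (dn_mono inf_le_left) (dn_mono inf_le_right))

/-- lift of a pure submodule -/
lemma exists_up {Q' : Submodule R' (Fin n → R')} (hQ' : Pure ρ' (σ π) Q') : ∃ Q, Pure ρ π Q ∧ dn σ Q = Q' := by
  have hle : ∀ y ∈ Q', ∃ x ∈ Q'.comap (sM σ n), sM σ n x = y := by
    intro y hy
    obtain ⟨x, rfl⟩ := sM_surj (σ := σ) y
    exact ⟨x, hy, rfl⟩
  obtain ⟨Q, hQ, hQp, hQr, -⟩ := h.cr.exists_lift (X := Q'.comap (sM σ n)) (C := res ρ' Q') (by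
    intro a ha
    obtain ⟨y, hy, rfl⟩ := mem_res.1 ha
    obtain ⟨x, hx, rfl⟩ := hle y hy
    exact mem_res.2 ⟨x, hx, (h.red_sM x).symm⟩)
  refine ⟨Q, hQp, h.cr'.nak hQ' ?_ ?_⟩
  · intro y hy
    obtain ⟨x, hx, rfl⟩ := mem_dn.1 hy
    exact hQ hx
  · rw [h.res_dn, hQr]
end Step
end
end EKR
end EKRB2

section EKRB3
set_option linter.unusedSectionVars false
set_option linter.deprecated false
set_option linter.unusedVariables false
open Finset Module
open scoped Classical

namespace EKR

lemma exists_ext (K : Type*) [Field K] [Finite K] (l : ℕ) (hl : 1 ≤ l) :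
    ∃ (L : Type) (_ : Field L) (_ : Finite L) (_ : Algebra K L), finrank K L = l := by
  obtain ⟨p, hp⟩ := CharP.exists K
  have : Fact p.Prime := ⟨CharP.char_is_prime K p⟩
  have : NeZero l := ⟨by omega⟩
  exact ⟨FiniteField.Extension K p l, inferInstance, inferInstance, inferInstance, FiniteField.finrank_extension K p l⟩

lemma frob_sum {K L : Type*} [Field K] [Finite K] [Field L] [Algebra K L] {ι : Type*} [Fintype ι] (c : ι → K) (g : ι → L) (j : ℕ) :
    (∑ i, c i • g i) ^ (Nat.card K ^ j) = ∑ i, c i • (g i) ^ (Nat.card K ^ j) := by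
  have := Fintype.ofFinite K
  induction j with
  | zero => simp
  | succ j ih =>
    rw [pow_succ, pow_mul, ih]
    have h1 := map_sum (FiniteField.frobeniusAlgHom K L) (fun i => c i • g i ^ Nat.card K ^ j) univ
    simp only [map_smul, FiniteField.coe_frobeniusAlgHom, ← Nat.card_eq_fintype_card] at h1
    rw [h1]
    simp only [pow_mul]

theorem gab {K L : Type*} [Field K] [Finite K] [Field L] [Finite L] [Algebra K L] {X : Type*} {k t : ℕ} (S : Finset X)
    (w : X → Fin k → L) (hw : ∀ x ∈ S, ∀ y ∈ S, w x = w y → x = y) (τ : K →+* K) (htk : t ≤ k) (hk : k ≤ finrank K L)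
    (hint : ∀ x ∈ S, ∀ y ∈ S, ∃ D : Submodule K (Fin k → K), t ≤ finrank K D ∧ ∀ c ∈ D, ∑ i, τ (c i) • (w x i - w y i) = 0) :
    S.card ≤ Nat.card L ^ (k - t) := by
  have := Fintype.ofFinite L
  set q := Nat.card K with hq
  have hq2 : 2 ≤ q := q_pos
  let B := finBasis K L
  let g : Fin k → L := fun i => B (Fin.castLE hk i)
  have hg : LinearIndependent K g := B.linearIndependent.comp _ (Fin.castLE_injective hk)
  let Φ : X × (Fin t → L) → (Fin k → L) := fun xp i => w xp.1 i + ∑ j, xp.2 j * g i ^ (q ^ (j : ℕ))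
  have hinj : Set.InjOn Φ (S ×ˢ (univ : Finset (Fin t → L)) : Finset (X × (Fin t → L))) := by
    rintro ⟨x, p⟩ hx ⟨y, p'⟩ hy e
    have hx' : x ∈ S := (Finset.mem_product.1 hx).1
    have hy' : y ∈ S := (Finset.mem_product.1 hy).1
    obtain ⟨D, hD, hDc⟩ := hint x hx' y hy'
    let d := fun j => p' j - p j
    have hd : ∀ i, w x i - w y i = ∑ j, d j * g i ^ (q ^ (j : ℕ)) := by
      intro i
      have h1 : w x i + ∑ j, p j * g i ^ (q ^ (j : ℕ)) = w y i + ∑ j, p' j * g i ^ (q ^ (j : ℕ)) := congrFun e i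
      simp only [d, sub_mul, Finset.sum_sub_distrib]
      linear_combination h1
    let P : Polynomial L := ∑ j : Fin t, Polynomial.C (d j) * Polynomial.X ^ (q ^ (j : ℕ))
    let ev : D → L := fun c => ∑ i, τ ((c : Fin k → K) i) • g i
    have hev : Function.Injective ev := by
      intro c c' hc
      have h1 : ∑ i, (τ ((c : Fin k → K) i) - τ ((c' : Fin k → K) i)) • g i = 0 := by
        simp only [sub_smul, Finset.sum_sub_distrib]; exact sub_eq_zero.2 hc
      have h2 := Fintype.linearIndependent_iff.1 hg _ h1
      apply Subtype.ext; ext i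
      exact τ.injective (sub_eq_zero.1 (h2 i))
    have hroot : ∀ c, P.eval (ev c) = 0 := by
      intro c
      have h1 := hDc c.1 c.2
      simp only [P, Polynomial.eval_finset_sum, Polynomial.eval_mul, Polynomial.eval_C, Polynomial.eval_pow, Polynomial.eval_X]
      rw [← h1]
      simp only [hd, ev, hq, frob_sum, Finset.mul_sum, Finset.smul_sum]
      rw [Finset.sum_comm]
      apply Finset.sum_congr rfl; intro i _; apply Finset.sum_congr rfl; intro j _
      rw [mul_smul_comm]
    have hP : P = 0 := by
      by_contra hP
      have ht : t ≠ 0 := by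
        rintro rfl; apply hP; simp [P]
      have h1 : Nat.card D ≤ P.natDegree := by
        have hfin : Fintype D := Fintype.ofFinite D
        rw [Nat.card_eq_fintype_card, ← Finset.card_univ, ← Finset.card_image_of_injective univ hev]
        refine le_trans ?_ (Polynomial.card_roots' P)
        refine le_trans (Finset.card_le_card ?_) (Multiset.toFinset_card_le _)
        intro z hz
        obtain ⟨c, -, rfl⟩ := Finset.mem_image.1 hz
        rw [Multiset.mem_toFinset, Polynomial.mem_roots hP]; exact hroot c
      have h2 : P.natDegree ≤ q ^ (t-1) := by
        apply Polynomial.natDegree_sum_le_of_forall_le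
        intro j _
        refine (Polynomial.natDegree_C_mul_X_pow_le _ _).trans ?_
        exact Nat.pow_le_pow_right (by omega) (by have := j.2; omega)
      rw [Module.natCard_eq_pow_finrank (K := K), ← hq] at h1
      have h3 : q ^ t ≤ q ^ finrank K D := Nat.pow_le_pow_right (by omega) hD
      have h4 : q ^ (t-1) < q ^ t := Nat.pow_lt_pow_right (by omega) (by omega)
      omega
    have hd0 : ∀ j, d j = 0 := by
      intro j
      have h1 := congrArg (fun P => Polynomial.coeff P (q ^ (j : ℕ))) hP
      simp only [P, Polynomial.finset_sum_coeff, Polynomial.coeff_C_mul_X_pow, Polynomial.coeff_zero] at h1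
      rw [Finset.sum_eq_single j] at h1
      · simpa using h1
      · intro b _ hb
        rw [if_neg]
        intro hh
        exact hb (Fin.ext (Nat.pow_right_injective hq2 hh).symm)
      · intro hh; exact absurd (mem_univ _) hh
    have hxy : x = y := hw x hx' y hy' (by
      ext i
      have := hd i
      simp only [hd0, zero_mul, Finset.sum_const_zero] at this
      exact sub_eq_zero.1 this)
    have hpp : p = p' := by ext j; exact (sub_eq_zero.1 (hd0 j)).symm
    rw [hxy, hpp]
  have hc := Finset.card_le_card_of_injOn Φ (t := univ) (fun _ _ => Finset.mem_univ _) hinj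
  rw [Finset.card_product, Finset.card_univ, Finset.card_univ, Fintype.card_fun, Fintype.card_fun, Fintype.card_fin, Fintype.card_fin,
    ← Nat.card_eq_fintype_card] at hc
  have hpos : 0 < Nat.card L ^ t := pow_pos Nat.card_pos _
  apply Nat.le_of_mul_le_mul_right _ hpos
  rw [← pow_add, Nat.sub_add_cancel htk]; exact hc

section
variable {R R' K : Type*} [Ring R] [Ring R'] [Field K] {ρ : R →+* K} [RingHomSurjective ρ] {π : R} {m n : ℕ}
  {ρ' : R' →+* K} [RingHomSurjective ρ'] {σ : R →+* R'} [RingHomSurjective σ] {ι : (Fin n → K) →+ (Fin n → R)} {τ : K →+* K}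

theorem Step.fibre [Finite K] (h : Step ρ π m n ρ' σ ι τ) {k t : ℕ} (htk : t ≤ k) (hk : 1 ≤ k) (hkn : 2 * k ≤ n)
    (F' : Submodule R' (Fin n → R')) (S : Finset (Submodule R (Fin n → R)))
    (hP : ∀ F ∈ S, Pure ρ π F) (hr : ∀ F ∈ S, finrank K (res ρ F) = k) (hd : ∀ F ∈ S, dn σ F = F')
    (hint : ∀ F ∈ S, ∀ G ∈ S, t ≤ finrank K (res ρ (F ⊓ G))) : S.card ≤ (Nat.card K ^ (n - k)) ^ (k - t) := by
  rcases S.eq_empty_or_nonempty with rfl | ⟨F0, hF0⟩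
  · simp
  obtain ⟨b, hb, hbF⟩ := h.cr.exists_basis (hP F0 hF0) (hr F0 hF0)
  obtain ⟨L, _, _, _, hL⟩ := exists_ext K (n - k) (by omega)
  have hA : ∀ F ∈ S, res ρ F = res ρ F0 := by
    intro F hF; rw [← h.res_dn F, ← h.res_dn F0, hd F hF, hd F0 hF0]
  set A := res ρ F0 with hAdef
  have hAspan : A = Submodule.span K (Set.range fun i => red ρ n (b i)) := by
    rw [hAdef, hbF, res_span, ← Set.range_comp]; rfl
  have hq : finrank K ((Fin n → K) ⧸ A) = finrank K L := by
    have := Submodule.finrank_quotient_add_finrank A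
    rw [hr F0 hF0, Module.finrank_fin_fun] at this
    omega
  let e0 : ((Fin n → K) ⧸ A) ≃ₗ[K] L := LinearEquiv.ofFinrankEq _ _ hq
  let e : (Fin n → K) →ₗ[K] L := e0.toLinearMap.comp A.mkQ
  have he : ∀ v, e v = 0 ↔ v ∈ A := by
    intro v
    simp [e]
  have hv : ∀ F : Submodule R (Fin n → R), ∀ i, ∃ v, F ∈ S → b i + ι v ∈ F := by
    intro F i
    by_cases hF : F ∈ S
    · have h1 : sM σ n (b i) ∈ dn σ F := by
        rw [hd F hF, ← hd F0 hF0]; apply sM_mem_dn; rw [hbF]; exact Submodule.subset_span ⟨i, rfl⟩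
      obtain ⟨x, hx, hxe⟩ := mem_dn.1 h1
      obtain ⟨v, rfl⟩ := h.sM_eq hxe
      exact ⟨v, fun _ => hx⟩
    · exact ⟨0, fun hh => absurd hh hF⟩
  choose v hv using hv
  have hredx : ∀ F i, red ρ n (b i + ι (v F i)) = red ρ n (b i) := by
    intro F i; rw [map_add, h.red_iota, add_zero]
  have key := gab S (fun F i => e (v F i)) ?_ τ htk (by omega) ?_ (K := K)
  · rwa [Module.natCard_eq_pow_finrank (K := K), hL] at key
  · intro F hF G hG hw
    have h1 : ∀ i, b i + ι (v F i) ∈ F ⊓ G := by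
      intro i
      refine ⟨hv F i hF, ?_⟩
      have h2 : v F i - v G i ∈ A := by
        rw [← he, map_sub, sub_eq_zero]; exact congrFun hw i
      rw [← hA G hG, ← h.iota_mem (hP G hG)] at h2
      have h3 := G.add_mem (hv G i hG) h2
      rw [map_sub, add_assoc, add_sub_cancel] at h3
      exact h3
    have h2 : A ≤ res ρ (F ⊓ G) := by
      rw [hAspan, Submodule.span_le]
      rintro _ ⟨i, rfl⟩
      rw [SetLike.mem_coe]
      simp only [← hredx F i]
      exact red_mem_res (h1 i)
    have h3 := h.cr.nak (hP F hF) (S := F ⊓ G) inf_le_left (by rw [hA F hF]; exact h2)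
    have h4 := h.cr.nak (hP G hG) (S := F ⊓ G) inf_le_right (by rw [hA G hG]; exact h2)
    exact h3.symm.trans h4
  · intro F hF G hG
    let f := Fintype.linearCombination K (fun i => red ρ n (b i))
    have hf : ∀ c, f c = ∑ i, c i • red ρ n (b i) := fun c => Fintype.linearCombination_apply _ _ _
    refine ⟨(res ρ (F ⊓ G)).comap f, ?_, ?_⟩
    · refine (hint F hF G hG).trans ?_
      have h1 : ((res ρ (F ⊓ G)).comap f).map f = res ρ (F ⊓ G) := by
        rw [Submodule.map_comap_eq, inf_eq_right]
        rw [Fintype.range_linearCombination, ← hAspan, ← hA F hF]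
        exact res_mono inf_le_left
      conv_lhs => rw [← h1]
      exact Submodule.finrank_map_le _ _
    · intro c hc
      rw [Submodule.mem_comap, hf] at hc
      obtain ⟨z, ⟨hzF, hzG⟩, hz⟩ := mem_res.1 hc
      choose r hr' using fun i => RingHomSurjective.is_surjective (σ := ρ) (c i)
      have hp : ∀ H : Submodule R (Fin n → R), red ρ n (∑ i, r i • (b i + ι (v H i))) = red ρ n z := by
        intro H
        rw [hz, map_sum]; apply Finset.sum_congr rfl; intro i _
        rw [LinearMap.map_smulₛₗ, hredx, hr']
      have hmem : ∀ H ∈ S, ∑ i, r i • (b i + ι (v H i)) ∈ H :=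
        fun H hH => Submodule.sum_mem _ fun i _ => Submodule.smul_mem _ _ (hv H i hH)
      obtain ⟨y, hy, ey⟩ := hP F hF (z - ∑ i, r i • (b i + ι (v F i))) (F.sub_mem hzF (hmem F hF)) (by rw [map_sub, hp, sub_self])
      obtain ⟨g, hg, eg⟩ := hP G hG (z - ∑ i, r i • (b i + ι (v G i))) (G.sub_mem hzG (hmem G hG)) (by rw [map_sub, hp, sub_self])
      have h1 : sM σ n y ∈ dn σ G := by rw [hd G hG, ← hd F hF]; exact sM_mem_dn hy
      obtain ⟨g1, hg1, e1⟩ := mem_dn.1 h1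
      obtain ⟨u, rfl⟩ := h.sM_eq e1.symm
      rw [smul_add, h.pi_iota, add_zero] at ey
      have h2 : ι (∑ i, τ (c i) • (v F i - v G i)) = π • (g - g1) := by
        rw [smul_sub, ← eg, ← ey, map_sum, sub_sub_sub_cancel_left, ← Finset.sum_sub_distrib]
        apply Finset.sum_congr rfl; intro i _
        rw [← hr', ← h.smul_iota, map_sub, ← smul_sub, add_sub_add_left_eq_sub]
      have h3 : ι (∑ i, τ (c i) • (v F i - v G i)) ∈ G := by
        rw [h2]; exact G.smul_mem _ (G.sub_mem hg hg1)
      rw [h.iota_mem (hP G hG), hA G hG, ← he, map_sum] at h3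
      simpa only [map_smul, map_sub] using h3
end

end EKR
end EKRB3

section EKRB4
set_option linter.unusedSectionVars false
set_option linter.deprecated false
set_option linter.unusedVariables false
open Finset Module
open scoped Classical

namespace EKR

lemma grow {K V : Type*} [Field K] [Finite K] [AddCommGroup V] [Module K V] [Finite V] {k t : ℕ} {T A B H : Submodule K V}
    (hTA : T ≤ A) (hTB : T ≤ B) (hAH : A ≤ H) (hBH : B ≤ H) (hA : finrank K A = k) (hB : finrank K B = k) (hT : finrank K T = t)
    (j : ℕ) (hj : t ≤ j) (hk : k + j ≤ finrank K H + t) :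
    ∃ C, T ≤ C ∧ C ≤ H ∧ finrank K C = j ∧ C ⊓ A = T ∧ C ⊓ B = T := by
  induction j, hj using Nat.le_induction with
  | base => exact ⟨T, le_rfl, hTA.trans hAH, hT, inf_eq_left.2 hTA, inf_eq_left.2 hTB⟩
  | succ j hj ih =>
    obtain ⟨C, hTC, hCH, hC, hCA, hCB⟩ := ih (by omega)
    have e1 := Submodule.finrank_sup_add_finrank_inf_eq C A
    have e2 := Submodule.finrank_sup_add_finrank_inf_eq C B
    rw [hCA] at e1
    rw [hCB] at e2
    obtain ⟨E, hCE, hEH, hE, h1, h2⟩ := av2 (F := C) (S := H) (C := C ⊔ A) (D := C ⊔ B) hCH le_sup_left le_sup_left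
      (fun hh => by have := Submodule.finrank_mono hh; omega) (fun hh => by have := Submodule.finrank_mono hh; omega)
    have key : ∀ X : Submodule K V, T ≤ X → C ⊓ X = T → ¬ E ≤ C ⊔ X → E ⊓ X = T := by
      intro X hTX hCX hEX
      have h3 : E ⊓ (C ⊔ X) < E := lt_of_le_of_ne inf_le_left (fun hh => hEX (inf_eq_left.1 hh))
      have h4 := Submodule.finrank_lt_finrank_of_lt h3
      have h5 : C = E ⊓ (C ⊔ X) := Submodule.eq_of_le_of_finrank_le (le_inf hCE le_sup_left) (by omega)
      apply le_antisymm
      · rw [← hCX]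
        refine le_inf ?_ inf_le_right
        rw [h5]
        exact inf_le_inf_left _ le_sup_right
      · exact le_inf (hTC.trans hCE) hTX
    exact ⟨E, hTC.trans hCE, hEH, by omega, key A hTA hCA h1, key B hTB hCB h2⟩

section
variable {R R' K : Type*} [Ring R] [Ring R'] [Field K] [Finite K] {ρ : R →+* K} [RingHomSurjective ρ] {π : R} {m n : ℕ}
  {ρ' : R' →+* K} [RingHomSurjective ρ'] {σ : R →+* R'} [RingHomSurjective σ] {ι : (Fin n → K) →+ (Fin n → R)} {τ : K →+* K}

theorem Step.caseA (h : Step ρ π m n ρ' σ ι τ) {k t : ℕ} (ht : 1 ≤ t) (htk : t < k) (hkn : 2 * k ≤ n)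
    (S : Finset (Submodule R (Fin n → R)))
    (hP : ∀ F ∈ S, Pure ρ π F) (hr : ∀ F ∈ S, finrank K (res ρ F) = k)
    (hint : ∀ F ∈ S, ∀ G ∈ S, t ≤ finrank K (res ρ (F ⊓ G))) {U' : Submodule R' (Fin n → R')}
    (hU' : Pure ρ' (σ π) U') (hU'r : finrank K (res ρ' U') = t) (hsub : ∀ F ∈ S, U' ≤ dn σ F)
    (hall : ∀ F', Pure ρ' (σ π) F' → finrank K (res ρ' F') = k → U' ≤ F' → ∃ F ∈ S, dn σ F = F') :
    ∃ U, Pure ρ π U ∧ finrank K (res ρ U) = t ∧ ∀ F ∈ S, U ≤ F := by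
  set T := res ρ' U' with hT
  have hTF : ∀ F ∈ S, T ≤ res ρ F := fun F hF => by rw [← h.res_dn]; exact res_mono (hsub F hF)
  have member : ∀ C, T ≤ C → finrank K C = k → ∃ G ∈ S, res ρ G = C := by
    intro C hC hCk
    obtain ⟨F', h1, h2, h3⟩ := h.cr'.exists_lift_ge hU' hC
    obtain ⟨G, hG, hGd⟩ := hall F' h2 (by rw [h3, hCk]) h1
    exact ⟨G, hG, by rw [← h.res_dn, hGd, h3]⟩
  have step1 : ∀ u, sM σ n u ∈ U' → ∃ w, ∀ F ∈ S, u + ι w ∈ F := by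
    intro u hu
    have hv : ∀ F : Submodule R (Fin n → R), ∃ v, F ∈ S → u + ι v ∈ F := by
      intro F
      by_cases hF : F ∈ S
      · obtain ⟨x, hx, hxe⟩ := mem_dn.1 (hsub F hF hu)
        obtain ⟨v, rfl⟩ := h.sM_eq hxe
        exact ⟨v, fun _ => hx⟩
      · exact ⟨0, fun hh => absurd hh hF⟩
    choose v hv using hv
    have hvx : ∀ F ∈ S, ∀ x, u + ι x ∈ F ↔ v F - x ∈ res ρ F := by
      intro F hF x
      rw [← h.iota_mem (hP F hF), map_sub]
      constructor
      · intro hx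
        have := F.sub_mem (hv F hF) hx
        rwa [add_sub_add_left_eq_sub] at this
      · intro hx
        have := F.sub_mem (hv F hF) hx
        rwa [add_sub_assoc, sub_sub_cancel] at this
    have c1 : ∀ F ∈ S, ∀ G ∈ S, res ρ F ⊓ res ρ G = T → v F - v G ∈ res ρ F ⊔ res ρ G := by
      intro F hF G hG hFG
      have h1 : dn σ (F ⊓ G) ≤ U' := by
        refine le_trans (le_inf (dn_mono inf_le_left) (dn_mono inf_le_right)) ?_
        apply h.cr'.inf_le_of (h.pure_dn (hP F hF)) (h.pure_dn (hP G hG)) (hsub F hF) (hsub G hG)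
        rw [h.res_dn, h.res_dn, hFG]
      have h2 : res ρ (F ⊓ G) = T :=
        Submodule.eq_of_le_of_finrank_le (hFG ▸ res_inf) (by rw [hU'r]; exact hint F hF G hG)
      have h3 := h.cr'.nak hU' h1 (by rw [h.res_dn, h2])
      rw [← h3] at hu
      obtain ⟨x, ⟨hxF, hxG⟩, hxe⟩ := mem_dn.1 hu
      obtain ⟨y, rfl⟩ := h.sM_eq hxe
      have h4 := (hvx F hF y).1 hxF
      have h5 := (hvx G hG y).1 hxG
      have h6 : v F - v G = (v F - y) - (v G - y) := by abel
      rw [h6]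
      exact Submodule.sub_mem _ (Submodule.mem_sup_left h4) (Submodule.mem_sup_right h5)
    have hker : ∀ ξ : Dual K (Fin n → K), n ≤ finrank K (LinearMap.ker ξ) + 1 := by
      intro ξ
      have h1 := LinearMap.finrank_range_add_finrank_ker ξ
      have h2 := Submodule.finrank_le (LinearMap.range ξ)
      rw [Module.finrank_fin_fun] at h1
      rw [Module.finrank_self] at h2
      omega
    have c2 : ∀ ξ : Dual K (Fin n → K), ∀ F ∈ S, ∀ G ∈ S, res ρ F ≤ LinearMap.ker ξ → res ρ G ≤ LinearMap.ker ξ → ξ (v F) = ξ (v G) := by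
      intro ξ F hF G hG h1 h2
      have h0 := hker ξ
      obtain ⟨C, hTC, hCH, hC, hCA, hCB⟩ := grow (hTF F hF) (hTF G hG) h1 h2 (hr F hF) (hr G hG) hU'r k htk.le (by omega)
      obtain ⟨M, hM, rfl⟩ := member C hTC hC
      have h3 := sup_le hCH h1 (c1 M hM F hF hCA)
      have h4 := sup_le hCH h2 (c1 M hM G hG hCB)
      rw [LinearMap.mem_ker, map_sub, sub_eq_zero] at h3 h4
      rw [← h3, h4]
    have c3 : ∀ X : Submodule K (Fin n → K), T ≤ X → k ≤ finrank K X → ∃ F ∈ S, res ρ F ≤ X := by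
      intro X hX hXk
      obtain ⟨C, h1, h2, h3⟩ := exists_between hX k (by omega) hXk
      obtain ⟨F, hF, rfl⟩ := member C h1 h3
      exact ⟨F, hF, h2⟩
    have hTk : ∀ ξ : T.dualAnnihilator, T ≤ LinearMap.ker ξ.1 := by
      intro ξ a ha
      exact (Submodule.mem_dualAnnihilator _).1 ξ.2 a ha
    have hex : ∀ ξ : T.dualAnnihilator, ∃ F ∈ S, res ρ F ≤ LinearMap.ker ξ.1 := fun ξ =>
      c3 _ (hTk ξ) (by have := hker ξ.1; omega)
    choose Φ hΦ hΦk using hex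
    let g0 : T.dualAnnihilator →ₗ[K] K :=
      { toFun := fun ξ => ξ.1 (v (Φ ξ))
        map_add' := by
          intro ξ η
          obtain ⟨F, hF, hFX⟩ := c3 (LinearMap.ker ξ.1 ⊓ LinearMap.ker η.1) (le_inf (hTk _) (hTk _)) (by
            have h1 := hker ξ.1
            have h2 := hker η.1
            have h3 := Submodule.finrank_sup_add_finrank_inf_eq (LinearMap.ker ξ.1) (LinearMap.ker η.1)
            have h4 := Submodule.finrank_le (LinearMap.ker ξ.1 ⊔ LinearMap.ker η.1)
            rw [Module.finrank_fin_fun] at h4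
            omega)
          rw [c2 ξ.1 _ (hΦ ξ) F hF (hΦk ξ) (hFX.trans inf_le_left), c2 η.1 _ (hΦ η) F hF (hΦk η) (hFX.trans inf_le_right),
            c2 (ξ + η).1 _ (hΦ _) F hF (hΦk _) ?_]
          · rfl
          · intro a ha
            have h1 := hFX ha
            rw [Submodule.mem_inf, LinearMap.mem_ker, LinearMap.mem_ker] at h1
            change ξ.1 a + η.1 a = 0
            rw [h1.1, h1.2, add_zero]
        map_smul' := by
          intro c ξ
          rw [c2 (c • ξ).1 _ (hΦ _) _ (hΦ ξ) (hΦk _) ?_]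
          · rfl
          · intro a ha
            have h1 : ξ.1 a = 0 := hΦk ξ ha
            change c • ξ.1 a = 0
            rw [h1, smul_zero] }
    obtain ⟨g, hg⟩ := LinearMap.exists_extend g0
    have hg' : ∀ ξ : T.dualAnnihilator, g ξ.1 = ξ.1 (v (Φ ξ)) := fun ξ => LinearMap.congr_fun hg ξ
    let w := (evalEquiv K (Fin n → K)).symm g
    have hw : ∀ ξ : Dual K (Fin n → K), ξ w = g ξ := by
      intro ξ
      have : evalEquiv K (Fin n → K) w = g := LinearEquiv.apply_symm_apply _ _
      rw [← this]; rfl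
    refine ⟨w, fun F hF => (hvx F hF w).2 ?_⟩
    rw [← Subspace.dualAnnihilator_dualCoannihilator_eq (W := res ρ F), Submodule.mem_dualCoannihilator]
    intro ξ hξ
    have h1 : ξ ∈ T.dualAnnihilator := Submodule.dualAnnihilator_anti (hTF F hF) hξ
    rw [map_sub, hw, hg' ⟨ξ, h1⟩, sub_eq_zero]
    apply c2 ξ F hF _ (hΦ _) _ (hΦk ⟨ξ, h1⟩)
    intro a ha
    exact (Submodule.mem_dualAnnihilator _).1 hξ a ha
  obtain ⟨U, hU, hUp, hUr, -⟩ := h.cr.exists_lift (X := S.inf id) (C := T) (by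
    intro a ha
    obtain ⟨u', hu', rfl⟩ := mem_res.1 ha
    obtain ⟨u, rfl⟩ := sM_surj (σ := σ) u'
    obtain ⟨w, hw⟩ := step1 u hu'
    refine mem_res.2 ⟨u + ι w, ?_, ?_⟩
    · rw [Submodule.mem_finsetInf]; exact hw
    · rw [map_add, h.red_iota, add_zero, h.red_sM])
  exact ⟨U, hUp, by rw [hUr, hU'r], fun F hF => hU.trans (Finset.inf_le hF)⟩

theorem Step.caseB (h : Step ρ π m n ρ' σ ι τ) {k t : ℕ} (ht : 1 ≤ t) (htk : t < k) (hkn : n = 2 * k)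
    (S : Finset (Submodule R (Fin n → R)))
    (hP : ∀ F ∈ S, Pure ρ π F) (hr : ∀ F ∈ S, finrank K (res ρ F) = k)
    (hint : ∀ F ∈ S, ∀ G ∈ S, t ≤ finrank K (res ρ (F ⊓ G))) {Q' : Submodule R' (Fin n → R')}
    (hQ' : Pure ρ' (σ π) Q') (hQ'r : finrank K (res ρ' Q') = 2 * k - t) (hsub : ∀ F ∈ S, dn σ F ≤ Q')
    (hall : ∀ F', Pure ρ' (σ π) F' → finrank K (res ρ' F') = k → F' ≤ Q' → ∃ F ∈ S, dn σ F = F') :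
    ∃ Q, Pure ρ π Q ∧ finrank K (res ρ Q) = 2 * k - t ∧ ∀ F ∈ S, F ≤ Q := by
  obtain ⟨Q0, hQ0, rfl⟩ := h.exists_up hQ'
  rw [h.res_dn] at hQ'r
  set Q := res ρ Q0 with hQ
  have hFQ : ∀ F ∈ S, res ρ F ≤ Q := fun F hF => by
    rw [hQ, ← h.res_dn F, ← h.res_dn Q0]; exact res_mono (hsub F hF)
  have member : ∀ C, C ≤ Q → finrank K C = k → ∃ G ∈ S, res ρ G = C := by
    intro C hC hCk
    obtain ⟨F', h1, h2, h3, -⟩ := h.cr'.exists_lift (X := dn σ Q0) (C := C) (by rw [h.res_dn]; exact hC)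
    obtain ⟨G, hG, hGd⟩ := hall F' h2 (by rw [h3, hCk]) h1
    exact ⟨G, hG, by rw [← h.res_dn, hGd, h3]⟩
  have member' : ∀ C, C ≤ Q → finrank K C ≤ k → ∃ G ∈ S, C ≤ res ρ G := by
    intro C hC hCk
    obtain ⟨D, h1, h2, h3⟩ := exists_between hC k hCk (by omega)
    obtain ⟨G, hG, rfl⟩ := member D h2 h3
    exact ⟨G, hG, h1⟩
  have hdec : ∀ F ∈ S, ∀ x ∈ F, ∃ v, x - ι v ∈ Q0 := by
    intro F hF x hx
    obtain ⟨y, hy, e⟩ := mem_dn.1 (hsub F hF (sM_mem_dn hx))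
    obtain ⟨v, rfl⟩ := h.sM_eq e.symm
    exact ⟨v, by rwa [add_sub_cancel_right]⟩
  let P : Submodule R (Fin n → R) → (Fin n → K) → (Fin n → K) → Prop := fun F a v => ∃ x ∈ F, red ρ n x = a ∧ x - ι v ∈ Q0
  have Pex : ∀ F ∈ S, ∀ a ∈ res ρ F, ∃ v, P F a v := by
    intro F hF a ha
    obtain ⟨x, hx, rfl⟩ := mem_res.1 ha
    obtain ⟨v, hv⟩ := hdec F hF x hx
    exact ⟨v, x, hx, rfl, hv⟩
  have Pres : ∀ F a v, P F a v → a ∈ res ρ F := by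
    rintro F a v ⟨x, hx, rfl, -⟩; exact red_mem_res hx
  have Puniq : ∀ F ∈ S, ∀ a v w, P F a v → P F a w → v - w ∈ Q := by
    rintro F hF a v w ⟨x, hx, hxa, hxv⟩ ⟨y, hy, hya, hyw⟩
    obtain ⟨f, hf, e⟩ := hP F hF (x - y) (F.sub_mem hx hy) (by rw [map_sub, hxa, hya, sub_self])
    obtain ⟨u, hu⟩ := hdec F hF f hf
    have h1 : x - y = π • (f - ι u) := by rw [e, smul_sub, h.pi_iota, sub_zero]
    rw [hQ, ← h.iota_mem hQ0, map_sub]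
    have h2 : ι v - ι w = (x - y) - (x - ι v) + (y - ι w) := by abel
    rw [h2, h1]
    exact Q0.add_mem (Q0.sub_mem (Q0.smul_mem _ hu) hxv) hyw
  have Pcl : ∀ F a v w, P F a v → w - v ∈ Q → P F a w := by
    rintro F a v w ⟨x, hx, hxa, hxv⟩ hw
    refine ⟨x, hx, hxa, ?_⟩
    rw [hQ, ← h.iota_mem hQ0, map_sub] at hw
    have h2 : x - ι w = (x - ι v) - (ι w - ι v) := by abel
    rw [h2]; exact Q0.sub_mem hxv hw
  have Padd : ∀ F a v b w, P F a v → P F b w → P F (a + b) (v + w) := by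
    rintro F a v b w ⟨x, hx, hxa, hxv⟩ ⟨y, hy, hya, hyw⟩
    refine ⟨x + y, F.add_mem hx hy, by rw [map_add, hxa, hya], ?_⟩
    rw [map_add, add_sub_add_comm]; exact Q0.add_mem hxv hyw
  have Psmul : ∀ F a v r, P F a v → P F (ρ r • a) (τ (ρ r) • v) := by
    rintro F a v r ⟨x, hx, hxa, hxv⟩
    refine ⟨r • x, F.smul_mem _ hx, by rw [LinearMap.map_smulₛₗ, hxa], ?_⟩
    rw [← h.smul_iota, ← smul_sub]; exact Q0.smul_mem _ hxv
  have same1 : ∀ F ∈ S, ∀ G ∈ S, finrank K ↥(res ρ F ⊓ res ρ G) ≤ t → ∀ a v w, P F a v → P G a w → v - w ∈ Q := by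
    intro F hF G hG hd a v w hv hw
    have h1 : res ρ (F ⊓ G) = res ρ F ⊓ res ρ G :=
      Submodule.eq_of_le_of_finrank_le res_inf (hd.trans (hint F hF G hG))
    have h2 : a ∈ res ρ (F ⊓ G) := by rw [h1]; exact ⟨Pres _ _ _ hv, Pres _ _ _ hw⟩
    obtain ⟨x, ⟨hxF, hxG⟩, hxa⟩ := mem_res.1 h2
    obtain ⟨y, hy⟩ := hdec F hF x hxF
    have h3 := Puniq F hF a v y hv ⟨x, hxF, hxa, hy⟩
    have h4 := Puniq G hG a w y hw ⟨x, hxG, hxa, hy⟩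
    have h5 := Q.sub_mem h3 h4
    rwa [sub_sub_sub_cancel_right] at h5
  have hspan1 : ∀ a : Fin n → K, finrank K (Submodule.span K {a}) ≤ 1 := by
    intro a
    have := finrank_span_le_card (R := K) ({a} : Set (Fin n → K))
    simpa using this
  have same2 : ∀ F ∈ S, ∀ G ∈ S, ∀ a v w, P F a v → P G a w → v - w ∈ Q := by
    intro F hF G hG a v w hv hw
    have e1 := Submodule.finrank_sup_add_finrank_inf_eq (res ρ F) (res ρ G)
    have e2 := Submodule.finrank_mono (sup_le (hFQ F hF) (hFQ G hG))
    rw [hr F hF, hr G hG] at e1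
    obtain ⟨T0, h1, h2, h3⟩ := exists_between (A := Submodule.span K {a}) (B := res ρ F ⊓ res ρ G) (by
      rw [Submodule.span_singleton_le_iff_mem]; exact ⟨Pres _ _ _ hv, Pres _ _ _ hw⟩) t ((hspan1 a).trans ht) (by omega)
    obtain ⟨C, hTC, hCH, hC, hCA, hCB⟩ := grow (h2.trans inf_le_left) (h2.trans inf_le_right) (hFQ F hF) (hFQ G hG)
      (hr F hF) (hr G hG) h3 k htk.le (by omega)
    obtain ⟨M, hM, rfl⟩ := member C hCH hC
    obtain ⟨y, hy⟩ := Pex M hM a (hTC (h1 (Submodule.mem_span_singleton_self a)))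
    have h4 := same1 M hM F hF (by rw [hCA, h3]) a y v hy hv
    have h5 := same1 M hM G hG (by rw [hCB, h3]) a y w hy hw
    have h6 := Q.sub_mem h5 h4
    rwa [sub_sub_sub_cancel_left] at h6
  have trans : ∀ F ∈ S, ∀ G ∈ S, ∀ a v, P F a v → a ∈ res ρ G → P G a v := by
    intro F hF G hG a v hv ha
    obtain ⟨w, hw⟩ := Pex G hG a ha
    exact Pcl G a w v hw (same2 F hF G hG a v w hv hw)
  have hP0 : ∀ F, P F 0 0 := fun F => ⟨0, F.zero_mem, map_zero _, by simp⟩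
  obtain ⟨F1, hF1, -⟩ := member' ⊥ bot_le (by simp)
  let Qn : Submodule R (Fin n → R) :=
    { carrier := {x | ∃ v, ∃ F ∈ S, x - ι v ∈ Q0 ∧ P F (red ρ n x) v}
      zero_mem' := ⟨0, F1, hF1, by simp, by rw [map_zero]; exact hP0 F1⟩
      add_mem' := by
        rintro x y ⟨v, F, hF, hxv, hv⟩ ⟨w, G, hG, hyw, hw⟩
        have h1 := hFQ F hF (Pres _ _ _ hv)
        have h2 := hFQ G hG (Pres _ _ _ hw)
        obtain ⟨M, hM, hle⟩ := member' (Submodule.span K {red ρ n x} ⊔ Submodule.span K {red ρ n y}) (sup_le (by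
          rwa [Submodule.span_singleton_le_iff_mem]) (by rwa [Submodule.span_singleton_le_iff_mem])) (by
          have h3 := Submodule.finrank_add_le_finrank_add_finrank (Submodule.span K {red ρ n x}) (Submodule.span K {red ρ n y})
          have h4 := hspan1 (red ρ n x)
          have h5 := hspan1 (red ρ n y)
          omega)
        have h6 := trans F hF M hM _ _ hv (hle (Submodule.mem_sup_left (Submodule.mem_span_singleton_self _)))
        have h7 := trans G hG M hM _ _ hw (hle (Submodule.mem_sup_right (Submodule.mem_span_singleton_self _)))
        refine ⟨v + w, M, hM, ?_, ?_⟩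
        · rw [map_add, add_sub_add_comm]; exact Q0.add_mem hxv hyw
        · rw [map_add]; exact Padd _ _ _ _ _ h6 h7
      smul_mem' := by
        rintro r x ⟨v, F, hF, hxv, hv⟩
        refine ⟨τ (ρ r) • v, F, hF, ?_, ?_⟩
        · rw [← h.smul_iota, ← smul_sub]; exact Q0.smul_mem _ hxv
        · rw [LinearMap.map_smulₛₗ]; exact Psmul _ _ _ _ hv }
  have hQn : ∀ x, x ∈ Qn ↔ ∃ v, ∃ F ∈ S, x - ι v ∈ Q0 ∧ P F (red ρ n x) v := fun x => Iff.rfl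
  have hcont : ∀ F ∈ S, F ≤ Qn := by
    intro F hF x hx
    obtain ⟨v, hv⟩ := hdec F hF x hx
    exact (hQn x).2 ⟨v, F, hF, hv, x, hx, rfl, hv⟩
  have mem1 : ∀ a ∈ Q, ∃ F ∈ S, a ∈ res ρ F := by
    intro a ha
    obtain ⟨F, hF, hle⟩ := member' (Submodule.span K {a}) (by rwa [Submodule.span_singleton_le_iff_mem]) ((hspan1 a).trans (by omega))
    exact ⟨F, hF, hle (Submodule.mem_span_singleton_self _)⟩
  have hres : res ρ Qn = Q := by
    apply le_antisymm
    · intro a ha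
      obtain ⟨x, hx, rfl⟩ := mem_res.1 ha
      obtain ⟨v, F, hF, -, hv⟩ := (hQn x).1 hx
      exact hFQ F hF (Pres _ _ _ hv)
    · intro a ha
      obtain ⟨F, hF, haF⟩ := mem1 a ha
      exact res_mono (hcont F hF) haF
  refine ⟨Qn, ?_, by rw [hres, hQ'r], hcont⟩
  intro x hx hx0
  obtain ⟨v, F, hF, hxv, hv⟩ := (hQn x).1 hx
  rw [hx0] at hv
  have h1 := Puniq F hF 0 v 0 hv (hP0 F)
  rw [sub_zero, hQ, ← h.iota_mem hQ0] at h1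
  have h2 := Q0.add_mem hxv h1
  rw [sub_add_cancel] at h2
  obtain ⟨y, hy, rfl⟩ := hQ0 x h2 hx0
  obtain ⟨G, hG, hyG⟩ := mem1 (red ρ n y) (red_mem_res hy)
  obtain ⟨w, hw⟩ := Pex G hG _ hyG
  refine ⟨y + ι w, (hQn _).2 ⟨w, G, hG, by rwa [add_sub_cancel_right], ?_⟩, ?_⟩
  · rw [map_add, h.red_iota, add_zero]; exact hw
  · rw [smul_add, h.pi_iota, add_zero]
end

end EKR
end EKRB4

section EKRB5
set_option linter.unusedSectionVars false
set_option linter.deprecated false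
set_option linter.unusedVariables false
open Finset Module
open scoped Classical

namespace EKR

structure Fam {R K : Type*} [Ring R] [Field K] (ρ : R →+* K) [RingHomSurjective ρ] (π : R) {n : ℕ} (k t : ℕ)
    (S : Finset (Submodule R (Fin n → R))) : Prop where
  hP : ∀ F ∈ S, Pure ρ π F
  hr : ∀ F ∈ S, finrank K (res ρ F) = k
  hint : ∀ F ∈ S, ∀ G ∈ S, t ≤ finrank K (res ρ (F ⊓ G))

lemma Fam.strong {R K : Type*} [Ring R] [Finite R] [Field K] {ρ : R →+* K} [RingHomSurjective ρ] {π : R} {n k t N : ℕ}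
    (bound : ∀ S : Finset (Submodule R (Fin n → R)), Fam ρ π k t S → S.card ≤ N)
    {S : Finset (Submodule R (Fin n → R))} (hc : S.card = N) (hS : Fam ρ π k t S) (p : Submodule R (Fin n → R) → Prop)
    (hp : ∀ F ∈ S, p F) (hpi : ∀ F G, Pure ρ π F → Pure ρ π G → finrank K (res ρ F) = k → finrank K (res ρ G) = k → p F → p G →
      t ≤ finrank K (res ρ (F ⊓ G))) :
    ∀ F, Pure ρ π F → finrank K (res ρ F) = k → p F → F ∈ S := by
  have : Finite (Submodule R (Fin n → R)) := Finite.of_injective (fun F => (F : Set (Fin n → R))) SetLike.coe_injective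
  have := Fintype.ofFinite (Submodule R (Fin n → R))
  let Z : Finset (Submodule R (Fin n → R)) := univ.filter fun F => Pure ρ π F ∧ finrank K (res ρ F) = k ∧ p F
  have hZ : ∀ F, F ∈ Z ↔ Pure ρ π F ∧ finrank K (res ρ F) = k ∧ p F := by intro F; simp [Z]
  have hSZ : S ⊆ Z := fun F hF => (hZ F).2 ⟨hS.hP F hF, hS.hr F hF, hp F hF⟩
  have hb := bound Z ⟨fun F hF => ((hZ F).1 hF).1, fun F hF => ((hZ F).1 hF).2.1, fun F hF G hG =>
    hpi F G ((hZ F).1 hF).1 ((hZ G).1 hG).1 ((hZ F).1 hF).2.1 ((hZ G).1 hG).2.1 ((hZ F).1 hF).2.2 ((hZ G).1 hG).2.2⟩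
  have hE := Finset.eq_of_subset_of_card_le hSZ (by omega)
  intro F h1 h2 h3
  rw [hE]; exact (hZ F).2 ⟨h1, h2, h3⟩

section
variable {R K : Type*} [Ring R] [Field K] {ρ : R →+* K} [RingHomSurjective ρ] {π : R} {m n k t : ℕ}

lemma CR.pA [Finite K] (h : CR ρ π m) {U : Submodule R (Fin n → R)} (hUr : finrank K (res ρ U) = t) :
   ∀ F G, Pure ρ π F → Pure ρ π G → finrank K (res ρ F) = k → finrank K (res ρ G) = k → U ≤ F → U ≤ G →
      t ≤ finrank K (res ρ (F ⊓ G)) := by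
  intro F G _ _ _ _ h1 h2
  rw [← hUr]; exact Submodule.finrank_mono (res_mono (le_inf h1 h2))

lemma CR.pB [Finite K] (h : CR ρ π m) (htk : t < k) {Q : Submodule R (Fin n → R)} (hQ : Pure ρ π Q) (hQr : finrank K (res ρ Q) = 2 * k - t) :
   ∀ F G, Pure ρ π F → Pure ρ π G → finrank K (res ρ F) = k → finrank K (res ρ G) = k → F ≤ Q → G ≤ Q →
      t ≤ finrank K (res ρ (F ⊓ G)) := by
  intro F G hF hG h3 h4 h1 h2
  have := h.inf_dim hQ hG h1 h2
  omega
end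

def Concl {R K : Type*} [Ring R] [Field K] (ρ : R →+* K) [RingHomSurjective ρ] (π : R) {n : ℕ} (k t : ℕ)
    (S : Finset (Submodule R (Fin n → R))) : Prop :=
  (∃ U, Pure ρ π U ∧ finrank K (res ρ U) = t ∧ ∀ F ∈ S, U ≤ F) ∨
    (n = 2 * k ∧ ∃ Q, Pure ρ π Q ∧ finrank K (res ρ Q) = 2 * k - t ∧ ∀ F ∈ S, F ≤ Q)

universe u v

lemma base {R : Type u} {K : Type v} [Ring R] [Field K] [Finite K] {ρ : R →+* K} [RingHomSurjective ρ] {π : R} {n k t : ℕ}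
    (h : CR ρ π 1) (ht : 1 ≤ t) (htk : t < k) (hkn : 2 * k ≤ n) {T0 : Submodule K (Fin n → K)} (hT0 : finrank K T0 = t)
    (S : Finset (Submodule R (Fin n → R))) (hS : Fam ρ π k t S) :
    S.card ≤ (star k T0).card ∧ (S.card = (star k T0).card → Concl ρ π k t S) := by
  have hinj : ∀ x y : Fin n → R, red ρ n x = red ρ n y → x = y := by
    intro x y hxy
    obtain ⟨z, hz⟩ := h.ker_red (x := x - y) (by rw [map_sub, hxy, sub_self])
    have := h.nil
    rw [pow_one] at this
    rw [this, zero_smul] at hz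
    exact sub_eq_zero.1 hz
  have hle : ∀ F G : Submodule R (Fin n → R), res ρ F ≤ res ρ G → F ≤ G := by
    intro F G hFG x hx
    obtain ⟨y, hy, e⟩ := mem_res.1 (hFG (red_mem_res hx))
    rw [← hinj _ _ e]; exact hy
  have hnf : finrank K (Fin n → K) = n := Module.finrank_fin_fun K
  obtain ⟨𝓖, h𝓖⟩ : ∃ 𝓖 : Finset (Gr K (Fin n → K) k), 𝓖 = S.attach.image (fun F => ⟨res ρ F.1, hS.hr F.1 F.2⟩) := ⟨_, rfl⟩
  have hcard : 𝓖.card = S.card := by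
    rw [h𝓖, Finset.card_image_of_injective, Finset.card_attach]
    intro F G hFG
    have h1 := congrArg Subtype.val hFG
    exact Subtype.ext (le_antisymm (hle _ _ (le_of_eq h1)) (hle _ _ (le_of_eq h1.symm)))
  have hmem : ∀ F (hF : F ∈ S), (⟨res ρ F, hS.hr F hF⟩ : Gr K (Fin n → K) k) ∈ 𝓖 := by
    intro F hF
    rw [h𝓖]
    exact Finset.mem_image.2 ⟨⟨F, hF⟩, Finset.mem_attach _ _, rfl⟩
  have hT : TInt t 𝓖 := by
    intro A hA B hB
    rw [h𝓖] at hA hB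
    obtain ⟨F, -, rfl⟩ := Finset.mem_image.1 hA
    obtain ⟨G, -, rfl⟩ := Finset.mem_image.1 hB
    exact (hS.hint F.1 F.2 G.1 G.2).trans (Submodule.finrank_mono res_inf)
  have htop : ∀ C : Submodule K (Fin n → K), C ≤ res ρ (⊤ : Submodule R (Fin n → R)) := by
    intro C v _
    obtain ⟨x, hx⟩ := red_surj (ρ := ρ) v
    exact mem_res.2 ⟨x, trivial, hx⟩
  refine ⟨hcard.symm.le.trans (ekr_core htk.le (by rw [hnf]; exact hkn) hT0 𝓖 hT).1, fun hc => ?_⟩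
  rcases ekr_field ht htk (by rw [hnf]; exact hkn) hT0 hT (hcard.trans hc) with ⟨T, hTt, hTF⟩ | ⟨hn, Q, hQ, hQF⟩
  · obtain ⟨U, -, hU, hUr, -⟩ := h.exists_lift (htop T)
    exact Or.inl ⟨U, hU, by rw [hUr, hTt], fun F hF => hle _ _ (by rw [hUr]; exact hTF _ (hmem F hF))⟩
  · obtain ⟨U, -, hU, hUr, -⟩ := h.exists_lift (htop Q)
    exact Or.inr ⟨hnf.symm.trans hn, U, hU, by rw [hUr, hQ], fun F hF => hle _ _ (by rw [hUr]; exact hQF _ (hmem F hF))⟩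

theorem mainInd {K : Type v} [Field K] [Finite K] {n k t : ℕ} (ht : 1 ≤ t) (htk : t < k) (hkn : 2 * k ≤ n)
    {T0 : Submodule K (Fin n → K)} (hT0 : finrank K T0 = t) (m : ℕ) :
    ∀ {R : Type u} [Ring R] [Finite R] (ρ : R →+* K) [RingHomSurjective ρ] (π : R) (h : CR ρ π (m+1))
      (S : Finset (Submodule R (Fin n → R))) (hS : Fam ρ π k t S),
      S.card ≤ ((Nat.card K ^ (n - k)) ^ (k - t)) ^ m * (star k T0).card ∧
      (S.card = ((Nat.card K ^ (n - k)) ^ (k - t)) ^ m * (star k T0).card → Concl ρ π k t S) := by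
  induction m with
  | zero =>
    intro R _ _ ρ _ π h S hS
    rw [pow_zero, one_mul]
    exact base h ht htk hkn hT0 S hS
  | succ m ih =>
    intro R _ _ ρ _ π h S hS
    obtain ⟨R', _, ρ', _, σ, _, ι, τ, st⟩ := h.exists_step (by omega) n
    have hfin : Finite R' := Finite.of_surjective σ (RingHomSurjective.is_surjective)
    have cr' : CR ρ' (σ π) (m+1) := st.cr'
    have IH := ih ρ' (σ π) cr'
    set c := (Nat.card K ^ (n - k)) ^ (k - t) with hcdef
    have hcpos : 0 < c := pow_pos (pow_pos Nat.card_pos _) _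
    have hS' : Fam ρ' (σ π) k t (S.image (dn σ)) := by
      refine ⟨?_, ?_, ?_⟩
      · intro F' hF'
        obtain ⟨F, hF, rfl⟩ := Finset.mem_image.1 hF'
        exact st.pure_dn (hS.hP F hF)
      · intro F' hF'
        obtain ⟨F, hF, rfl⟩ := Finset.mem_image.1 hF'
        rw [st.res_dn]; exact hS.hr F hF
      · intro F' hF' G' hG'
        obtain ⟨F, hF, rfl⟩ := Finset.mem_image.1 hF'
        obtain ⟨G, hG, rfl⟩ := Finset.mem_image.1 hG'
        exact (hS.hint F hF G hG).trans (Submodule.finrank_mono (st.res_inf_dn F G))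
    have hle : S.card ≤ c * (S.image (dn σ)).card := by
      apply Finset.card_le_mul_card_image
      intro F' hF'
      apply st.fibre htk.le (by omega) hkn F'
      · intro F hF; exact hS.hP F (Finset.mem_filter.1 hF).1
      · intro F hF; exact hS.hr F (Finset.mem_filter.1 hF).1
      · intro F hF; exact (Finset.mem_filter.1 hF).2
      · intro F hF G hG; exact hS.hint F (Finset.mem_filter.1 hF).1 G (Finset.mem_filter.1 hG).1
    have hIH := IH _ hS'
    rw [pow_succ', mul_assoc]
    refine ⟨hle.trans (Nat.mul_le_mul_left _ hIH.1), fun hc => ?_⟩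
    have hc' : (S.image (dn σ)).card = c ^ m * (star k T0).card := by
      apply le_antisymm hIH.1
      rw [hc] at hle
      exact Nat.le_of_mul_le_mul_left hle hcpos
    have bound : ∀ S' : Finset (Submodule R' (Fin n → R')), Fam ρ' (σ π) k t S' → S'.card ≤ c ^ m * (star k T0).card :=
      fun S' hS' => (IH S' hS').1
    rcases hIH.2 hc' with ⟨U', hU', hU'r, hU'F⟩ | ⟨hn, Q', hQ', hQ'r, hQ'F⟩
    · left
      have hst := Fam.strong bound hc' hS' (fun F => U' ≤ F) hU'F (cr'.pA hU'r)
      exact st.caseA ht htk hkn S hS.hP hS.hr hS.hint hU' hU'r (fun F hF => hU'F _ (Finset.mem_image_of_mem _ hF))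
        (fun F' h1 h2 h3 => by
          obtain ⟨F, hF, e⟩ := Finset.mem_image.1 (hst F' h1 h2 h3)
          exact ⟨F, hF, e⟩)
    · right
      refine ⟨hn, ?_⟩
      have hst := Fam.strong bound hc' hS' (fun F => F ≤ Q') hQ'F (cr'.pB htk hQ' hQ'r)
      exact st.caseB ht htk hn S hS.hP hS.hr hS.hint hQ' hQ'r (fun F hF => hQ'F _ (Finset.mem_image_of_mem _ hF))
        (fun F' h1 h2 h3 => by
          obtain ⟨F, hF, e⟩ := Finset.mem_image.1 (hst F' h1 h2 h3)
          exact ⟨F, hF, e⟩)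

end EKR
end EKRB5

section EKRB6
set_option linter.unusedSectionVars false
set_option linter.deprecated false
set_option linter.unusedVariables false
open Finset Module
open scoped Classical

namespace EKR

universe u
variable {R : Type u} [Ring R] [Finite R] {N : Ideal R}

lemma unit_left {x y : R} (h : x * y = 1) : IsUnit x ∧ IsUnit y := by
  have h' : y * x = 1 := mul_eq_one_symm h
  exact ⟨⟨⟨x, y, h, h'⟩, rfl⟩, ⟨⟨y, x, h', h⟩, rfl⟩⟩

lemma unit_of_not_mem (hchain : ∀ I J : Ideal R, I ≤ J ∨ J ≤ I) (hN : N.IsMaximal) {x : R} (hx : x ∉ N) : IsUnit x := by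
  have h1 : N < Ideal.span {x} := by
    rcases hchain (Ideal.span {x}) N with h | h
    · exact absurd (h (Ideal.mem_span_singleton_self x)) hx
    · exact lt_of_le_of_ne h (fun e => hx (by rw [e]; exact Ideal.mem_span_singleton_self x))
  have h2 := hN.1.2 _ h1
  have h3 : (1 : R) ∈ Ideal.span {x} := by rw [h2]; trivial
  obtain ⟨a, ha⟩ := Ideal.mem_span_singleton'.1 h3
  exact (unit_left ha).2

lemma not_unit_of_mem (hN : N.IsMaximal) {x : R} (hx : x ∈ N) : ¬ IsUnit x :=
  fun h => hN.1.1 (Ideal.eq_top_of_isUnit_mem _ hx h)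

lemma two_sided (hchain : ∀ I J : Ideal R, I ≤ J ∨ J ≤ I) (hN : N.IsMaximal) {x : R} (hx : x ∈ N) (r : R) : x * r ∈ N := by
  by_contra hc
  obtain ⟨v, hv⟩ := (unit_of_not_mem hchain hN hc)
  have h1 : x * (r * ↑v⁻¹) = 1 := by rw [← mul_assoc, ← hv]; simp
  exact not_unit_of_mem hN hx (unit_left h1).1

lemma exists_pi (hchain : ∀ I J : Ideal R, I ≤ J ∨ J ≤ I) : ∃ π ∈ N, ∀ x ∈ N, ∃ y, x = y * π := by
  have := Fintype.ofFinite R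
  obtain ⟨π, hπ, hmax⟩ := Finset.exists_max_image (univ.filter fun x => x ∈ N) (fun x => Nat.card (Ideal.span {x} : Ideal R))
    ⟨0, by simp⟩
  refine ⟨π, (Finset.mem_filter.1 hπ).2, fun x hx => ?_⟩
  have h1 := hmax x (by simp [hx])
  have h2 : Ideal.span {x} ≤ Ideal.span {π} := by
    rcases hchain (Ideal.span {x}) (Ideal.span {π}) with h | h
    · exact h
    · have : (Ideal.span {π} : Set R) = Ideal.span {x} := Set.eq_of_subset_of_ncard_le h (by
        rw [← Nat.card_coe_set_eq, ← Nat.card_coe_set_eq]; exact h1) (Set.toFinite _)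
      exact (SetLike.coe_injective this).symm.le
  obtain ⟨y, hy⟩ := Ideal.mem_span_singleton'.1 (h2 (Ideal.mem_span_singleton_self x))
  exact ⟨y, hy.symm⟩

lemma exists_field (hchain : ∀ I J : Ideal R, I ≤ J ∨ J ≤ I) (hN : N.IsMaximal) :
    ∃ (K : Type u) (_ : Field K) (_ : Finite K) (ρ : R →+* K) (_ : RingHomSurjective ρ), Nat.card K = Nat.card (R ⧸ N) ∧
      ∀ x, ρ x = 0 ↔ x ∈ N := by
  have : N.IsTwoSided := ⟨fun {a} b ha => two_sided hchain hN ha b⟩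
  have hnt : Nontrivial (R ⧸ N) := Ideal.Quotient.nontrivial_iff.2 hN.1.1
  have hfin : Finite (R ⧸ N) := Finite.of_surjective _ (Ideal.Quotient.mk_surjective (I := N))
  have hnz : NoZeroDivisors (R ⧸ N) := ⟨by
    intro a b hab
    obtain ⟨x, rfl⟩ := Ideal.Quotient.mk_surjective a
    obtain ⟨y, rfl⟩ := Ideal.Quotient.mk_surjective b
    rw [Ideal.Quotient.eq_zero_iff_mem, Ideal.Quotient.eq_zero_iff_mem]
    rw [← map_mul, Ideal.Quotient.eq_zero_iff_mem] at hab
    by_contra hc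
    push Not at hc
    exact not_unit_of_mem hN hab ((unit_of_not_mem hchain hN hc.1).mul (unit_of_not_mem hchain hN hc.2))⟩
  have hd : IsDomain (R ⧸ N) := NoZeroDivisors.to_isDomain _
  have hF := Finite.isDomain_to_isField (R ⧸ N)
  exact ⟨R ⧸ N, hF.toField, hfin, Ideal.Quotient.mk N, ⟨Ideal.Quotient.mk_surjective⟩, rfl, fun x => Ideal.Quotient.eq_zero_iff_mem⟩

lemma pi_comm (hchain : ∀ I J : Ideal R, I ≤ J ∨ J ≤ I) (hN : N.IsMaximal) {π : R} (hπ : π ∈ N)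
    (hl : ∀ x ∈ N, ∃ y, x = y * π) (r : R) (i : ℕ) : ∃ s, π ^ i * r = s * π ^ i := by
  induction i with
  | zero => exact ⟨r, by simp⟩
  | succ i ih =>
    obtain ⟨s, hs⟩ := ih
    obtain ⟨y, hy⟩ := hl (π * s) (two_sided hchain hN hπ s)
    exact ⟨y, by rw [pow_succ', mul_assoc, hs, ← mul_assoc, hy, mul_assoc]⟩

lemma right_gen (hchain : ∀ I J : Ideal R, I ≤ J ∨ J ≤ I) (hN : N.IsMaximal) {π : R} (hπ : π ∈ N)
    (hl : ∀ x ∈ N, ∃ y, x = y * π) {m : ℕ} (hm : π ^ m = 0) : ∀ x ∈ N, ∃ y, x = π * y := by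
  have hval : ∀ x : R, ∃ a : ℕ, ∃ u : R, IsUnit u ∧ x = u * π ^ a := by
    intro x
    have key : ∀ s : ℕ, (∃ y, x = y * π ^ s) ∨ ∃ a : ℕ, ∃ u : R, IsUnit u ∧ x = u * π ^ a := by
      intro s
      induction s with
      | zero => left; exact ⟨x, by simp⟩
      | succ s ih =>
        rcases ih with ⟨y, hy⟩ | ih
        · by_cases h0 : y ∈ N
          · obtain ⟨z, hz⟩ := hl y h0
            left; exact ⟨z, by rw [hy, hz, pow_succ', mul_assoc]⟩
          · right; exact ⟨s, y, unit_of_not_mem hchain hN h0, hy⟩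
        · right; exact ih
    rcases key m with ⟨y, hy⟩ | hh
    · exact ⟨m, 1, isUnit_one, by rw [hy, hm, mul_zero, mul_zero]⟩
    · exact hh
  have hu : ∀ u : R, IsUnit u → ∃ u', IsUnit u' ∧ π * u = u' * π := by
    intro u hu
    obtain ⟨s, hs⟩ := pi_comm hchain hN hπ hl u 1
    rw [pow_one] at hs
    by_cases hsN : s ∈ N
    · obtain ⟨z, rfl⟩ := hl s hsN
      obtain ⟨v, rfl⟩ := hu
      obtain ⟨w, hw⟩ := pi_comm hchain hN hπ hl (↑v⁻¹ : R) 1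
      rw [pow_one] at hw
      have h1 : π = z * π * w * π := by
        calc π = π * v * ↑v⁻¹ := by simp
          _ = z * π * (π * ↑v⁻¹) := by rw [hs, mul_assoc]
          _ = _ := by rw [hw]; noncomm_ring
      have h2 : z * π * w ∈ N := two_sided hchain hN (N.mul_mem_left _ hπ) w
      have h3 : 1 - z * π * w ∉ N := by
        intro hh
        exact hN.1.1 ((Ideal.eq_top_iff_one _).2 (by simpa using N.add_mem hh h2))
      obtain ⟨e, he⟩ := unit_of_not_mem hchain hN h3
      have h4 : (e : R) * π = 0 := by rw [he, sub_mul, one_mul, ← h1, sub_self]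
      have h5 : π = 0 := by simpa using h4
      exact ⟨1, isUnit_one, by rw [h5]; simp⟩
    · exact ⟨s, unit_of_not_mem hchain hN hsN, hs⟩
  have hker : (AddMonoidHom.mulLeft π).ker = (AddMonoidHom.mulRight π).ker := by
    ext x
    rw [AddMonoidHom.mem_ker, AddMonoidHom.mem_ker]
    change π * x = 0 ↔ x * π = 0
    obtain ⟨a, w, ⟨w, rfl⟩, rfl⟩ := hval x
    obtain ⟨w', ⟨w', rfl⟩, e⟩ := hu w w.isUnit
    rw [← mul_assoc, e, mul_assoc, mul_assoc, ← pow_succ, ← pow_succ']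
    simp
  have hc : Nat.card (AddMonoidHom.mulLeft π).range = Nat.card (AddMonoidHom.mulRight π).range := by
    rw [← Nat.card_congr (QuotientAddGroup.quotientKerEquivRange (AddMonoidHom.mulLeft π)).toEquiv,
      ← Nat.card_congr (QuotientAddGroup.quotientKerEquivRange (AddMonoidHom.mulRight π)).toEquiv, hker]
  have hsub : ((AddMonoidHom.mulLeft π).range : Set R) ⊆ (AddMonoidHom.mulRight π).range := by
    rintro _ ⟨r, rfl⟩
    obtain ⟨s, hs⟩ := pi_comm hchain hN hπ hl r 1
    rw [pow_one] at hs
    exact ⟨s, hs.symm⟩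
  have heq := Set.eq_of_subset_of_ncard_le hsub (by
    rw [← Nat.card_coe_set_eq, ← Nat.card_coe_set_eq]; exact hc.symm.le) (Set.toFinite _)
  intro x hx
  obtain ⟨y, hy⟩ := hl x hx
  have : x ∈ ((AddMonoidHom.mulLeft π).range : Set R) := by
    rw [heq]; exact ⟨y, hy.symm⟩
  obtain ⟨z, hz⟩ := this
  exact ⟨z, hz.symm⟩

lemma idealPow_eq (hchain : ∀ I J : Ideal R, I ≤ J ∨ J ≤ I) (hN : N.IsMaximal) {π : R} (hπ : π ∈ N)
    (hl : ∀ x ∈ N, ∃ y, x = y * π) (i : ℕ) : idealPow N i = Ideal.span {π ^ i} := by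
  induction i with
  | zero => simp [idealPow]
  | succ i ih =>
    apply le_antisymm
    · rw [idealPow, Submodule.span_le]
      rintro _ ⟨a, ha, b, hb, rfl⟩
      rw [ih] at ha
      obtain ⟨r, rfl⟩ := Ideal.mem_span_singleton'.1 ha
      obtain ⟨s, rfl⟩ := hl b hb
      obtain ⟨w, hw⟩ := pi_comm hchain hN hπ hl s i
      refine Ideal.mem_span_singleton'.2 ⟨r * w, ?_⟩
      rw [mul_assoc, pow_succ, ← mul_assoc w, ← hw]; noncomm_ring
    · rw [Ideal.span_singleton_le_iff_mem, idealPow]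
      refine Submodule.subset_span ⟨π ^ i, ?_, π, hπ, pow_succ _ _⟩
      rw [ih]; exact Ideal.mem_span_singleton_self _

lemma gauss_eq {K V : Type*} [Field K] [Finite K] [AddCommGroup V] [Module K V] [Finite V] {k t : ℕ} (htk : t ≤ k)
    (hkn : k ≤ finrank K V) {T : Submodule K V} (hT : finrank K T = t) :
    gaussBinom (Nat.card K) (finrank K V - t) (k - t) = (star k T).card := by
  have hq := q_pos (K := K)
  have h0 := card_G (K := K) (V := V) k (k - t) (S := T) (by omega) hkn
  have h1 : (star k T).card = (univ.filter fun z : Submodule K V => finrank K z = k ∧ T ≤ z).card := card_Gr_filter _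
  rw [← h1, hT] at h0
  have hbr : ∀ r, Nat.card K ^ r - 1 = br (Nat.card K) r * (Nat.card K - 1) := by
    intro r
    rw [br, geom_sum_mul_of_one_le (by omega)]
  have hpos : 0 < ∏ i ∈ range (k - t), (Nat.card K ^ (k - t - i) - 1) := by
    apply Finset.prod_pos
    intro i hi
    have := Finset.mem_range.1 hi
    rw [hbr]
    exact Nat.mul_pos (br_pos (by omega)) (by omega)
  rw [gaussBinom]
  apply Nat.div_eq_of_eq_mul_left hpos
  simp only [hbr, Finset.prod_mul_distrib]
  rw [← h0, mul_assoc]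

end EKR
end EKRB6

open Module EKR

/-- **Classification of extremal Erdős–Ko–Rado families of Hjelmslev subspaces.**
Let `R` be a finite chain ring of length `m` with maximal ideal `N` and residue field
`F_q`, let `1 ≤ t < k ≤ n/2`, and let `𝓕` be a family of free rank-`k` submodules of
`R^n` any two of which contain a common free rank-`t` submodule. If
`|𝓕| = q^{(m-1)(k-t)(n-k)} · [n-t choose k-t]_q`, then either
(a) `𝓕` is the set of all free rank-`k` submodules containing a fixed free rank-`t`
submodule; or (b) `n = 2k` and `𝓕` is the set of all free rank-`k` submodules contained
in a fixed free rank-`(2k-t)` submodule. -/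
theorem ekr_hjelmslev_equality (q m t k n : ℕ) {R : Type*} [Ring R] [Fintype R]
    (hchain : ∀ I J : Ideal R, I ≤ J ∨ J ≤ I)
    (N : Ideal R) (hN : N.IsMaximal)
    (hnil : idealPow N m = ⊥) (hnil' : idealPow N (m - 1) ≠ ⊥)
    (hq : Nat.card (R ⧸ N) = q) (hq' : IsPrimePow q)
    (ht : 1 ≤ t) (htk : t < k) (hkn : 2 * k ≤ n)
    (𝓕 : Finset (Submodule R (Fin n → R)))
    (hfree : ∀ F ∈ 𝓕, Nonempty (F ≃ₗ[R] (Fin k → R)))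
    (hint : ∀ F ∈ 𝓕, ∀ F' ∈ 𝓕, ∃ U : Submodule R (Fin n → R),
      U ≤ F ⊓ F' ∧ Nonempty (U ≃ₗ[R] (Fin t → R)))
    (hcard : 𝓕.card = q ^ ((m - 1) * (k - t) * (n - k)) * gaussBinom q (n - t) (k - t)) :
    (∃ U : Submodule R (Fin n → R), Nonempty (U ≃ₗ[R] (Fin t → R)) ∧
        ∀ F : Submodule R (Fin n → R),
          F ∈ 𝓕 ↔ (Nonempty (F ≃ₗ[R] (Fin k → R)) ∧ U ≤ F)) ∨
    (n = 2 * k ∧ ∃ U : Submodule R (Fin n → R),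
        Nonempty (U ≃ₗ[R] (Fin (2 * k - t) → R)) ∧
        ∀ F : Submodule R (Fin n → R),
          F ∈ 𝓕 ↔ (Nonempty (F ≃ₗ[R] (Fin k → R)) ∧ F ≤ U)) := by
  classical
  obtain ⟨π, hπ, hl⟩ := exists_pi (N := N) hchain
  obtain ⟨K, _, _, ρ, _, hK, hρ⟩ := exists_field hchain hN
  have hpow := idealPow_eq hchain hN hπ hl
  have hm : 1 ≤ m := by
    by_contra hc
    have : m = 0 := by omega
    subst this
    exact hnil' hnil
  have hpm : π ^ m = 0 := by
    rw [hpow, Ideal.span_singleton_eq_bot] at hnil; exact hnil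
  have hpm' : π ^ (m-1) ≠ 0 := by
    rw [hpow, Ne, Ideal.span_singleton_eq_bot] at hnil'; exact hnil'
  have hcr : CR ρ π m := ⟨hm, fun x hx => unit_of_not_mem hchain hN (fun hh => hx ((hρ x).2 hh)),
    fun x hx => hl x ((hρ x).1 hx), fun x hx => right_gen hchain hN hπ hl hpm x ((hρ x).1 hx), (hρ π).2 hπ, hpm, hpm'⟩
  have hnf : finrank K (Fin n → K) = n := Module.finrank_fin_fun K
  obtain ⟨T0, -, -, hT0⟩ := exists_between (K := K) (V := Fin n → K) (bot_le : ⊥ ≤ (⊤ : Submodule K (Fin n → K))) t (by simp)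
    (by rw [finrank_top, hnf]; omega)
  have hS : Fam ρ π k t 𝓕 := by
    refine ⟨fun F hF => (hcr.of_free (hfree F hF)).1, fun F hF => (hcr.of_free (hfree F hF)).2, fun F hF G hG => ?_⟩
    obtain ⟨U, hU, hUf⟩ := hint F hF G hG
    rw [← (hcr.of_free hUf).2]
    exact Submodule.finrank_mono (res_mono hU)
  obtain ⟨m, rfl⟩ : ∃ m', m = m' + 1 := ⟨m - 1, by omega⟩
  have hmain := mainInd ht htk hkn hT0 m ρ π hcr
  have hg := gauss_eq htk.le (by rw [hnf]; omega) hT0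
  rw [hnf, hK, hq] at hg
  have hc : 𝓕.card = ((Nat.card K ^ (n - k)) ^ (k - t)) ^ m * (star k T0).card := by
    rw [hcard, hK, hq, hg, ← pow_mul, ← pow_mul, Nat.add_sub_cancel]
    congr 2
    ring
  rcases (hmain 𝓕 hS).2 hc with ⟨U, hU, hUr, hUF⟩ | ⟨hn, Q, hQ, hQr, hQF⟩
  · refine Or.inl ⟨U, hcr.free_of hU hUr, fun F => ⟨fun hF => ⟨hfree F hF, hUF F hF⟩, fun hF => ?_⟩⟩
    have h1 := hcr.of_free hF.1
    exact Fam.strong (fun S hS => (hmain S hS).1) hc hS (fun F => U ≤ F) hUF (hcr.pA hUr) F h1.1 h1.2 hF.2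
  · refine Or.inr ⟨hn, Q, hcr.free_of hQ hQr, fun F => ⟨fun hF => ⟨hfree F hF, hQF F hF⟩, fun hF => ?_⟩⟩
    have h1 := hcr.of_free hF.1
    exact Fam.strong (fun S hS => (hmain S hS).1) hc hS (fun F => F ≤ Q) hQF (hcr.pB htk hQ hQr) F h1.1 h1.2 hF.2
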